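/- Suppose assumptions (A1)-(A3) hold and {f_n} is a sequence of hypothesis velocity fields with R(f_n) → 0 as n → ∞. Then for every t ∈ [0,T], W₂²(ρ¹(t,·;f_n), α(t,·)) → 0 as n → ∞. -/

import Mathlib

open MeasureTheory Set
open scoped ENNReal

noncomputable section

abbrev E (d : ℕ) := EuclideanSpace ℝ (Fin d)

def uvec (d : ℕ) (i : Fin d) : E d := EuclideanSpace.single i (1 : ℝ)

/-- The box `𝒳 = [-l/2, l/2]^d`. -/
def box (d : ℕ) (l : ℝ) : Set (E d) := {x | ∀ i, x i ∈ Icc (-(l / 2)) (l / 2)}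

def IsPeriodic {d : ℕ} {β : Type*} (l : ℝ) (g : E d → β) : Prop :=
  ∀ (x : E d) (i : Fin d), g (x + l • uvec d i) = g x

/-- Divergence of a vector field on `ℝ^d`. -/
def diverg {d : ℕ} (F : E d → E d) (x : E d) : ℝ :=
  ∑ i, fderiv ℝ F x (uvec d i) i

/-- Laplacian of a scalar function on `ℝ^d`. -/
def lap {d : ℕ} (φ : E d → ℝ) (x : E d) : ℝ :=
  diverg (fun y => gradient φ y) x

/-- The score (gradient of the log-density) of a positive density. -/
def score {d : ℕ} (g : E d → ℝ) (x : E d) : E d :=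
  gradient (fun y => Real.log (g y)) x

/-- The velocity-consistency transformation `A[f](t,x) = -∇V(t,x) - ∇log ρ¹(t,x;f)`,
expressed through the density trajectory `ρ1` of `f`. -/
def Avf {d : ℕ} (V : ℝ → E d → ℝ) (ρ1 : ℝ → E d → ℝ) (t : ℝ) : E d → E d :=
  fun x => -gradient (V t) x - score (ρ1 t) x

/-- The self-consistency residual `δ(t,x;f) = f(t,x) - A[f](t,x)`. -/
def deltaF {d : ℕ} (f : ℝ → E d → E d) (V ρ1 : ℝ → E d → ℝ) (t : ℝ) : E d → E d :=
  fun x => f t x - Avf V ρ1 t x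

/-- The self-consistency potential
`R(f) = ∫₀ᵀ ∫_𝒳 Σ_{i=0}^{2} ‖δ^{(i)}(t,x;f)‖² ρ¹(t,x;f) dx dt`. -/
def Rloss (d : ℕ) (l T : ℝ) (f : ℝ → E d → E d) (V ρ1 : ℝ → E d → ℝ) : ℝ :=
  ∫ t in (0 : ℝ)..T, ∫ x in box d l,
    (‖deltaF f V ρ1 t x‖ ^ 2 + ‖fderiv ℝ (deltaF f V ρ1 t) x‖ ^ 2
      + ‖fderiv ℝ (fun y => fderiv ℝ (deltaF f V ρ1 t) y) x‖ ^ 2) * ρ1 t x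

/-- The measure on `𝒳` with density `g` w.r.t. Lebesgue measure. -/
def densM {d : ℕ} (l : ℝ) (g : E d → ℝ) : Measure (E d) :=
  (volume.restrict (box d l)).withDensity (fun x => ENNReal.ofReal (g x))

/-- Squared Wasserstein-2 distance, as an infimum over couplings. -/
def W2sq {d : ℕ} (μ ν : Measure (E d)) : ℝ≥0∞ :=
  ⨅ π ∈ {π : Measure (E d × E d) | π.map Prod.fst = μ ∧ π.map Prod.snd = ν},
    ∫⁻ q, ENNReal.ofReal (‖q.1 - q.2‖ ^ 2) ∂π

/-- (A1): regularity of the initial density `α₀`. -/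
def RegInit (d : ℕ) (l L₀ : ℝ) (α₀ : E d → ℝ) : Prop :=
  ∀ x ∈ box d l,
    (∀ i ∈ Finset.Icc 1 3, ‖iteratedFDeriv ℝ i (fun y => Real.log (α₀ y)) x‖ ≤ L₀) ∧
    ‖iteratedFDeriv ℝ 2 (fun y => lap (fun z => Real.log (α₀ z)) y) x‖ ≤ L₀

/-- (A2): regularity of a hypothesis velocity field. -/
def RegVel (d : ℕ) (l T Lf : ℝ) (f : ℝ → E d → E d) : Prop :=
  ∀ t ∈ Icc (0 : ℝ) T, IsPeriodic l (f t) ∧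
    ∀ x ∈ box d l, ∀ i ∈ Finset.Icc 1 4,
      ‖iteratedFDeriv ℝ i (f t) x‖ ≤ Lf ∧
      ‖iteratedFDeriv ℝ i (fun y => diverg (f t) y) x‖ ≤ Lf

/-- (A3): regularity of the drift potential `V`. -/
def RegPot (d : ℕ) (l T Lv : ℝ) (V : ℝ → E d → ℝ) : Prop :=
  ∀ t ∈ Icc (0 : ℝ) T, IsPeriodic l (V t) ∧
    ∀ x ∈ box d l,
      ‖iteratedFDeriv ℝ 2 (V t) x‖ ≤ Lv ∧ ‖iteratedFDeriv ℝ 3 (V t) x‖ ≤ Lv ∧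
      ‖iteratedFDeriv ℝ 2 (fun y => lap (V t) y) x‖ ≤ Lv

/-- `α₀` is a smooth, positive, `l`-periodic probability density on `𝒳`. -/
def InitDensity (d : ℕ) (l : ℝ) (α₀ : E d → ℝ) : Prop :=
  ContDiff ℝ (⊤ : ℕ∞) α₀ ∧ (∀ x, 0 < α₀ x) ∧ IsPeriodic l α₀ ∧ (∫ x in box d l, α₀ x) = 1

/-- `ρ` is the (smooth, positive, periodic) density trajectory transported by the
velocity field `v` from `α₀`, i.e. `ρ(t,·) = X(t,·;v)♯α₀`; equivalently `ρ` solves the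
continuity equation `∂_t ρ + div(ρ v) = 0` with `ρ(0,·) = α₀`. -/
def TransportedBy (d : ℕ) (l : ℝ) (v : ℝ → E d → E d) (α₀ : E d → ℝ)
    (ρ : ℝ → E d → ℝ) : Prop :=
  (∀ t, ContDiff ℝ (⊤ : ℕ∞) (ρ t)) ∧ (∀ t x, 0 < ρ t x) ∧ (∀ t, IsPeriodic l (ρ t)) ∧
  ρ 0 = α₀ ∧
  ∀ t x, HasDerivAt (fun τ => ρ τ x) (-(diverg (fun y => ρ t y • v t y) x)) t

/-- `αs` is the (smooth, positive, periodic) solution of the Fokker–Planck equation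
`∂_t α + div(α(-∇V - ∇log α)) = 0`, i.e. `∂_t α = Δα + div(α ∇V)`, with `α(0,·) = α₀`. -/
def SolvesFPE (d : ℕ) (l : ℝ) (V : ℝ → E d → ℝ) (α₀ : E d → ℝ)
    (αs : ℝ → E d → ℝ) : Prop :=
  (∀ t, ContDiff ℝ (⊤ : ℕ∞) (αs t)) ∧ (∀ t x, 0 < αs t x) ∧ (∀ t, IsPeriodic l (αs t)) ∧
  αs 0 = α₀ ∧
  ∀ t x, HasDerivAt (fun τ => αs τ x)
    (lap (αs t) x + diverg (fun y => αs t y • gradient (V t) y) x) t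

/-- The basis `l e_i` of the period lattice. -/
def latticeBasis (d : ℕ) {l : ℝ} (hl : 0 < l) : Module.Basis (Fin d) ℝ (E d) :=
  (EuclideanSpace.basisFun (Fin d) ℝ).toBasis.isUnitSMul (w := fun _ => l)
    (fun _ => isUnit_iff_ne_zero.2 hl.ne')

/-- The period lattice `l ℤ^d`. -/
abbrev lattice (d : ℕ) {l : ℝ} (hl : 0 < l) : Submodule ℤ (E d) :=
  Submodule.span ℤ (range (latticeBasis d hl))

lemma latticeBasis_apply {d : ℕ} {l : ℝ} (hl : 0 < l) (i : Fin d) :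
    latticeBasis d hl i = l • uvec d i := by
  simp [latticeBasis, Module.Basis.isUnitSMul_apply, uvec]

lemma latticeBasis_repr {d : ℕ} {l : ℝ} (hl : 0 < l) (x : E d) (i : Fin d) :
    (latticeBasis d hl).repr x i = x i / l := by
  have := Module.Basis.repr_isUnitSMul (v := (EuclideanSpace.basisFun (Fin d) ℝ).toBasis)
    (w := fun _ => l) (fun _ => isUnit_iff_ne_zero.2 hl.ne') x i
  rw [latticeBasis, this]
  simp [Units.smul_def, div_eq_inv_mul]

lemma IsPeriodic.add_mem {d : ℕ} {l : ℝ} (hl : 0 < l) {β : Type*} {g : E d → β}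
    (hg : IsPeriodic l g) {z : E d} (hz : z ∈ lattice d hl) : ∀ x, g (x + z) = g x := by
  induction hz using Submodule.span_induction with
  | mem z hz =>
    obtain ⟨i, rfl⟩ := hz
    intro x; rw [latticeBasis_apply]; exact hg x i
  | zero => simp
  | add a b _ _ ha hb => intro x; rw [← add_assoc, hb, ha]
  | smul n a _ ha =>
    have hn : ∀ n : ℕ, ∀ x, g (x + n • a) = g x := by
      intro n
      induction n with
      | zero => simp
      | succ k ih => intro x; rw [succ_nsmul, ← add_assoc, ha, ih]
    intro x
    obtain ⟨m, rfl | rfl⟩ := n.eq_nat_or_neg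
    · simpa using hn m x
    · have := hn m (x + (-(m : ℤ)) • a)
      rw [← this]; simp

lemma isCompact_box (d : ℕ) (l : ℝ) : IsCompact (box d l) := by
  have : box d l = (EuclideanSpace.equiv (Fin d) ℝ) ⁻¹'
      (Set.pi univ fun _ => Icc (-(l / 2)) (l / 2)) := by
    ext x; simp only [box, mem_ofPred_eq, mem_preimage, mem_pi, mem_univ, true_imp_iff]; rfl
  rw [this]
  exact (EuclideanSpace.equiv (Fin d) ℝ).toHomeomorph.isCompact_preimage.2
    (isCompact_univ_pi fun _ => isCompact_Icc)

lemma measurableSet_box (d : ℕ) (l : ℝ) : MeasurableSet (box d l) :=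
  (isCompact_box d l).isClosed.measurableSet

lemma zero_mem_box {d : ℕ} {l : ℝ} (hl : 0 < l) : (0 : E d) ∈ box d l := by
  intro i; constructor <;> simp <;> positivity

lemma volume_box_lt_top (d : ℕ) (l : ℝ) : volume (box d l) < ⊤ := (isCompact_box d l).measure_lt_top

instance instFiniteBox (d : ℕ) (l : ℝ) : IsFiniteMeasure (volume.restrict (box d l)) :=
  ⟨by simpa using volume_box_lt_top d l⟩

lemma exists_lattice_box {d : ℕ} {l : ℝ} (hl : 0 < l) (x : E d) :
    ∃ z ∈ lattice d hl, x + z ∈ box d l := by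
  set c : E d := WithLp.toLp 2 (fun _ => l / 2) with hc
  refine ⟨-(ZSpan.floor (latticeBasis d hl) (x + c) : E d), neg_mem (Subtype.mem _), fun i => ?_⟩
  have h := ZSpan.fract_mem_fundamentalDomain (latticeBasis d hl) (x + c) i
  rw [latticeBasis_repr, ZSpan.fract_apply] at h
  obtain ⟨h1, h2⟩ := h
  rw [le_div_iff₀ hl] at h1
  rw [div_lt_one hl] at h2
  simp only [PiLp.sub_apply, PiLp.add_apply, hc] at h1 h2
  simp only [PiLp.add_apply, PiLp.neg_apply, mem_Icc]
  constructor <;> linarith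

lemma IsPeriodic.forall_of_box {d : ℕ} {l : ℝ} (hl : 0 < l) {β : Type*} {g : E d → β}
    (hg : IsPeriodic l g) {p : β → Prop} (h : ∀ x ∈ box d l, p (g x)) (x : E d) : p (g x) := by
  obtain ⟨z, hz, hx⟩ := exists_lattice_box hl x
  rw [← hg.add_mem hl hz]; exact h _ hx

lemma IsPeriodic.comp_left {d : ℕ} {l : ℝ} {β γ : Type*} {g : E d → β}
    (hg : IsPeriodic l g) (F : β → γ) : IsPeriodic l (fun x => F (g x)) := fun x i => by
  simp only [hg x i]

lemma IsPeriodic.comp₂ {d : ℕ} {l : ℝ} {β γ δ : Type*} {g : E d → β} {h : E d → γ}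
    (hg : IsPeriodic l g) (hh : IsPeriodic l h) (F : β → γ → δ) :
    IsPeriodic l (fun x => F (g x) (h x)) := fun x i => by
  simp only [hg x i, hh x i]

lemma IsPeriodic.fderiv {d : ℕ} {l : ℝ} {G : Type*} [NormedAddCommGroup G] [NormedSpace ℝ G]
    {g : E d → G} (hg : IsPeriodic l g) : IsPeriodic l (fun x => fderiv ℝ g x) := fun x i => by
  have : (fun y => g (y + l • uvec d i)) = g := funext fun y => hg y i
  conv_rhs => rw [← this]
  beta_reduce
  rw [fderiv_comp_add_right]

lemma IsPeriodic.iteratedFDeriv {d : ℕ} {l : ℝ} {G : Type*} [NormedAddCommGroup G]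
    [NormedSpace ℝ G] {g : E d → G} (hg : IsPeriodic l g) (k : ℕ) :
    IsPeriodic l (fun x => iteratedFDeriv ℝ k g x) := fun x i => by
  have : (fun y => g (y + l • uvec d i)) = g := funext fun y => hg y i
  conv_rhs => rw [← this]
  beta_reduce
  rw [iteratedFDeriv_comp_add_right]

lemma IsPeriodic.exists_bound {d : ℕ} {l : ℝ} (hl : 0 < l) {G : Type*} [NormedAddCommGroup G]
    {g : E d → G} (hg : IsPeriodic l g) (hc : Continuous g) : ∃ C, 0 ≤ C ∧ ∀ x, ‖g x‖ ≤ C := by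
  obtain ⟨C, hC⟩ := (isCompact_box d l).exists_bound_of_continuousOn hc.continuousOn
  exact ⟨C, (norm_nonneg _).trans (hC 0 (zero_mem_box hl)),
    hg.forall_of_box hl (p := fun y => ‖y‖ ≤ C) hC⟩

lemma IsPeriodic.exists_min {d : ℕ} {l : ℝ} (hl : 0 < l)
    {g : E d → ℝ} (hg : IsPeriodic l g) (hc : Continuous g) : ∃ x₀ ∈ box d l, ∀ x, g x₀ ≤ g x := by
  obtain ⟨x₀, hx, h⟩ := (isCompact_box d l).exists_isMinOn ⟨0, zero_mem_box hl⟩ hc.continuousOn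
  exact ⟨x₀, hx, hg.forall_of_box hl (p := fun y => g x₀ ≤ y) fun y hy => h hy⟩

open Pointwise in
lemma isAddFundamentalDomain_box_image {d : ℕ} {l : ℝ} (hl : 0 < l) (h : E d) :
    ∃ D : Set (E d), IsAddFundamentalDomain (lattice d hl).toAddSubgroup D volume ∧
      ((fun x => x + h) '' box d l) =ᵐ[volume] D := by
  set c : E d := WithLp.toLp 2 (fun _ => -(l / 2)) with hc
  have h0 := ZSpan.isAddFundamentalDomain' (latticeBasis d hl) (volume : Measure (E d))
  have h1 := h0.vadd_of_comm (h + c)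
  refine ⟨_, h1, ?_⟩
  set e := (MeasurableEquiv.toLp 2 (Fin d → ℝ)).symm with he
  have h1 : (c +ᵥ ZSpan.fundamentalDomain (latticeBasis d hl) : Set (E d))
      = e ⁻¹' (Set.pi univ fun _ => Ico (-(l / 2)) (l / 2)) := by
    ext x
    rw [mem_vadd_set_iff_neg_vadd_mem, ZSpan.mem_fundamentalDomain]
    simp only [latticeBasis_repr, mem_preimage, mem_pi, mem_univ, true_imp_iff, mem_Ico,
      le_div_iff₀ hl, div_lt_one hl]
    refine forall_congr' fun i => ?_
    simp [e, hc]
    constructor <;> rintro ⟨h1, h2⟩ <;> constructor <;> linarith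
  have h2 : (box d l : Set (E d)) = e ⁻¹' (Set.pi univ fun _ => Icc (-(l / 2)) (l / 2)) := by
    ext x; simp only [box, mem_ofPred_eq, mem_preimage, mem_pi, mem_univ, true_imp_iff]; rfl
  have h3 : (box d l : Set (E d)) =ᵐ[volume]
      (c +ᵥ ZSpan.fundamentalDomain (latticeBasis d hl) : Set (E d)) := by
    rw [h1, h2]
    have hq := (EuclideanSpace.volume_preserving_symm_measurableEquiv_toLp
      (Fin d)).quasiMeasurePreserving
    refine hq.preimage_ae_eq ?_
    rw [pi_univ_Icc]
    exact (Measure.univ_pi_Ico_ae_eq_Icc (μ := fun _ : Fin d => (volume : Measure ℝ))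
      (f := fun _ => -(l / 2)) (g := fun _ => l / 2)).symm
  have h4 : ((fun x => x + h) '' box d l) = (fun x => x + -h) ⁻¹' box d l := by
    ext x; simp [← sub_eq_add_neg, image_add_right]
  have h5 : ((h + c) +ᵥ ZSpan.fundamentalDomain (latticeBasis d hl) : Set (E d)) =
     (fun x => x + -h) ⁻¹' (c +ᵥ ZSpan.fundamentalDomain (latticeBasis d hl) : Set (E d)) := by
    ext x
    simp only [mem_vadd_set_iff_neg_vadd_mem, mem_preimage, vadd_eq_add]
    rw [neg_add_rev, add_assoc, add_comm (-h)]
  rw [h4, h5]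
  exact (measurePreserving_add_right (volume : Measure (E d)) (-h)).quasiMeasurePreserving.preimage_ae_eq h3

lemma integral_image_box {d : ℕ} {l : ℝ} {G : Type*} [NormedAddCommGroup G]
    [NormedSpace ℝ G] {g : E d → G} (h : E d) :
    ∫ x in box d l, g (x + h) = ∫ x in (fun x => x + h) '' box d l, g x :=
  ((measurePreserving_add_right (volume : Measure (E d)) h).setIntegral_image_emb
    (measurableEmbedding_addRight h) g (box d l)).symm

lemma integral_box_add {d : ℕ} {l : ℝ} (hl : 0 < l) {G : Type*} [NormedAddCommGroup G]
    [NormedSpace ℝ G] {g : E d → G} (hg : IsPeriodic l g) (h : E d) :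
    ∫ x in box d l, g (x + h) = ∫ x in box d l, g x := by
  obtain ⟨D, hD, hD'⟩ := isAddFundamentalDomain_box_image hl h
  obtain ⟨D0, hD0, hD0'⟩ := isAddFundamentalDomain_box_image (d := d) hl 0
  have : Countable (lattice d hl).toAddSubgroup :=
    inferInstanceAs (Countable (Submodule.span ℤ (range (latticeBasis d hl))))
  rw [integral_image_box, setIntegral_congr_set hD', hD.setIntegral_eq hD0
    (fun z x => by rw [AddSubgroup.vadd_def, vadd_eq_add, add_comm]; exact hg.add_mem hl z.2 x),
    ← setIntegral_congr_set hD0']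
  simp

/-- The `i`-th partial derivative. -/
def pd {d : ℕ} (i : Fin d) (g : E d → ℝ) (x : E d) : ℝ := fderiv ℝ g x (uvec d i)

/-- Smooth `l`-periodic scalar functions. -/
structure SP {d : ℕ} (l : ℝ) (g : E d → ℝ) : Prop where
  smooth : ContDiff ℝ (⊤ : ℕ∞) g
  periodic : IsPeriodic l g

section
variable {d : ℕ} {l : ℝ} {f g : E d → ℝ}

lemma contDiff_pd {g : E d → ℝ} (hg : ContDiff ℝ (⊤ : ℕ∞) g) (i : Fin d) :
    ContDiff ℝ (⊤ : ℕ∞) (pd i g) :=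
  (hg.fderiv_right (m := (⊤ : ℕ∞)) (by simp)).clm_apply contDiff_const

namespace SP

lemma pd (hg : SP l g) (i : Fin d) : SP l (pd i g) :=
  ⟨contDiff_pd hg.smooth i, hg.periodic.fderiv.comp_left (fun L => L (uvec d i))⟩

lemma add (hf : SP l f) (hg : SP l g) : SP l (fun x => f x + g x) :=
  ⟨hf.smooth.add hg.smooth, hf.periodic.comp₂ hg.periodic (· + ·)⟩

lemma sub (hf : SP l f) (hg : SP l g) : SP l (fun x => f x - g x) :=
  ⟨hf.smooth.sub hg.smooth, hf.periodic.comp₂ hg.periodic (· - ·)⟩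

lemma mul (hf : SP l f) (hg : SP l g) : SP l (fun x => f x * g x) :=
  ⟨hf.smooth.mul hg.smooth, hf.periodic.comp₂ hg.periodic (· * ·)⟩

lemma const (c : ℝ) : SP l (fun _ : E d => c) := ⟨contDiff_const, fun _ _ => rfl⟩

lemma neg (hf : SP l f) : SP l (fun x => -f x) :=
  ⟨hf.smooth.neg, hf.periodic.comp_left _⟩

lemma sum {ι : Type*} {s : Finset ι} {f : ι → E d → ℝ} (hf : ∀ i ∈ s, SP l (f i)) :
    SP l (fun x => ∑ i ∈ s, f i x) :=
  ⟨ContDiff.sum fun i hi => (hf i hi).smooth, fun x i => by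
    exact Finset.sum_congr rfl fun j hj => (hf j hj).periodic x i⟩

lemma log (hf : SP l f) (h0 : ∀ x, 0 < f x) : SP l (fun x => Real.log (f x)) :=
  ⟨hf.smooth.log fun x => (h0 x).ne', hf.periodic.comp_left _⟩

lemma continuous (hf : SP l f) : Continuous f := hf.smooth.continuous

lemma differentiable (hf : SP l f) : Differentiable ℝ f := hf.smooth.differentiable (by simp)

lemma exists_bound (hl : 0 < l) (hf : SP l f) : ∃ C, 0 ≤ C ∧ ∀ x, |f x| ≤ C :=
  hf.periodic.exists_bound hl hf.continuous

end SP

lemma hasDerivAt_line (hg : Differentiable ℝ g) (x : E d) (i : Fin d) (s : ℝ) :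
    HasDerivAt (fun s : ℝ => g (x + s • uvec d i)) (pd i g (x + s • uvec d i)) s := by
  have h1 : HasDerivAt (fun s : ℝ => x + s • uvec d i) (uvec d i) s := by
    simpa using ((hasDerivAt_id s).smul_const (uvec d i)).const_add x
  exact (hg _).hasFDerivAt.comp_hasDerivAt s h1

lemma gradient_apply (g : E d → ℝ) (x : E d) (i : Fin d) : gradient g x i = pd i g x := by
  have : inner ℝ (gradient g x) (uvec d i) = fderiv ℝ g x (uvec d i) := by
    rw [gradient, InnerProductSpace.toDual_symm_apply]
  rw [pd, ← this, uvec, EuclideanSpace.inner_single_right]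
  simp

lemma fderiv_coord {F : E d → E d} {x : E d} (hF : DifferentiableAt ℝ F x) (v : E d) (i : Fin d) :
    fderiv ℝ (fun y => F y i) x v = fderiv ℝ F x v i := by
  have := (EuclideanSpace.proj i : E d →L[ℝ] ℝ).hasFDerivAt.comp x hF.hasFDerivAt
  exact congrArg (fun L : E d →L[ℝ] ℝ => L v) this.fderiv

lemma diverg_eq {F : E d → E d} {x : E d} (hF : DifferentiableAt ℝ F x) :
    diverg F x = ∑ i, pd i (fun y => F y i) x := by
  simp only [diverg, pd, fderiv_coord hF]

lemma contDiff_coord_iff {n : WithTop ℕ∞} {F : E d → E d} :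
    ContDiff ℝ n F ↔ ∀ i, ContDiff ℝ n (fun x => F x i) := contDiff_euclidean

lemma contDiff_gradient (hg : ContDiff ℝ (⊤ : ℕ∞) g) :
    ContDiff ℝ (⊤ : ℕ∞) (fun x => gradient g x) :=
  contDiff_coord_iff.2 fun i => by simpa only [gradient_apply] using contDiff_pd hg i

lemma lap_eq (hg : ContDiff ℝ (⊤ : ℕ∞) g) (x : E d) : lap g x = ∑ i, pd i (pd i g) x := by
  rw [lap, diverg_eq ((contDiff_gradient hg).differentiable (by simp) x)]
  simp only [gradient_apply]

lemma pd_add (hf : Differentiable ℝ f) (hg : Differentiable ℝ g) (i : Fin d) (x : E d) :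
    pd i (fun y => f y + g y) x = pd i f x + pd i g x := by
  simp [pd, fderiv_fun_add (hf x) (hg x)]

lemma pd_sub (hf : Differentiable ℝ f) (hg : Differentiable ℝ g) (i : Fin d) (x : E d) :
    pd i (fun y => f y - g y) x = pd i f x - pd i g x := by
  simp [pd, fderiv_fun_sub (hf x) (hg x)]

lemma pd_mul (hf : Differentiable ℝ f) (hg : Differentiable ℝ g) (i : Fin d) (x : E d) :
    pd i (fun y => f y * g y) x = pd i f x * g x + f x * pd i g x := by
  simp [pd, fderiv_fun_mul (hf x) (hg x)]; ring

lemma pd_const (c : ℝ) (i : Fin d) (x : E d) : pd i (fun _ => c) x = 0 := by simp [pd]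

lemma pd_const_mul (hf : Differentiable ℝ f) (c : ℝ) (i : Fin d) (x : E d) :
    pd i (fun y => c * f y) x = c * pd i f x := by
  rw [pd_mul (differentiable_const c) hf, pd_const]; ring

lemma pd_log (hf : Differentiable ℝ f) (h0 : ∀ x, 0 < f x) (i : Fin d) (x : E d) :
    pd i (fun y => Real.log (f y)) x = pd i f x / f x := by
  have := (hf x).hasFDerivAt.log (h0 x).ne'
  rw [pd, this.fderiv]; simp [pd, div_eq_inv_mul]

lemma integrableOn_box {G : Type*} [NormedAddCommGroup G] {h : E d → G} (hh : Continuous h) :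
    IntegrableOn h (box d l) := hh.continuousOn.integrableOn_compact (isCompact_box d l)

lemma integral_pd_eq_zero (hl : 0 < l) (hg : SP l g) (i : Fin d) :
    ∫ x in box d l, pd i g x = 0 := by
  obtain ⟨C, hC0, hC⟩ := (hg.pd i).exists_bound hl
  have h := hasDerivAt_integral_of_dominated_loc_of_deriv_le (μ := volume.restrict (box d l))
    (F := fun (s : ℝ) x => g (x + s • uvec d i))
    (F' := fun (s : ℝ) x => pd i g (x + s • uvec d i)) (x₀ := (0 : ℝ)) (s := univ)
    (bound := fun _ => C) Filter.univ_mem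
    (Filter.Eventually.of_forall fun s =>
      (hg.continuous.comp (by fun_prop)).aestronglyMeasurable)
    (integrableOn_box (hg.continuous.comp (by fun_prop)))
    (((hg.pd i).continuous.comp (by fun_prop)).aestronglyMeasurable)
    (Filter.Eventually.of_forall fun x s _ => hC _)
    (integrable_const _)
    (Filter.Eventually.of_forall fun x s _ => hasDerivAt_line hg.differentiable x i s)
  have h2 := h.2
  simp only [integral_box_add hl hg.periodic] at h2
  simpa using (h2.unique (hasDerivAt_const _ _))

lemma integral_pd_mul (hl : 0 < l) (hf : SP l f) (hg : SP l g) (i : Fin d) :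
    ∫ x in box d l, pd i f x * g x = -∫ x in box d l, f x * pd i g x := by
  have h := integral_pd_eq_zero hl (hf.mul hg) i
  simp only [pd_mul hf.differentiable hg.differentiable] at h
  rw [integral_add (integrableOn_box ((hf.pd i).mul hg).continuous)
    (integrableOn_box (hf.mul (hg.pd i)).continuous)] at h
  linarith

lemma pd_eq_zero_of_min {x₀ : E d} (h : ∀ x, g x₀ ≤ g x) (i : Fin d) : pd i g x₀ = 0 := by
  have : IsLocalMin g x₀ := Filter.Eventually.of_forall h
  rw [pd, this.fderiv_eq_zero]; rfl

lemma pd_pd_nonneg_of_min (hg : ContDiff ℝ (⊤ : ℕ∞) g) {x₀ : E d} (h : ∀ x, g x₀ ≤ g x)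
    (i : Fin d) : 0 ≤ pd i (pd i g) x₀ := by
  by_contra! hneg
  set φ : ℝ → ℝ := fun s => g (x₀ + s • uvec d i)
  have h1 : deriv φ = fun s => pd i g (x₀ + s • uvec d i) :=
    funext fun s => (hasDerivAt_line (hg.differentiable (by simp)) x₀ i s).deriv
  have h2 : deriv (deriv φ) 0 = pd i (pd i g) x₀ := by
    rw [h1, (hasDerivAt_line ((contDiff_pd hg i).differentiable (by simp)) x₀ i 0).deriv]; simp
  have hd0 : deriv φ 0 = 0 := by rw [h1]; simpa using pd_eq_zero_of_min h i
  have hmax := isLocalMax_of_deriv_deriv_neg (f := φ) (x₀ := 0) (by rw [h2]; exact hneg) hd0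
    ((hasDerivAt_line (hg.differentiable (by simp)) x₀ i 0).continuousAt)
  have hconst : φ =ᶠ[nhds 0] fun _ => φ 0 := by
    filter_upwards [hmax] with s hs
    exact le_antisymm hs (by simpa [φ] using h (x₀ + s • uvec d i))
  have h3 : deriv φ =ᶠ[nhds 0] fun _ => 0 := by
    filter_upwards [hconst.deriv] with s hs
    rw [hs]; simp
  have h4 := h3.deriv_eq
  rw [h2] at h4
  simp at h4; linarith

end

/-- The Fokker–Planck operator `Δg + div(g ∇W)` in coordinates. -/
def fpOp {d : ℕ} (W g : E d → ℝ) (x : E d) : ℝ :=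
  (∑ i, pd i (pd i g) x) + (∑ i, pd i W x * pd i g x) + (∑ i, pd i (pd i W) x) * g x

/-- A positive smooth periodic pointwise solution of a Fokker–Planck equation on `[0,T]`. -/
structure FPData {d : ℕ} (l T B : ℝ) (V α : ℝ → E d → ℝ) : Prop where
  hl : 0 < l
  hB : 0 ≤ B
  sV : ∀ t ∈ Icc 0 T, SP l (V t)
  sα : ∀ t ∈ Icc 0 T, SP l (α t)
  pos : ∀ t ∈ Icc 0 T, ∀ x, 0 < α t x
  bV : ∀ t ∈ Icc 0 T, ∀ x i, |pd i (V t) x| ≤ B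
  bV2 : ∀ t ∈ Icc 0 T, ∀ x, |∑ i, pd i (pd i (V t)) x| ≤ B
  der : ∀ t ∈ Icc 0 T, ∀ x, HasDerivAt (fun τ => α τ x) (fpOp (V t) (α t) x) t

/-- Right uniform continuity in time at `t`, within `[0,T]`. -/
def RUC {d : ℕ} (T : ℝ) (α : ℝ → E d → ℝ) (t : ℝ) : Prop :=
  ∀ ε > 0, ∃ δ > 0, ∀ s ∈ Icc t (t + δ), s ≤ T → ∀ x, |α s x - α t x| ≤ ε

section
variable {d : ℕ} {l T B : ℝ} {V α : ℝ → E d → ℝ}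

/-- A minimum principle for periodic functions that are only right uniformly continuous in time. -/
lemma pos_of_touching {w : ℝ → E d → ℝ} (hl : 0 < l) {s₀ s₁ : ℝ}
    (hw : ∀ s ∈ Icc s₀ s₁, SP l (w s))
    (hruc : ∀ t ∈ Ico s₀ s₁, ∀ ε > 0, ∃ δ > 0, ∀ s ∈ Icc t (t + δ), s ≤ s₁ →
      ∀ x, w t x - ε ≤ w s x)
    (h0 : ∀ x, 0 < w s₀ x)
    (hder : ∀ s ∈ Ioc s₀ s₁, ∀ x, ∃ w', HasDerivAt (fun τ => w τ x) w' s ∧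
      ((∀ y, 0 ≤ w s y) → w s x = 0 → 0 < w')) :
    ∀ s ∈ Icc s₀ s₁, ∀ x, 0 < w s x := by
  by_contra! hcon
  obtain ⟨s, hs, x, hx⟩ := hcon
  set S : Set ℝ := {s | s ∈ Icc s₀ s₁ ∧ ∃ x, w s x ≤ 0} with hS
  have hSn : S.Nonempty := ⟨s, hs, x, hx⟩
  have hSb : BddBelow S := ⟨s₀, fun s h => h.1.1⟩
  set σ := sInf S with hσ
  have hσ0 : s₀ ≤ σ := le_csInf hSn fun s h => h.1.1
  have hσ1 : σ ≤ s₁ := (csInf_le hSb ⟨hs, x, hx⟩).trans hs.2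
  have hbelow : ∀ τ, s₀ ≤ τ → τ < σ → ∀ y, 0 < w τ y := by
    intro τ h1 h2 y
    by_contra! h3
    exact absurd (csInf_le hSb (show τ ∈ S from ⟨⟨h1, h2.le.trans hσ1⟩, y, h3⟩)) (not_le.2 h2)
  have hσS : ∃ x, w σ x ≤ 0 := by
    by_contra! hpos
    obtain ⟨x₀, -, hx₀⟩ := (hw σ ⟨hσ0, hσ1⟩).periodic.exists_min hl (hw σ ⟨hσ0, hσ1⟩).continuous
    have hlt : σ < s₁ := by
      rcases hσ1.lt_or_eq with h | h
      · exact h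
      · exfalso
        have : s = σ := le_antisymm (h ▸ hs.2) (csInf_le hSb ⟨hs, x, hx⟩)
        rw [this] at hx
        exact absurd hx (not_le.2 (hpos x))
    obtain ⟨δ, hδ, h⟩ := hruc σ ⟨hσ0, hlt⟩ (w σ x₀ / 2) (half_pos (hpos x₀))
    obtain ⟨τ, hτS, hτ⟩ := exists_lt_of_csInf_lt hSn (show sInf S < σ + δ by linarith)
    obtain ⟨y, hy⟩ := hτS.2
    have := h τ ⟨csInf_le hSb hτS, hτ.le⟩ hτS.1.2 y
    have := hx₀ y
    have := hpos x₀
    linarith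
  obtain ⟨x, hx⟩ := hσS
  have hσlt : s₀ < σ := by
    rcases hσ0.lt_or_eq with h | h
    · exact h
    · rw [← h] at hx; exact absurd hx (not_le.2 (h0 x))
  have hmem : ∀ᶠ τ in nhdsWithin σ (Iio σ), s₀ ≤ τ ∧ τ < σ := by
    filter_upwards [self_mem_nhdsWithin, mem_nhdsWithin_of_mem_nhds (lt_mem_nhds hσlt)]
      with τ h1 h2 using ⟨le_of_lt h2, h1⟩
  have hnn : ∀ y, 0 ≤ w σ y := by
    intro y
    obtain ⟨w', hw', -⟩ := hder σ ⟨hσlt, hσ1⟩ y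
    have := (hw'.continuousAt.tendsto).mono_left (nhdsWithin_le_nhds (s := Iio σ))
    refine ge_of_tendsto this ?_
    filter_upwards [hmem] with τ hτ using (hbelow τ hτ.1 hτ.2 y).le
  obtain ⟨w', hw', hp⟩ := hder σ ⟨hσlt, hσ1⟩ x
  have hx0 : w σ x = 0 := le_antisymm hx (hnn x)
  have hpos := hp hnn hx0
  have hle : w' ≤ 0 := by
    have h1 := (hasDerivWithinAt_iff_tendsto_slope' (s := Iio σ) (by simp)).1
      (hw'.hasDerivWithinAt)
    refine le_of_tendsto h1 ?_
    filter_upwards [hmem] with τ hτ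
    rw [slope_def_field, hx0]
    have := hbelow τ hτ.1 hτ.2 x
    exact div_nonpos_of_nonneg_of_nonpos (by linarith) (by linarith [hτ.2])
  linarith

lemma sum_pd_pd_nonneg_of_min {g : E d → ℝ} (hg : ContDiff ℝ (⊤ : ℕ∞) g) {x₀ : E d}
    (h : ∀ x, g x₀ ≤ g x) : 0 ≤ ∑ i, pd i (pd i g) x₀ :=
  Finset.sum_nonneg fun i _ => pd_pd_nonneg_of_min hg h i

namespace FPData

/-- Uniform Lipschitz estimate forward in time. -/
lemma abs_sub_le (h : FPData l T B V α) {s₀ s₁ C₀ : ℝ} (hs0 : 0 ≤ s₀) (hs1 : s₁ ≤ T)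
    (hC0 : 0 ≤ C₀) (hruc : ∀ t ∈ Ico s₀ s₁, RUC T α t)
    (hC : ∀ s ∈ Icc s₀ s₁, ∀ x, |fpOp (V s) (α s₀) x| ≤ C₀) :
    ∀ s ∈ Icc s₀ s₁, ∀ x, |α s x - α s₀ x| ≤ C₀ * (s - s₀) * Real.exp (B * (s - s₀)) := by
  have key : ∀ σ : ℝ, |σ| = 1 → ∀ ε > 0, ∀ s ∈ Icc s₀ s₁, ∀ x, 0 < σ * (α s x - α s₀ x) +
      (ε + (C₀ + ε) * (s - s₀)) * Real.exp (B * (s - s₀)) := by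
    intro σ hσ ε hε
    refine pos_of_touching (w := fun s x => σ * (α s x - α s₀ x) +
      (ε + (C₀ + ε) * (s - s₀)) * Real.exp (B * (s - s₀))) h.hl ?_ ?_ ?_ ?_
    · intro s hs
      have a := h.sα s ⟨hs0.trans hs.1, hs.2.trans hs1⟩
      have b := h.sα s₀ ⟨hs0, (hs.1.trans hs.2).trans hs1⟩
      exact ((SP.const σ).mul (a.sub b)).add (SP.const _)
    · intro t ht ε' hε'
      obtain ⟨δ, hδ, hh⟩ := hruc t ht ε' hε'
      refine ⟨δ, hδ, fun s hs hss x => ?_⟩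
      have h1 := hh s hs (hss.trans hs1) x
      have h2 : -(ε') ≤ σ * (α s x - α t x) := by
        have : |σ * (α s x - α t x)| ≤ ε' := by rw [abs_mul, hσ, one_mul]; exact h1
        exact (abs_le.1 this).1
      have h3 : (ε + (C₀ + ε) * (t - s₀)) * Real.exp (B * (t - s₀)) ≤
          (ε + (C₀ + ε) * (s - s₀)) * Real.exp (B * (s - s₀)) := by
        have := hs.1
        have := ht.1
        have := h.hB
        have : 0 ≤ s - s₀ := by linarith
        gcongr
      have h4 : σ * (α s x - α s₀ x) = σ * (α t x - α s₀ x) + σ * (α s x - α t x) := by ring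
      linarith
    · intro x; simp [hε]
    · intro s hs x
      have hsT : s ∈ Icc 0 T := ⟨hs0.trans hs.1.le, hs.2.trans hs1⟩
      have hs0T : s₀ ∈ Icc 0 T := ⟨hs0, (hs.1.le.trans hs.2).trans hs1⟩
      have a := h.sα s hsT
      have b := h.sα s₀ hs0T
      have hη : HasDerivAt (fun s => (ε + (C₀ + ε) * (s - s₀)) * Real.exp (B * (s - s₀)))
          ((C₀ + ε) * Real.exp (B * (s - s₀)) +
            (ε + (C₀ + ε) * (s - s₀)) * (Real.exp (B * (s - s₀)) * B)) s := by
        have h1 : HasDerivAt (fun s => ε + (C₀ + ε) * (s - s₀)) (C₀ + ε) s := by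
          simpa using (((hasDerivAt_id s).sub_const s₀).const_mul (C₀ + ε)).const_add ε
        have h2 : HasDerivAt (fun s => B * (s - s₀)) B s := by
          simpa using (((hasDerivAt_id s).sub_const s₀).const_mul B)
        exact h1.mul h2.exp
      refine ⟨_, (((h.der s hsT x).sub_const _).const_mul σ).add hη, ?_⟩
      intro hnn hz
      set η := (ε + (C₀ + ε) * (s - s₀)) * Real.exp (B * (s - s₀)) with hηdef
      have hW : SP l (fun y => σ * (α s y - α s₀ y) + η) :=
        ((SP.const σ).mul (a.sub b)).add (SP.const _)
      have hmin : ∀ y, σ * (α s x - α s₀ x) + η ≤ σ * (α s y - α s₀ y) + η := by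
        intro y; have := hnn y; rw [hz]; exact this
      have pd1 : ∀ i, pd i (fun y => σ * (α s y - α s₀ y) + η) =
          fun y => σ * (pd i (α s) y - pd i (α s₀) y) := by
        intro i; ext y
        rw [pd_add ((SP.const σ).mul (a.sub b)).differentiable (differentiable_const _), pd_const,
          pd_const_mul (a.sub b).differentiable, pd_sub a.differentiable b.differentiable, add_zero]
      have pd2 : ∀ i y, pd i (pd i (fun y => σ * (α s y - α s₀ y) + η)) y =
          σ * (pd i (pd i (α s)) y - pd i (pd i (α s₀)) y) := by
        intro i y
        rw [pd1, pd_const_mul ((a.pd i).sub (b.pd i)).differentiable,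
          pd_sub (a.pd i).differentiable (b.pd i).differentiable]
      have g1 : ∀ i, σ * (pd i (α s) x - pd i (α s₀) x) = 0 := by
        intro i
        have := pd_eq_zero_of_min (g := fun y => σ * (α s y - α s₀ y) + η) hmin i
        rwa [pd1] at this
      have g2 := sum_pd_pd_nonneg_of_min hW.smooth hmin
      simp only [pd2] at g2
      have e1 : σ * fpOp (V s) (α s) x = σ * fpOp (V s) (α s₀) x
          + ∑ i, σ * (pd i (pd i (α s)) x - pd i (pd i (α s₀)) x)
          + ∑ i, pd i (V s) x * (σ * (pd i (α s) x - pd i (α s₀) x))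
          + (∑ i, pd i (pd i (V s)) x) * (σ * (α s x - α s₀ x)) := by
        simp only [fpOp, mul_sub, mul_add, Finset.sum_sub_distrib, Finset.mul_sum,
          mul_left_comm _ σ, Finset.sum_mul]
        ring
      simp only [g1, mul_zero, Finset.sum_const_zero, add_zero] at e1
      have hz' : σ * (α s x - α s₀ x) = -η := by linarith
      rw [hz'] at e1
      have hσ1 : -C₀ ≤ σ * fpOp (V s) (α s₀) x := by
        have : |σ * fpOp (V s) (α s₀) x| ≤ C₀ := by
          rw [abs_mul, hσ, one_mul]; exact hC s ⟨hs.1.le, hs.2⟩ x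
        exact (abs_le.1 this).1
      have hs' := hs.1
      have hηnn : 0 ≤ η := by
        have : 0 ≤ s - s₀ := by linarith
        positivity
      have hc := (abs_le.1 (h.bV2 s hsT x)).2
      have hcη : (∑ i, pd i (pd i (V s)) x) * η ≤ B * η := mul_le_mul_of_nonneg_right hc hηnn
      have hexp : 1 ≤ Real.exp (B * (s - s₀)) :=
        Real.one_le_exp (mul_nonneg h.hB (by linarith))
      have hCe : C₀ + ε ≤ (C₀ + ε) * Real.exp (B * (s - s₀)) :=
        le_mul_of_one_le_right (by linarith) hexp
      have e2 : (ε + (C₀ + ε) * (s - s₀)) * (Real.exp (B * (s - s₀)) * B) = B * η := by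
        rw [hηdef]; ring
      rw [e2, e1]
      linarith
  intro s hs x
  have lim : Filter.Tendsto (fun ε : ℝ => (ε + (C₀ + ε) * (s - s₀)) * Real.exp (B * (s - s₀)))
      (nhdsWithin 0 (Ioi 0)) (nhds (C₀ * (s - s₀) * Real.exp (B * (s - s₀)))) := by
    have : Continuous (fun ε : ℝ => (ε + (C₀ + ε) * (s - s₀)) * Real.exp (B * (s - s₀))) := by
      fun_prop
    have h2 := (this.tendsto 0).mono_left (nhdsWithin_le_nhds (s := Ioi 0))
    simpa using h2
  rw [abs_le]
  constructor
  · have : -(α s x - α s₀ x) ≤ C₀ * (s - s₀) * Real.exp (B * (s - s₀)) := by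
      refine ge_of_tendsto lim ?_
      filter_upwards [self_mem_nhdsWithin] with ε hε
      have := key 1 (by simp) ε hε s hs x
      linarith
    linarith
  · refine ge_of_tendsto lim ?_
    filter_upwards [self_mem_nhdsWithin] with ε hε
    have := key (-1) (by simp) ε hε s hs x
    linarith

/-- Uniform positivity. -/
lemma exists_lower_bound (h : FPData l T B V α) (hruc : ∀ t ∈ Ico 0 T, RUC T α t) :
    ∃ m > 0, ∀ s ∈ Icc 0 T, ∀ x, m ≤ α s x := by
  rcases lt_or_ge T 0 with hT | hT
  · exact ⟨1, one_pos, fun s hs => absurd (hs.1.trans hs.2) (not_le.2 hT)⟩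
  have h00 : (0 : ℝ) ∈ Icc 0 T := ⟨le_rfl, hT⟩
  obtain ⟨x₀, -, hx₀⟩ := (h.sα 0 h00).periodic.exists_min h.hl (h.sα 0 h00).continuous
  set m := α 0 x₀ / 2 with hm
  have hmpos : 0 < m := half_pos (h.pos 0 h00 x₀)
  have key : ∀ s ∈ Icc 0 T, ∀ x, 0 < α s x - m * Real.exp (-(B + 1) * s) := by
    refine pos_of_touching (w := fun s x => α s x - m * Real.exp (-(B + 1) * s)) h.hl ?_ ?_ ?_ ?_
    · intro s hs
      exact (h.sα s hs).sub (SP.const _)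
    · intro t ht ε hε
      obtain ⟨δ, hδ, hh⟩ := hruc t ht ε hε
      refine ⟨δ, hδ, fun s hs hss x => ?_⟩
      have h1 := (abs_le.1 (hh s hs hss x)).1
      have h3 : m * Real.exp (-(B + 1) * s) ≤ m * Real.exp (-(B + 1) * t) := by
        refine mul_le_mul_of_nonneg_left (Real.exp_le_exp.2 ?_) hmpos.le
        have := hs.1
        have := h.hB
        nlinarith
      linarith
    · intro x
      have := hx₀ x
      simp
      linarith
    · intro s hs x
      have hsT : s ∈ Icc 0 T := ⟨hs.1.le, hs.2⟩
      have a := h.sα s hsT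
      have hη : HasDerivAt (fun s => m * Real.exp (-(B + 1) * s))
          (m * (Real.exp (-(B + 1) * s) * (-(B + 1)))) s := by
        have h2 : HasDerivAt (fun s => -(B + 1) * s) (-(B + 1)) s := by
          simpa using ((hasDerivAt_id s).const_mul (-(B + 1)))
        exact h2.exp.const_mul m
      refine ⟨_, (h.der s hsT x).sub hη, ?_⟩
      intro hnn hz
      set η := m * Real.exp (-(B + 1) * s) with hηdef
      have hmin : ∀ y, α s x ≤ α s y := by
        intro y; have := hnn y; linarith
      have g1 : ∀ i, pd i (α s) x = 0 := fun i => pd_eq_zero_of_min hmin i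
      have g2 := sum_pd_pd_nonneg_of_min a.smooth hmin
      have hc := (abs_le.1 (h.bV2 s hsT x)).1
      have hp := h.pos s hsT x
      have hcη := mul_le_mul_of_nonneg_right hc hp.le
      have hη2 : m * (Real.exp (-(B + 1) * s) * (-(B + 1))) = -(B + 1) * α s x := by
        rw [show α s x = η by linarith, hηdef]; ring
      rw [hη2]
      simp only [fpOp, g1, mul_zero, Finset.sum_const_zero, add_zero]
      linarith
  refine ⟨m * Real.exp (-(B + 1) * T), by positivity, fun s hs x => ?_⟩
  have h1 := key s hs x
  have h3 : m * Real.exp (-(B + 1) * T) ≤ m * Real.exp (-(B + 1) * s) := by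
    refine mul_le_mul_of_nonneg_left (Real.exp_le_exp.2 ?_) hmpos.le
    have := hs.2
    have := h.hB
    nlinarith
  linarith

end FPData

end

/-- Differentiation under the integral sign from the right. -/
lemma hasDerivWithinAt_integral_right {X : Type*} [MeasurableSpace X] {μ : Measure X}
    {F : ℝ → X → ℝ} {F' b : X → ℝ} {s : ℝ} (hFs : Integrable (F s) μ)
    (hmeas : ∀ᶠ r in nhdsWithin s (Ioi s), AEStronglyMeasurable (F r) μ)
    (hb : Integrable b μ)
    (hbound : ∀ᶠ r in nhdsWithin s (Ioi s), ∀ x, |F r x - F s x| ≤ b x * (r - s))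
    (hder : ∀ x, HasDerivWithinAt (fun r => F r x) (F' x) (Ioi s) s) :
    HasDerivWithinAt (fun r => ∫ x, F r x ∂μ) (∫ x, F' x ∂μ) (Ioi s) s := by
  rw [hasDerivWithinAt_iff_tendsto_slope' (by simp)]
  have h1 : Filter.Tendsto (fun r => ∫ x, slope (fun r => F r x) s r ∂μ)
      (nhdsWithin s (Ioi s)) (nhds (∫ x, F' x ∂μ)) := by
    refine tendsto_integral_filter_of_dominated_convergence b ?_ ?_ hb ?_
    · filter_upwards [hmeas] with r hr
      simp only [slope_def_field]
      simpa only [div_eq_mul_inv, Pi.sub_apply] using (hr.sub hFs.1).mul_const (r - s)⁻¹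
    · filter_upwards [hbound, self_mem_nhdsWithin] with r hr hrs
      refine Filter.Eventually.of_forall fun x => ?_
      have : 0 < r - s := sub_pos.2 hrs
      rw [slope_def_field, Real.norm_eq_abs, abs_div, abs_of_pos this, div_le_iff₀ this]
      exact hr x
    · exact Filter.Eventually.of_forall fun x =>
        (hasDerivWithinAt_iff_tendsto_slope' (by simp)).1 (hder x)
  refine h1.congr' ?_
  filter_upwards [hmeas, hbound, self_mem_nhdsWithin] with r hr hrb hrs
  have hFr : Integrable (F r) μ := by
    have : Integrable (fun x => F r x - F s x) μ :=
      (hb.mul_const (r - s)).mono' (hr.sub hFs.1) (Filter.Eventually.of_forall hrb)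
    exact (this.add hFs).congr (Filter.Eventually.of_forall fun x => by simp)
  simp only [slope_def_field]
  rw [integral_div, integral_sub hFr hFs]

section
variable {d : ℕ} {l T B : ℝ} {V α : ℝ → E d → ℝ}

/-- The Gaussian `exp(c - b|x|²)`. -/
def gauss {d : ℕ} (c b : ℝ) (x : E d) : ℝ := Real.exp (c - b * ‖x‖ ^ 2)

lemma gauss_pos (c b : ℝ) (x : E d) : 0 < gauss c b x := Real.exp_pos _

lemma continuous_gauss (c b : ℝ) : Continuous (gauss c b : E d → ℝ) := by
  unfold gauss; fun_prop

lemma integral_gauss {b : ℝ} (hb : 0 < b) (c : ℝ) :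
    ∫ x : E d, gauss c b x = Real.exp c * (Real.pi / b) ^ (d / 2 : ℝ) := by
  have h := GaussianFourier.integral_rexp_neg_mul_sq_norm (V := E d) hb
  rw [finrank_euclideanSpace_fin] at h
  rw [← h, ← integral_const_mul]
  congr 1; ext x
  rw [gauss, ← Real.exp_add]; ring_nf

lemma integrable_gauss {b : ℝ} (hb : 0 < b) (c : ℝ) : Integrable (gauss c b : E d → ℝ) := by
  by_contra h
  have h1 := integral_gauss (d := d) hb c
  rw [integral_undef h] at h1
  have : 0 < Real.exp c * (Real.pi / b) ^ (d / 2 : ℝ) := by positivity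
  linarith

lemma gauss_mul_le {b : ℝ} (hb : 0 < b) (c : ℝ) (x : E d) :
    gauss c b x * (1 + ‖x‖ ^ 2) ≤ (1 + 2 / b) * gauss c (b / 2) x := by
  have h1 : gauss c b x = gauss c (b / 2) x * Real.exp (-(b / 2 * ‖x‖ ^ 2)) := by
    rw [gauss, gauss, ← Real.exp_add]; ring_nf
  have h2 : 1 + b / 2 * ‖x‖ ^ 2 ≤ Real.exp (b / 2 * ‖x‖ ^ 2) := by
    linarith [Real.add_one_le_exp (b / 2 * ‖x‖ ^ 2)]
  have h3 : (1 + ‖x‖ ^ 2) ≤ (1 + 2 / b) * (1 + b / 2 * ‖x‖ ^ 2) := by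
    have : (1 + 2 / b) * (1 + b / 2 * ‖x‖ ^ 2) =
      1 + ‖x‖ ^ 2 + (2 / b + b / 2 * ‖x‖ ^ 2) := by field_simp; ring
    rw [this]
    have : 0 ≤ 2 / b + b / 2 * ‖x‖ ^ 2 := by positivity
    linarith
  have h4 : Real.exp (-(b / 2 * ‖x‖ ^ 2)) * (1 + ‖x‖ ^ 2) ≤ 1 + 2 / b := by
    rw [Real.exp_neg, inv_mul_le_iff₀ (Real.exp_pos _)]
    have : 0 < 1 + 2 / b := by positivity
    nlinarith
  rw [h1, mul_assoc, mul_comm (1 + 2 / b)]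
  exact mul_le_mul_of_nonneg_left h4 (gauss_pos _ _ _).le

lemma integrable_gauss_mul {b : ℝ} (hb : 0 < b) (c : ℝ) {u : E d → ℝ} (hu : Continuous u) {K : ℝ}
    (hK : ∀ x, |u x| ≤ K * (1 + ‖x‖ ^ 2)) : Integrable (fun x => gauss c b x * u x) := by
  have hK0 : 0 ≤ K := by
    have := (abs_nonneg _).trans (hK 0); simpa using this
  refine ((integrable_gauss (half_pos hb) c).const_mul (K * (1 + 2 / b))).mono'
    ((continuous_gauss c b).mul hu).aestronglyMeasurable (Filter.Eventually.of_forall fun x => ?_)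
  rw [Real.norm_eq_abs, abs_mul, abs_of_pos (gauss_pos _ _ _)]
  calc gauss c b x * |u x| ≤ gauss c b x * (K * (1 + ‖x‖ ^ 2)) :=
        mul_le_mul_of_nonneg_left (hK x) (gauss_pos _ _ _).le
    _ = K * (gauss c b x * (1 + ‖x‖ ^ 2)) := by ring
    _ ≤ K * ((1 + 2 / b) * gauss c (b / 2) x) :=
        mul_le_mul_of_nonneg_left (gauss_mul_le hb c x) hK0
    _ = _ := by ring

lemma integrable_gauss_mul_bdd {b : ℝ} (hb : 0 < b) (c : ℝ) {u : E d → ℝ} (hu : Continuous u)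
    {K : ℝ} (hK : ∀ x, |u x| ≤ K) : Integrable (fun x => gauss c b x * u x) :=
  integrable_gauss_mul hb c hu (K := K) fun x => (hK x).trans (by
    have := (abs_nonneg _).trans (hK x)
    nlinarith [sq_nonneg ‖x‖])

lemma abs_coord_le (x : E d) (i : Fin d) : |x i| ≤ ‖x‖ := PiLp.norm_apply_le x i

lemma contDiff_gauss (c b : ℝ) : ContDiff ℝ (⊤ : ℕ∞) (gauss c b : E d → ℝ) := by
  unfold gauss
  exact (contDiff_const.sub (contDiff_const.mul (contDiff_norm_sq ℝ))).exp

lemma pd_gauss (c b : ℝ) (i : Fin d) (x : E d) :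
    pd i (gauss c b) x = -2 * b * x i * gauss c b x := by
  have h := (((hasStrictFDerivAt_norm_sq x).hasFDerivAt.const_mul b).const_sub c).exp
  have : gauss c b = fun x : E d => Real.exp (c - b * ‖x‖ ^ 2) := rfl
  rw [pd, this, h.fderiv]
  simp [uvec, EuclideanSpace.inner_single_right]
  ring

lemma integral_gauss_mul_pd {b : ℝ} (hb : 0 < b) (c : ℝ) {u : E d → ℝ}
    (hu : ContDiff ℝ (⊤ : ℕ∞) u) {K : ℝ} (i : Fin d) (h1 : ∀ x, |u x| ≤ K * (1 + ‖x‖ ^ 2))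
    (h2 : ∀ x, |x i * u x| ≤ K * (1 + ‖x‖ ^ 2)) (h3 : ∀ x, |pd i u x| ≤ K * (1 + ‖x‖ ^ 2)) :
    ∫ x, gauss c b x * pd i u x = ∫ x, gauss c b x * (2 * b * x i * u x) := by
  have hc : Continuous fun x : E d => x i := (EuclideanSpace.proj i : E d →L[ℝ] ℝ).continuous
  have e1 : ∀ x : E d, fderiv ℝ (gauss c b) x (uvec d i) = -2 * b * x i * gauss c b x :=
    fun x => pd_gauss c b i x
  have := integral_mul_fderiv_eq_neg_fderiv_mul_of_integrable (μ := (volume : Measure (E d)))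
    (f := gauss c b) (g := u) (v := uvec d i)
    (by
      simp only [e1]
      have := (integrable_gauss_mul hb c (u := fun x => x i * u x) (hc.mul hu.continuous) h2).const_mul
        (-2 * b)
      exact this.congr (Filter.Eventually.of_forall fun x => by simp only; ring))
    (integrable_gauss_mul hb c (contDiff_pd hu i).continuous h3)
    (integrable_gauss_mul hb c hu.continuous h1)
    (fun x _ => (contDiff_gauss c b).differentiable (by simp) x)
    (fun x _ => hu.differentiable (by simp) x)
  simp only [e1] at this
  rw [show (fun x => gauss c b x * pd i u x) = fun x => gauss c b x * fderiv ℝ u x (uvec d i)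
    from rfl, this, ← integral_neg]
  congr 1; ext x; ring

lemma contDiff_coord (i : Fin d) : ContDiff ℝ (⊤ : ℕ∞) (fun x : E d => x i) :=
  (EuclideanSpace.proj i : E d →L[ℝ] ℝ).contDiff

lemma pd_coord_mul {g : E d → ℝ} (hg : ContDiff ℝ (⊤ : ℕ∞) g) (i : Fin d) (x : E d) :
    pd i (fun y => y i * g y) x = g x + x i * pd i g x := by
  rw [pd_mul ((contDiff_coord i).differentiable (by simp)) (hg.differentiable (by simp))]
  have : pd i (fun y : E d => y i) x = 1 := by
    have := (EuclideanSpace.proj i : E d →L[ℝ] ℝ).fderiv (x := x)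
    have h2 : fderiv ℝ (fun y : E d => y i) x = (EuclideanSpace.proj i : E d →L[ℝ] ℝ) := this
    rw [pd, h2]; simp [uvec]
  rw [this]; ring

lemma mul_one_add_sq {K a r : ℝ} (hK : 0 ≤ K) (h : |a| ≤ r) : |a| * K ≤ K * (1 + r ^ 2) := by
  have h0 := abs_nonneg a
  have : |a| ≤ 1 + r ^ 2 := by nlinarith [sq_nonneg (r - 1)]
  rw [mul_comm]; exact mul_le_mul_of_nonneg_left this hK

/-- Integration of the Fokker–Planck operator against a Gaussian. -/
lemma integral_gauss_mul_fpOp (hl : 0 < l) {b : ℝ} (hb : 0 < b) (c : ℝ) {W g : E d → ℝ}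
    (hW : SP l W) (hg : SP l g) :
    ∫ x, gauss c b x * fpOp W g x = ∫ x, gauss c b x *
      ((4 * b ^ 2 * ‖x‖ ^ 2 - 2 * b * d + 2 * b * ∑ i, x i * pd i W x) * g x) := by
  obtain ⟨K₀, hK₀, hgK⟩ := hg.exists_bound hl
  have hcoord : ∀ i : Fin d, Continuous fun x : E d => x i := fun i => (contDiff_coord i).continuous
  have hone : ∀ (K : ℝ) (x : E d), 0 ≤ K → K ≤ K * (1 + ‖x‖ ^ 2) := by
    intro K x hK; nlinarith [sq_nonneg ‖x‖]
  have hsq : ∀ (K : ℝ) (x : E d), 0 ≤ K → K * ‖x‖ ^ 2 ≤ K * (1 + ‖x‖ ^ 2) := by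
    intro K x hK; nlinarith [sq_nonneg ‖x‖]
  have hbd : ∀ {u : E d → ℝ}, SP l u → ∃ K, ∀ i, (∀ x, |u x| ≤ K * (1 + ‖x‖ ^ 2)) ∧
      (∀ x, |x i * u x| ≤ K * (1 + ‖x‖ ^ 2)) ∧ (∀ x, |x i * (x i * u x)| ≤ K * (1 + ‖x‖ ^ 2)) := by
    intro u hu
    obtain ⟨K, hK, h⟩ := hu.exists_bound hl
    refine ⟨K, fun i => ⟨fun x => (h x).trans (hone K x hK), fun x => ?_, fun x => ?_⟩⟩
    · rw [abs_mul]
      exact (mul_le_mul_of_nonneg_left (h x) (abs_nonneg _)).trans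
        (mul_one_add_sq hK (abs_coord_le x i))
    · rw [abs_mul, abs_mul, ← mul_assoc]
      have := abs_coord_le x i
      have h0 := abs_nonneg (x i)
      calc |x i| * |x i| * |u x| ≤ ‖x‖ * ‖x‖ * K := by gcongr; exact h x
        _ = K * ‖x‖ ^ 2 := by ring
        _ ≤ _ := hsq K x hK
  have lapl : ∀ i, ∫ x, gauss c b x * pd i (pd i g) x =
      ∫ x, gauss c b x * ((4 * b ^ 2 * x i ^ 2 - 2 * b) * g x) := by
    intro i
    obtain ⟨K1, h1⟩ := hbd (hg.pd i)
    obtain ⟨K2, h2⟩ := hbd ((hg.pd i).pd i)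
    obtain ⟨K, h0⟩ := hbd hg
    have e1 := integral_gauss_mul_pd hb c (hg.pd i).smooth (K := max K1 K2) i
      (fun x => ((h1 i).1 x).trans (by gcongr; exact le_max_left _ _))
      (fun x => ((h1 i).2.1 x).trans (by gcongr; exact le_max_left _ _))
      (fun x => ((h2 i).1 x).trans (by gcongr; exact le_max_right _ _))
    have e2 := integral_gauss_mul_pd hb c ((contDiff_coord i).mul hg.smooth) (K := K + K1) i
      (fun x => ((h0 i).2.1 x).trans (by
        have := (abs_nonneg _).trans ((h1 i).1 x)
        linarith))
      (fun x => ((h0 i).2.2 x).trans (by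
        have := (abs_nonneg _).trans ((h1 i).1 x)
        linarith))
      (fun x => by
        rw [pd_coord_mul hg.smooth]
        refine (abs_add_le _ _).trans ?_
        rw [add_mul]
        exact add_le_add ((h0 i).1 x) ((h1 i).2.1 x))
    simp only [pd_coord_mul hg.smooth] at e2
    have i1 : Integrable (fun x => gauss c b x * g x) :=
      integrable_gauss_mul hb c hg.continuous (h0 i).1
    have i2 : Integrable (fun x => gauss c b x * (x i * pd i g x)) :=
      integrable_gauss_mul hb c ((hcoord i).mul (hg.pd i).continuous) (h1 i).2.1
    have i3 : Integrable (fun x => gauss c b x * (x i * (x i * g x))) :=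
      integrable_gauss_mul hb c ((hcoord i).mul ((hcoord i).mul hg.continuous)) (h0 i).2.2
    simp only [mul_add] at e2
    rw [integral_add i1 i2] at e2
    rw [e1]
    have a1 : ∫ x, gauss c b x * (2 * b * x i * pd i g x) =
        2 * b * ∫ x, gauss c b x * (x i * pd i g x) := by
      rw [← integral_const_mul]; congr 1; ext x; ring
    have a2 : ∫ x, gauss c b x * (2 * b * x i * (x i * g x)) =
        2 * b * ∫ x, gauss c b x * (x i * (x i * g x)) := by
      rw [← integral_const_mul]; congr 1; ext x; ring
    have a3 : ∫ x, gauss c b x * ((4 * b ^ 2 * x i ^ 2 - 2 * b) * g x) =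
        4 * b ^ 2 * (∫ x, gauss c b x * (x i * (x i * g x))) - 2 * b * ∫ x, gauss c b x * g x := by
      rw [← integral_const_mul, ← integral_const_mul, ← integral_sub (i3.const_mul _) (i1.const_mul _)]
      congr 1; ext x; ring
    rw [a1, a3]
    rw [a2] at e2
    linear_combination 2 * b * e2
  have drift : ∀ i, ∫ x, gauss c b x * pd i (fun y => g y * pd i W y) x =
      ∫ x, gauss c b x * (2 * b * x i * (g x * pd i W x)) := by
    intro i
    obtain ⟨K1, h1⟩ := hbd (hg.mul (hW.pd i))
    obtain ⟨K2, h2⟩ := hbd ((hg.mul (hW.pd i)).pd i)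
    exact integral_gauss_mul_pd hb c (hg.mul (hW.pd i)).smooth (K := max K1 K2) i
      (fun x => ((h1 i).1 x).trans (by gcongr; exact le_max_left _ _))
      (fun x => ((h1 i).2.1 x).trans (by gcongr; exact le_max_left _ _))
      (fun x => ((h2 i).1 x).trans (by gcongr; exact le_max_right _ _))
  have int : ∀ {u : E d → ℝ}, SP l u → Integrable (fun x => gauss c b x * u x) := by
    intro u hu
    obtain ⟨K, -, h⟩ := hu.exists_bound hl
    exact integrable_gauss_mul_bdd hb c hu.continuous h
  have e : ∀ x, gauss c b x * fpOp W g x = ∑ i, (gauss c b x * pd i (pd i g) x +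
      gauss c b x * pd i (fun y => g y * pd i W y) x) := by
    intro x
    simp only [pd_mul hg.differentiable (hW.pd _).differentiable, fpOp, Finset.sum_add_distrib,
      Finset.mul_sum, mul_add, Finset.sum_mul]
    simp only [← Finset.sum_add_distrib]
    exact Finset.sum_congr rfl fun i _ => by ring
  simp only [e]
  have i0 : ∀ i, Integrable (fun x => gauss c b x * pd i (pd i g) x +
      gauss c b x * pd i (fun y => g y * pd i W y) x) := fun i =>
    (int ((hg.pd i).pd i)).add (int ((hg.mul (hW.pd i)).pd i))
  rw [integral_finsetSum _ fun i _ => i0 i]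
  have i1 : ∀ i, Integrable (fun x => gauss c b x * ((4 * b ^ 2 * x i ^ 2 - 2 * b) * g x)) := by
    intro i
    obtain ⟨K, h0⟩ := hbd hg
    have i1 := integrable_gauss_mul hb c hg.continuous (h0 i).1
    have i3 : Integrable (fun x => gauss c b x * (x i * (x i * g x))) :=
      integrable_gauss_mul hb c ((hcoord i).mul ((hcoord i).mul hg.continuous)) (h0 i).2.2
    refine ((i3.const_mul (4 * b ^ 2)).sub (i1.const_mul (2 * b))).congr
      (Filter.Eventually.of_forall fun x => ?_)
    simp only [Pi.sub_apply]; ring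
  have i2 : ∀ i, Integrable (fun x => gauss c b x * (2 * b * x i * (g x * pd i W x))) := by
    intro i
    obtain ⟨K, h0⟩ := hbd (hg.mul (hW.pd i))
    have i3 : Integrable (fun x => gauss c b x * (x i * (g x * pd i W x))) :=
      integrable_gauss_mul hb c ((hcoord i).mul (hg.mul (hW.pd i)).continuous) (h0 i).2.1
    exact (i3.const_mul (2 * b)).congr (Filter.Eventually.of_forall fun x => by simp only; ring)
  have e2 : ∀ i, ∫ x, (gauss c b x * pd i (pd i g) x +
      gauss c b x * pd i (fun y => g y * pd i W y) x) =
      ∫ x, (gauss c b x * ((4 * b ^ 2 * x i ^ 2 - 2 * b) * g x) +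
        gauss c b x * (2 * b * x i * (g x * pd i W x))) := by
    intro i
    rw [integral_add (int ((hg.pd i).pd i)) (int ((hg.mul (hW.pd i)).pd i)), lapl, drift,
      ← integral_add (i1 i) (i2 i)]
  simp only [e2]
  have i4 : ∀ i, Integrable (fun x => gauss c b x * ((4 * b ^ 2 * x i ^ 2 - 2 * b) * g x) +
      gauss c b x * (2 * b * x i * (g x * pd i W x))) := fun i => (i1 i).add (i2 i)
  rw [← integral_finsetSum _ fun i _ => i4 i]
  congr 1; ext x
  rw [EuclideanSpace.norm_sq_eq]
  simp only [Real.norm_eq_abs, sq_abs, Finset.mul_sum, Finset.sum_mul, add_mul, sub_mul, mul_add,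
    mul_sub, Finset.sum_add_distrib, Finset.sum_sub_distrib, Finset.sum_const, Finset.card_univ,
    Fintype.card_fin, nsmul_eq_mul]
  congr 1
  · congr 1
    ring
  · exact Finset.sum_congr rfl fun i _ => by ring

end

section
variable {d : ℕ} {l T B : ℝ} {V α : ℝ → E d → ℝ}

lemma exists_fpOp_bound (hl : 0 < l) (hB : 0 ≤ B) {g : E d → ℝ} (hg : SP l g) :
    ∃ C, 0 ≤ C ∧ ∀ W : E d → ℝ, (∀ x i, |pd i W x| ≤ B) →
      (∀ x, |∑ i, pd i (pd i W) x| ≤ B) → ∀ x, |fpOp W g x| ≤ C := by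
  obtain ⟨C0, h0, hC0⟩ := hg.exists_bound hl
  choose C1 h1 hC1 using fun i => (hg.pd i).exists_bound hl
  choose C2 h2 hC2 using fun i => ((hg.pd i).pd i).exists_bound hl
  refine ⟨(∑ i, C2 i) + (∑ i, B * C1 i) + B * C0, ?_, fun W hW hW2 x => ?_⟩
  · have := Finset.sum_nonneg fun i (_ : i ∈ Finset.univ) => h2 i
    have := Finset.sum_nonneg fun i (_ : i ∈ Finset.univ) => mul_nonneg hB (h1 i)
    positivity
  · rw [fpOp]
    refine (abs_add_le _ _).trans (add_le_add ((abs_add_le _ _).trans (add_le_add ?_ ?_)) ?_)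
    · exact (Finset.abs_sum_le_sum_abs _ _).trans (Finset.sum_le_sum fun i _ => hC2 i x)
    · refine (Finset.abs_sum_le_sum_abs _ _).trans (Finset.sum_le_sum fun i _ => ?_)
      rw [abs_mul]
      exact mul_le_mul (hW x i) (hC1 i x) (abs_nonneg _) hB
    · rw [abs_mul]
      exact mul_le_mul (hW2 x) (hC0 x) (abs_nonneg _) hB

namespace FPData

lemma exists_lip (h : FPData l T B V α) {s t : ℝ} (hs0 : 0 ≤ s) (hst : s ≤ t) (ht : t ≤ T)
    (hruc : ∀ r ∈ Ico s t, RUC T α r) :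
    ∃ C, 0 ≤ C ∧ ∀ r ∈ Icc s t, ∀ x, |α r x - α s x| ≤ C * (r - s) := by
  obtain ⟨C, hC, hb⟩ := exists_fpOp_bound h.hl h.hB (h.sα s ⟨hs0, hst.trans ht⟩)
  refine ⟨C * Real.exp (B * (t - s)), by positivity, fun r hr x => ?_⟩
  have := h.abs_sub_le hs0 ht hC hruc (fun r hr x => hb _
    (h.bV r ⟨hs0.trans hr.1, hr.2.trans ht⟩) (h.bV2 r ⟨hs0.trans hr.1, hr.2.trans ht⟩) x) r hr x
  refine this.trans ?_
  have h1 : Real.exp (B * (r - s)) ≤ Real.exp (B * (t - s)) := by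
    apply Real.exp_le_exp.2
    exact mul_le_mul_of_nonneg_left (by linarith [hr.2]) h.hB
  calc C * (r - s) * Real.exp (B * (r - s)) ≤ C * (r - s) * Real.exp (B * (t - s)) :=
        mul_le_mul_of_nonneg_left h1 (mul_nonneg hC (sub_nonneg.2 hr.1))
    _ = _ := by ring

lemma abs_drift_le (h : FPData l T B V α) {s : ℝ} (hs : s ∈ Icc 0 T) (x : E d) :
    |∑ i, x i * pd i (V s) x| ≤ d * B * ‖x‖ := by
  refine (Finset.abs_sum_le_sum_abs _ _).trans ?_
  calc ∑ i, |x i * pd i (V s) x| ≤ ∑ _i : Fin d, ‖x‖ * B := Finset.sum_le_sum fun i _ => by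
        rw [abs_mul]
        exact mul_le_mul (abs_coord_le x i) (h.bV s hs x i) (abs_nonneg _) (norm_nonneg _)
    _ = _ := by simp; ring

/-- Monotonicity of Gaussian averages with time-dependent parameters. -/
lemma gauss_mono (h : FPData l T B V α) {s₀ t : ℝ} (hs0 : 0 ≤ s₀) (hst : s₀ ≤ t) (ht : t ≤ T)
    (hruc : ∀ r ∈ Ico s₀ t, RUC T α r) {p b p' b' : ℝ → ℝ} {M β σ : ℝ} (hβ : 0 < β) (hM : 0 ≤ M)
    (hσ : |σ| ≤ 1)
    (hp : ∀ s ∈ Icc s₀ t, HasDerivAt p (p' s) s) (hb : ∀ s ∈ Icc s₀ t, HasDerivAt b (b' s) s)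
    (hp' : ∀ s ∈ Icc s₀ t, |p' s| ≤ M) (hb' : ∀ s ∈ Icc s₀ t, |b' s| ≤ M)
    (hpM : ∀ s ∈ Icc s₀ t, p s ≤ M) (hbβ : ∀ s ∈ Icc s₀ t, β ≤ b s)
    (hsub : ∀ s ∈ Icc s₀ t, ∀ r, 0 ≤ r →
      0 ≤ σ * (p' s - b' s * r ^ 2 + 4 * b s ^ 2 * r ^ 2 - 2 * b s * d) - 2 * b s * (d * B) * r) :
    σ * ∫ x, gauss (p s₀) (b s₀) x * α s₀ x ≤ σ * ∫ x, gauss (p t) (b t) x * α t x := by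
  have hmem : ∀ {s}, s ∈ Icc s₀ t → s ∈ Icc 0 T := fun hs => ⟨hs0.trans hs.1, hs.2.trans ht⟩
  have hle : ∀ s ∈ Icc s₀ t, ∀ x : E d, gauss (p s) (b s) x ≤ gauss M β x := by
    intro s hs x
    refine Real.exp_le_exp.2 (sub_le_sub (hpM s hs) ?_)
    exact mul_le_mul_of_nonneg_right (hbβ s hs) (sq_nonneg _)
  have hgd : ∀ s ∈ Icc s₀ t, ∀ x : E d, HasDerivAt (fun r => gauss (p r) (b r) x)
      (gauss (p s) (b s) x * (p' s - b' s * ‖x‖ ^ 2)) s := fun s hs x =>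
    ((hp s hs).sub ((hb s hs).mul_const _)).exp
  have hglip : ∀ s ∈ Icc s₀ t, ∀ r ∈ Icc s t, ∀ x : E d,
      |gauss (p r) (b r) x - gauss (p s) (b s) x| ≤ gauss M β x * (M * (1 + ‖x‖ ^ 2)) * (r - s) := by
    intro s hs r hr x
    have := (convex_Icc s t).norm_image_sub_le_of_norm_hasDerivWithin_le
      (f := fun r => gauss (p r) (b r) x) (C := gauss M β x * (M * (1 + ‖x‖ ^ 2)))
      (fun q hq => (hgd q ⟨hs.1.trans hq.1, hq.2⟩ x).hasDerivWithinAt) (fun q hq => ?_)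
      (left_mem_Icc.2 hs.2) hr
    · rwa [Real.norm_eq_abs, Real.norm_eq_abs, abs_of_nonneg (sub_nonneg.2 hr.1)] at this
    · have hq' : q ∈ Icc s₀ t := ⟨hs.1.trans hq.1, hq.2⟩
      rw [Real.norm_eq_abs, abs_mul, abs_of_pos (gauss_pos _ _ _)]
      refine mul_le_mul (hle q hq' x) ?_ (abs_nonneg _) (gauss_pos _ _ _).le
      refine (abs_sub _ _).trans ?_
      rw [abs_mul, abs_of_nonneg (sq_nonneg ‖x‖), mul_add, mul_one]
      exact add_le_add (hp' q hq') (mul_le_mul_of_nonneg_right (hb' q hq') (sq_nonneg _))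
  obtain ⟨C₀, hC₀, hlip₀⟩ := h.exists_lip hs0 hst ht hruc
  obtain ⟨K₀, hK₀, hαK₀⟩ := (h.sα s₀ (hmem (left_mem_Icc.2 hst))).exists_bound h.hl
  have hαb : ∀ s ∈ Icc s₀ t, ∀ x, |α s x| ≤ C₀ * (t - s₀) + K₀ := by
    intro s hs x
    have e : α s x = (α s x - α s₀ x) + α s₀ x := by ring
    rw [e]
    refine (abs_add_le _ _).trans (add_le_add ((hlip₀ s hs x).trans ?_) (hαK₀ x))
    exact mul_le_mul_of_nonneg_left (by linarith [hs.2]) hC₀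
  set A := C₀ * (t - s₀) + K₀ with hA
  have hA0 : 0 ≤ A := by
    have := sub_nonneg.2 hst
    positivity
  set F : ℝ → E d → ℝ := fun s x => gauss (p s) (b s) x * α s x with hF
  have hFc : ∀ s ∈ Icc s₀ t, Continuous (F s) := fun s hs =>
    (continuous_gauss _ _).mul (h.sα s (hmem hs)).continuous
  have hcont : ContinuousOn (fun s => ∫ x, F s x) (Icc s₀ t) := by
    refine continuousOn_of_dominated (bound := fun x => gauss M β x * A)
      (fun s hs => (hFc s hs).aestronglyMeasurable) (fun s hs => Filter.Eventually.of_forall fun x => ?_)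
      ((integrable_gauss hβ M).mul_const A) (Filter.Eventually.of_forall fun x s hs => ?_)
    · rw [Real.norm_eq_abs, abs_mul, abs_of_pos (gauss_pos _ _ _)]
      exact mul_le_mul (hle s hs x) (hαb s hs x) (abs_nonneg _) (gauss_pos _ _ _).le
    · exact ((hgd s hs x).mul (h.der s (hmem hs) x)).continuousAt.continuousWithinAt
  set F' : ℝ → E d → ℝ := fun s x => gauss (p s) (b s) x * (p' s - b' s * ‖x‖ ^ 2) * α s x +
    gauss (p s) (b s) x * fpOp (V s) (α s) x with hF'
  have hderiv : ∀ s ∈ Ico s₀ t, HasDerivWithinAt (fun s => ∫ x, F s x) (∫ x, F' s x) (Ioi s) s := by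
    intro s hs
    have hs' : s ∈ Icc s₀ t := Ico_subset_Icc_self hs
    obtain ⟨C, hC, hlip⟩ := h.exists_lip (hs0.trans hs.1) hs.2.le ht
      (fun r hr => hruc r ⟨hs.1.trans hr.1, hr.2⟩)
    have hev : ∀ᶠ r in nhdsWithin s (Ioi s), r ∈ Icc s t := by
      filter_upwards [Ioo_mem_nhdsGT hs.2] with r hr using Ioo_subset_Icc_self hr
    refine hasDerivWithinAt_integral_right
      (b := fun x => gauss M β x * (C + M * (1 + ‖x‖ ^ 2) * A)) ?_ ?_ ?_ ?_ ?_
    · exact integrable_gauss_mul_bdd (hβ.trans_le (hbβ s hs')) _ (h.sα s (hmem hs')).continuous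
        (hαb s hs')
    · filter_upwards [hev] with r hr using (hFc r ⟨hs.1.trans hr.1, hr.2⟩).aestronglyMeasurable
    · refine integrable_gauss_mul hβ M (by fun_prop) (K := C + M * A) fun x => ?_
      rw [abs_of_nonneg (by positivity)]
      have := mul_nonneg hC (sq_nonneg ‖x‖)
      nlinarith
    · filter_upwards [hev] with r hr x
      have hr' : r ∈ Icc s₀ t := ⟨hs.1.trans hr.1, hr.2⟩
      have e : F r x - F s x = gauss (p r) (b r) x * (α r x - α s x) +
          (gauss (p r) (b r) x - gauss (p s) (b s) x) * α s x := by simp only [hF]; ring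
      rw [e]
      refine (abs_add_le _ _).trans ?_
      rw [abs_mul, abs_mul, abs_of_pos (gauss_pos _ _ _)]
      have h1 := mul_le_mul (hle r hr' x) (hlip r hr x) (abs_nonneg _) (gauss_pos _ _ _).le
      have h2 := mul_le_mul (hglip s hs' r hr x) (hαb s hs' x) (abs_nonneg _)
        (by have := (gauss_pos M β x).le; have := sub_nonneg.2 hr.1; positivity)
      refine (add_le_add h1 h2).trans (le_of_eq ?_)
      ring
    · intro x
      refine ((hgd s hs' x).mul (h.der s (hmem hs') x)).hasDerivWithinAt
  have hnonneg : ∀ s ∈ Ico s₀ t, 0 ≤ σ * ∫ x, F' s x := by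
    intro s hs
    have hs' : s ∈ Icc s₀ t := Ico_subset_Icc_self hs
    have hbs : 0 < b s := hβ.trans_le (hbβ s hs')
    have i1 : Integrable (fun x => gauss (p s) (b s) x * (p' s - b' s * ‖x‖ ^ 2) * α s x) := by
      have := integrable_gauss_mul hbs (p s) (u := fun x => (p' s - b' s * ‖x‖ ^ 2) * α s x)
        ((by fun_prop : Continuous fun x : E d => p' s - b' s * ‖x‖ ^ 2).mul
          (h.sα s (hmem hs')).continuous) (K := M * A) fun x => ?_
      · exact this.congr (Filter.Eventually.of_forall fun x => by simp only; ring)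
      · rw [abs_mul, mul_right_comm _ A _]
        refine mul_le_mul ?_ (hαb s hs' x) (abs_nonneg _) (by positivity)
        refine (abs_sub _ _).trans ?_
        rw [abs_mul, abs_of_nonneg (sq_nonneg ‖x‖), mul_add, mul_one]
        exact add_le_add (hp' s hs') (mul_le_mul_of_nonneg_right (hb' s hs') (sq_nonneg _))
    have hfc : Continuous (fpOp (V s) (α s)) := by
      unfold fpOp
      have hV := h.sV s (hmem hs')
      have ha := h.sα s (hmem hs')
      exact ((continuous_finsetSum _ fun i _ => ((ha.pd i).pd i).continuous).add
        (continuous_finsetSum _ fun i _ => (hV.pd i).continuous.mul (ha.pd i).continuous)).add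
        ((continuous_finsetSum _ fun i _ => ((hV.pd i).pd i).continuous).mul ha.continuous)
    have i2 : Integrable (fun x => gauss (p s) (b s) x * fpOp (V s) (α s) x) := by
      obtain ⟨C, hC, hb⟩ := exists_fpOp_bound h.hl h.hB (h.sα s (hmem hs'))
      exact integrable_gauss_mul_bdd hbs _ hfc (hb _ (h.bV s (hmem hs')) (h.bV2 s (hmem hs')))
    have i3 : Integrable (fun x => gauss (p s) (b s) x * ((4 * b s ^ 2 * ‖x‖ ^ 2 - 2 * b s * d +
        2 * b s * ∑ i, x i * pd i (V s) x) * α s x)) := by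
      have hsc : Continuous fun x : E d => ∑ i, x i * pd i (V s) x :=
        continuous_finsetSum _ fun i _ =>
          (contDiff_coord i).continuous.mul ((h.sV s (hmem hs')).pd i).continuous
      refine integrable_gauss_mul hbs (p s) (((by fun_prop :
        Continuous fun x : E d => 4 * b s ^ 2 * ‖x‖ ^ 2 - 2 * b s * d).add
        (continuous_const.mul hsc)).mul (h.sα s (hmem hs')).continuous)
        (K := (4 * b s ^ 2 + 2 * b s * d + 2 * b s * (d * B)) * A) fun x => ?_
      rw [abs_mul, mul_right_comm _ A _]
      have hB := h.hB
      refine mul_le_mul ?_ (hαb s hs' x) (abs_nonneg _) (by positivity)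
      have h1 := h.abs_drift_le (hmem hs') x
      refine (abs_add_le _ _).trans ((add_le_add (abs_sub _ _) le_rfl).trans ?_)
      rw [abs_mul (2 * b s) (∑ i, x i * pd i (V s) x), abs_of_nonneg (by positivity : 0 ≤ 4 * b s ^ 2 * ‖x‖ ^ 2),
        abs_of_nonneg (by positivity : 0 ≤ 2 * b s * (d : ℝ)), abs_of_pos (by positivity : 0 < 2 * b s)]
      have h2 : ‖x‖ ≤ 1 + ‖x‖ ^ 2 := by nlinarith [sq_nonneg (‖x‖ - 1)]
      have h3 : 2 * b s * |∑ i, x i * pd i (V s) x| ≤ 2 * b s * (d * B) * (1 + ‖x‖ ^ 2) := by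
        rw [mul_assoc (2 * b s) (d * B)]
        refine mul_le_mul_of_nonneg_left (h1.trans ?_) (by positivity)
        exact mul_le_mul_of_nonneg_left h2 (by positivity)
      have h4 : 0 ≤ 2 * b s * (d : ℝ) * ‖x‖ ^ 2 := by positivity
      have h5 : 0 ≤ 4 * b s ^ 2 := by positivity
      linarith
    rw [hF']
    simp only
    rw [integral_add i1 i2, integral_gauss_mul_fpOp h.hl hbs _ (h.sV s (hmem hs')) (h.sα s (hmem hs')),
      ← integral_add i1 i3, ← integral_const_mul]
    refine integral_nonneg fun x => ?_
    have key := hsub s hs' ‖x‖ (norm_nonneg _)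
    have hdr := h.abs_drift_le (hmem hs') x
    have h1 : -(2 * b s * (d * B) * ‖x‖) ≤ σ * (2 * b s * ∑ i, x i * pd i (V s) x) := by
      have : |σ * (2 * b s * ∑ i, x i * pd i (V s) x)| ≤ 1 * (2 * b s * (d * B * ‖x‖)) := by
        rw [abs_mul, abs_mul, abs_of_pos (by positivity : 0 < 2 * b s)]
        exact mul_le_mul hσ (mul_le_mul_of_nonneg_left hdr (by positivity)) (by positivity) zero_le_one
      have := (abs_le.1 this).1
      linarith
    have h2 : 0 ≤ σ * (p' s - b' s * ‖x‖ ^ 2 + (4 * b s ^ 2 * ‖x‖ ^ 2 - 2 * b s * d +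
        2 * b s * ∑ i, x i * pd i (V s) x)) := by linarith
    have h3 := mul_nonneg h2 (mul_nonneg (gauss_pos (p s) (b s) x).le (h.pos s (hmem hs') x).le)
    simp only [Pi.zero_apply]
    linarith
  have := intervalIntegral.sub_le_integral_of_hasDeriv_right_of_le_Ico (φ := fun _ => 0)
    (g := fun s => -(σ * ∫ x, F s x)) (g' := fun s => -(σ * ∫ x, F' s x)) hst
    (hcont.const_smul σ).neg (fun s hs => ((hderiv s hs).const_mul σ).neg) (by simp)
    (fun s hs => by simpa using hnonneg s hs)
  simp only [intervalIntegral.integral_zero, hF] at this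
  linarith

end FPData
end

section
variable {d : ℕ} {l T B : ℝ} {V α : ℝ → E d → ℝ}

lemma pd_comp_add (g : E d → ℝ) (x₀ : E d) (i : Fin d) (x : E d) :
    pd i (fun y => g (x₀ + y)) x = pd i g (x₀ + x) := by
  rw [pd, pd, fderiv_comp_add_left]

lemma SP.comp_add {g : E d → ℝ} (hg : SP l g) (x₀ : E d) : SP l (fun y => g (x₀ + y)) :=
  ⟨hg.smooth.comp (contDiff_const.add contDiff_id), fun x i => by
    rw [← add_assoc]; exact hg.periodic (x₀ + x) i⟩

lemma fpOp_comp_add (W g : E d → ℝ) (x₀ x : E d) :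
    fpOp (fun y => W (x₀ + y)) (fun y => g (x₀ + y)) x = fpOp W g (x₀ + x) := by
  have h : ∀ (g : E d → ℝ) (i : Fin d), pd i (fun y => g (x₀ + y)) = fun y => pd i g (x₀ + y) :=
    fun g i => funext (pd_comp_add g x₀ i)
  simp only [fpOp, h]

lemma FPData.comp_add (h : FPData l T B V α) (x₀ : E d) :
    FPData l T B (fun t y => V t (x₀ + y)) (fun t y => α t (x₀ + y)) where
  hl := h.hl
  hB := h.hB
  sV t ht := (h.sV t ht).comp_add x₀
  sα t ht := (h.sα t ht).comp_add x₀
  pos t ht x := h.pos t ht _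
  bV t ht x i := by rw [pd_comp_add]; exact h.bV t ht _ i
  bV2 t ht x := by
    have h' : ∀ (g : E d → ℝ) (i : Fin d), pd i (fun y => g (x₀ + y)) = fun y => pd i g (x₀ + y) :=
      fun g i => funext (pd_comp_add g x₀ i)
    simp only [h']
    exact h.bV2 t ht _
  der t ht x := by rw [fpOp_comp_add]; exact h.der t ht _

lemma RUC.comp_add {t : ℝ} (h : RUC T α t) (x₀ : E d) : RUC T (fun t y => α t (x₀ + y)) t := by
  intro ε hε
  obtain ⟨δ, hδ, h⟩ := h ε hε
  exact ⟨δ, hδ, fun s hs hsT x => h s hs hsT _⟩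

/-- The Gaussian rate of the perturbed heat kernel. -/
def heatRate (σ τ : ℝ) : ℝ := (1 + σ * √τ) / (4 * τ)

/-- The log-amplitude of the perturbed heat kernel. -/
def heatAmp (d : ℕ) (σ A τ : ℝ) : ℝ := -(σ * A * √τ) + d / 2 * Real.log (heatRate σ τ / Real.pi)

/-- A perturbed heat kernel, a sub- or super-solution of the adjoint equation. -/
def heat {d : ℕ} (σ A τ : ℝ) (x : E d) : ℝ := gauss (heatAmp d σ A τ) (heatRate σ τ) x

lemma sqrt_le_half {τ : ℝ} (h : τ ≤ 1 / 4) : √τ ≤ 1 / 2 := by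
  rw [show (1 / 2 : ℝ) = √(1 / 4) by
    rw [show (1 / 4 : ℝ) = (1 / 2) ^ 2 by norm_num, Real.sqrt_sq (by norm_num)]]
  exact Real.sqrt_le_sqrt h

lemma abs_mul_sqrt_le {σ τ : ℝ} (hσ : |σ| ≤ 1) (h : τ ≤ 1 / 4) : |σ * √τ| ≤ 1 / 2 := by
  rw [abs_mul, abs_of_nonneg (Real.sqrt_nonneg τ)]
  calc |σ| * √τ ≤ 1 * (1 / 2) := mul_le_mul hσ (sqrt_le_half h) (Real.sqrt_nonneg _) zero_le_one
    _ = 1 / 2 := one_mul _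

lemma heatRate_ge {σ τ : ℝ} (hσ : |σ| ≤ 1) (h0 : 0 < τ) (h : τ ≤ 1 / 4) :
    1 / (8 * τ) ≤ heatRate σ τ := by
  have := (abs_le.1 (abs_mul_sqrt_le hσ h)).1
  rw [heatRate, div_le_div_iff₀ (by positivity) (by positivity)]
  nlinarith

lemma heatRate_le {σ τ : ℝ} (hσ : |σ| ≤ 1) (h0 : 0 < τ) (h : τ ≤ 1 / 4) :
    heatRate σ τ ≤ 3 / (8 * τ) := by
  have := (abs_le.1 (abs_mul_sqrt_le hσ h)).2
  rw [heatRate, div_le_div_iff₀ (by positivity) (by positivity)]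
  nlinarith

lemma heatRate_pos {σ τ : ℝ} (hσ : |σ| ≤ 1) (h0 : 0 < τ) (h : τ ≤ 1 / 4) : 0 < heatRate σ τ :=
  lt_of_lt_of_le (by positivity) (heatRate_ge hσ h0 h)

lemma heat_pos (σ A τ : ℝ) (x : E d) : 0 < heat σ A τ x := gauss_pos _ _ _

lemma continuous_heat (σ A τ : ℝ) : Continuous (heat σ A τ : E d → ℝ) := continuous_gauss _ _

lemma integrable_heat {σ τ : ℝ} (hσ : |σ| ≤ 1) (h0 : 0 < τ) (h : τ ≤ 1 / 4) (A : ℝ) :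
    Integrable (heat σ A τ : E d → ℝ) := integrable_gauss (heatRate_pos hσ h0 h) _

lemma exp_heatAmp {σ τ : ℝ} (hσ : |σ| ≤ 1) (h0 : 0 < τ) (h : τ ≤ 1 / 4) (A : ℝ) :
    Real.exp (heatAmp d σ A τ) =
      Real.exp (-(σ * A * √τ)) * (heatRate σ τ / Real.pi) ^ (d / 2 : ℝ) := by
  have hb := heatRate_pos hσ h0 h
  rw [heatAmp, Real.exp_add, Real.rpow_def_of_pos (by positivity), mul_comm (Real.log _)]

lemma integral_heat {σ τ : ℝ} (hσ : |σ| ≤ 1) (h0 : 0 < τ) (h : τ ≤ 1 / 4) (A : ℝ) :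
    ∫ x : E d, heat σ A τ x = Real.exp (-(σ * A * √τ)) := by
  have hb := heatRate_pos hσ h0 h
  unfold heat
  rw [integral_gauss hb, exp_heatAmp hσ h0 h, mul_assoc, ← Real.mul_rpow (by positivity) (by positivity)]
  have : heatRate σ τ / Real.pi * (Real.pi / heatRate σ τ) = 1 := by field_simp
  rw [this, Real.one_rpow, mul_one]

lemma gauss_mul_norm_le {b : ℝ} (hb : 0 < b) (c : ℝ) (x : E d) :
    gauss c b x * ‖x‖ ≤ 1 / √b * gauss c (b / 2) x := by
  have h1 : gauss c b x = gauss c (b / 2) x * Real.exp (-(b / 2 * ‖x‖ ^ 2)) := by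
    rw [gauss, gauss, ← Real.exp_add]; ring_nf
  have h2 : 1 + b / 2 * ‖x‖ ^ 2 ≤ Real.exp (b / 2 * ‖x‖ ^ 2) := by
    linarith [Real.add_one_le_exp (b / 2 * ‖x‖ ^ 2)]
  have hs : 0 < √b := Real.sqrt_pos.2 hb
  have h3 : √b * ‖x‖ ≤ 1 + b / 2 * ‖x‖ ^ 2 := by
    have : b = √b ^ 2 := (Real.sq_sqrt hb.le).symm
    rw [this, Real.sqrt_sq hs.le]
    nlinarith [sq_nonneg (√b * ‖x‖ - 1)]
  have h4 : Real.exp (-(b / 2 * ‖x‖ ^ 2)) * ‖x‖ ≤ 1 / √b := by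
    rw [Real.exp_neg, inv_mul_le_iff₀ (Real.exp_pos _), mul_one_div, le_div_iff₀ hs]
    linarith
  rw [h1, mul_assoc, mul_comm (1 / √b)]
  exact mul_le_mul_of_nonneg_left h4 (gauss_pos _ _ _).le

lemma integral_gauss_half {σ τ : ℝ} (hσ : |σ| ≤ 1) (h0 : 0 < τ) (h : τ ≤ 1 / 4) (A : ℝ) :
    ∫ x : E d, gauss (heatAmp d σ A τ) (heatRate σ τ / 2) x =
      Real.exp (-(σ * A * √τ)) * 2 ^ (d / 2 : ℝ) := by
  have hb := heatRate_pos hσ h0 h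
  rw [integral_gauss (half_pos hb), exp_heatAmp hσ h0 h, mul_assoc,
    ← Real.mul_rpow (by positivity) (by positivity)]
  have : heatRate σ τ / Real.pi * (Real.pi / (heatRate σ τ / 2)) = 2 := by field_simp
  rw [this]

lemma exp_neg_mul_sqrt_le {σ τ A : ℝ} (hσ : |σ| ≤ 1) (h : τ ≤ 1 / 4) (hA : 0 ≤ A) :
    Real.exp (-(σ * A * √τ)) ≤ Real.exp A := by
  apply Real.exp_le_exp.2
  have := (abs_le.1 (abs_mul_sqrt_le hσ h)).1
  nlinarith

lemma integrable_heat_mul_norm {σ τ : ℝ} (hσ : |σ| ≤ 1) (h0 : 0 < τ) (h : τ ≤ 1 / 4) (A : ℝ) :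
    Integrable (fun x : E d => heat σ A τ x * ‖x‖) := by
  refine integrable_gauss_mul (heatRate_pos hσ h0 h) _ continuous_norm (K := 1) fun x => ?_
  rw [abs_of_nonneg (norm_nonneg x)]
  nlinarith [sq_nonneg (‖x‖ - 1)]

lemma integral_heat_mul_norm_le {σ τ A : ℝ} (hσ : |σ| ≤ 1) (h0 : 0 < τ) (h : τ ≤ 1 / 4)
    (hA : 0 ≤ A) :
    ∫ x : E d, heat σ A τ x * ‖x‖ ≤ Real.exp A * 2 ^ (d / 2 : ℝ) * (3 * √τ) := by
  have hb := heatRate_pos hσ h0 h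
  have hg := heatRate_ge hσ h0 h
  have h1 : ∫ x : E d, heat σ A τ x * ‖x‖ ≤
      ∫ x : E d, 1 / √(heatRate σ τ) * gauss (heatAmp d σ A τ) (heatRate σ τ / 2) x :=
    integral_mono (integrable_heat_mul_norm hσ h0 h A)
      ((integrable_gauss (half_pos hb) _).const_mul _) fun x => gauss_mul_norm_le hb _ x
  rw [integral_const_mul, integral_gauss_half hσ h0 h] at h1
  refine h1.trans ?_
  have h2 : 1 / √(heatRate σ τ) ≤ 3 * √τ := by
    have hs := Real.sqrt_pos.2 hb
    rw [div_le_iff₀ hs, mul_assoc, ← Real.sqrt_mul h0.le]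
    have : √(1 / 9 : ℝ) ≤ √(τ * heatRate σ τ) := by
      apply Real.sqrt_le_sqrt
      have := mul_le_mul_of_nonneg_left hg h0.le
      have e : τ * (1 / (8 * τ)) = 1 / 8 := by field_simp
      rw [e] at this
      linarith
    have e : √(1 / 9 : ℝ) = 1 / 3 := by
      rw [show (1 / 9 : ℝ) = (1 / 3) ^ 2 by norm_num, Real.sqrt_sq (by norm_num)]
    rw [e] at this
    linarith
  have h3 := exp_neg_mul_sqrt_le hσ h hA
  calc _ ≤ (3 * √τ) * (Real.exp A * 2 ^ (d / 2 : ℝ)) := by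
        refine mul_le_mul h2 (mul_le_mul_of_nonneg_right h3 (by positivity)) (by positivity)
          (by positivity)
    _ = _ := by ring

/-- Approximation by perturbed heat averages. -/
lemma abs_integral_heat_sub_le {σ τ A K : ℝ} (hσ : |σ| ≤ 1) (h0 : 0 < τ) (h : τ ≤ 1 / 4)
    (hA : 0 ≤ A) (hK0 : 0 ≤ K) {g : E d → ℝ} (hg : Continuous g) (x₀ : E d)
    (hK : ∀ x, |g (x₀ + x) - g x₀| ≤ K * ‖x‖) :
    |(∫ x, heat σ A τ x * g (x₀ + x)) - Real.exp (-(σ * A * √τ)) * g x₀| ≤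
      K * (Real.exp A * 2 ^ (d / 2 : ℝ) * (3 * √τ)) := by
  have i1 : Integrable (fun x => heat σ A τ x * (g (x₀ + x) - g x₀)) := by
    refine integrable_gauss_mul (heatRate_pos hσ h0 h) _ (by fun_prop) (K := K) fun x => ?_
    refine (hK x).trans (mul_le_mul_of_nonneg_left ?_ hK0)
    nlinarith [sq_nonneg (‖x‖ - 1)]
  have e : (∫ x, heat σ A τ x * g (x₀ + x)) - Real.exp (-(σ * A * √τ)) * g x₀ =
      ∫ x, heat σ A τ x * (g (x₀ + x) - g x₀) := by
    have i2 : Integrable (fun x : E d => heat σ A τ x * g x₀) := (integrable_heat hσ h0 h A).mul_const _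
    rw [← integral_heat (d := d) hσ h0 h A, ← integral_mul_const, sub_eq_iff_eq_add,
      ← integral_add i1 i2]
    congr 1; ext x; ring
  rw [e]
  refine (abs_integral_le_integral_abs).trans ?_
  calc ∫ x, |heat σ A τ x * (g (x₀ + x) - g x₀)| ≤ ∫ x : E d, K * (heat σ A τ x * ‖x‖) := by
        refine integral_mono i1.abs ((integrable_heat_mul_norm hσ h0 h A).const_mul K) fun x => ?_
        simp only
        rw [abs_mul, abs_of_pos (heat_pos _ _ _ _)]
        have := mul_le_mul_of_nonneg_left (hK x) (heat_pos σ A τ x).le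
        linarith
    _ = K * ∫ x : E d, heat σ A τ x * ‖x‖ := integral_const_mul _ _
    _ ≤ _ := mul_le_mul_of_nonneg_left (integral_heat_mul_norm_le hσ h0 h hA) hK0

end

section
variable {d : ℕ} {l T B : ℝ} {V α : ℝ → E d → ℝ}

lemma hasDerivAt_heatRate (σ : ℝ) {τ : ℝ} (h0 : 0 < τ) :
    HasDerivAt (heatRate σ) (-1 / (4 * τ ^ 2) - σ / (8 * τ * √τ)) τ := by
  have hs : 0 < √τ := Real.sqrt_pos.2 h0
  have h := (((Real.hasDerivAt_sqrt h0.ne').const_mul σ).const_add 1).div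
    ((hasDerivAt_id τ).const_mul 4) (by simp only [id]; positivity)
  refine h.congr_deriv ?_
  simp only [id]
  have e : τ = √τ ^ 2 := (Real.sq_sqrt h0.le).symm
  generalize √τ = q at *
  subst e
  field_simp
  ring

lemma hasDerivAt_heatAmp {σ τ : ℝ} (hσ : |σ| ≤ 1) (A : ℝ) (h0 : 0 < τ) (h : τ ≤ 1 / 4) :
    HasDerivAt (heatAmp d σ A) (-(σ * A * (1 / (2 * √τ))) +
      d / 2 * ((-1 / (4 * τ ^ 2) - σ / (8 * τ * √τ)) / heatRate σ τ)) τ := by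
  have hb := heatRate_pos hσ h0 h
  have h1 := ((hasDerivAt_heatRate σ h0).div_const Real.pi).log (by positivity)
  have h2 := ((Real.hasDerivAt_sqrt h0.ne').const_mul (σ * A)).neg.add (h1.const_mul (d / 2 : ℝ))
  refine h2.congr_deriv ?_
  have hpi := Real.pi_ne_zero
  rw [div_div_div_cancel_right₀ hpi]

/-- The differential inequality satisfied by the perturbed heat kernel. -/
lemma heat_subsol {σ τ B A : ℝ} (hσ : σ = 1 ∨ σ = -1) (h0 : 0 < τ) (h : τ ≤ 1 / 4) (hB : 0 ≤ B)
    (hA : A = 4 * d + 9 / 8 * (d * B) ^ 2) {r : ℝ} (hr : 0 ≤ r) :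
    0 ≤ σ * (-(-(σ * A * (1 / (2 * √τ))) +
      d / 2 * ((-1 / (4 * τ ^ 2) - σ / (8 * τ * √τ)) / heatRate σ τ)) -
      (-(-1 / (4 * τ ^ 2) - σ / (8 * τ * √τ))) * r ^ 2 +
      4 * heatRate σ τ ^ 2 * r ^ 2 - 2 * heatRate σ τ * d) - 2 * heatRate σ τ * (d * B) * r := by
  have hσ1 : |σ| ≤ 1 := by rcases hσ with rfl | rfl <;> simp
  have hσ2 : σ ^ 2 = 1 := by rcases hσ with rfl | rfl <;> norm_num
  have hb := heatRate_pos hσ1 h0 h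
  have hb1 := heatRate_ge hσ1 h0 h
  have hb2 := heatRate_le hσ1 h0 h
  have hs : 0 < √τ := Real.sqrt_pos.2 h0
  have hs2 : √τ ≤ 1 / 2 := sqrt_le_half h
  have e : τ = √τ ^ 2 := (Real.sq_sqrt h0.le).symm
  have hbd : heatRate σ τ = (1 + σ * √τ) / (4 * τ) := rfl
  generalize heatRate σ τ = b at *
  generalize √τ = q at *
  subst e
  set e := -1 / (4 * (q ^ 2) ^ 2) - σ / (8 * q ^ 2 * q) + 4 * b ^ 2 with he
  have hee : σ * e = 3 / (8 * q ^ 3) + σ / (4 * q ^ 2) := by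
    have : σ * e = σ ^ 2 * (3 / (8 * q ^ 3)) + (σ ^ 2) * (σ / (4 * q ^ 2)) := by
      rw [he, hbd]; field_simp; ring
    rw [this, hσ2]; ring
  have he1 : 1 / (4 * q ^ 3) ≤ σ * e := by
    rw [hee, div_add_div _ _ (by positivity) (by positivity), div_le_div_iff₀ (by positivity) (by positivity)]
    have : 0 ≤ (1 / 2 + σ * q) * q ^ 5 := by
      refine mul_nonneg ?_ (by positivity)
      rcases hσ with rfl | rfl <;> linarith
    nlinarith
  have he2 : σ * e ≤ 1 / (2 * q ^ 3) := by
    rw [hee, div_add_div _ _ (by positivity) (by positivity), div_le_div_iff₀ (by positivity) (by positivity)]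
    have : 0 ≤ (1 / 2 - σ * q) * q ^ 5 := by
      refine mul_nonneg ?_ (by positivity)
      rcases hσ with rfl | rfl <;> linarith
    nlinarith
  have key : σ * (-(-(σ * A * (1 / (2 * q))) +
      d / 2 * ((-1 / (4 * (q ^ 2) ^ 2) - σ / (8 * q ^ 2 * q)) / b)) -
      (-(-1 / (4 * (q ^ 2) ^ 2) - σ / (8 * q ^ 2 * q))) * r ^ 2 +
      4 * b ^ 2 * r ^ 2 - 2 * b * d) - 2 * b * (d * B) * r =
      A / (2 * q) - d / 2 * (σ * e) * (1 / b) + (σ * e) * r ^ 2 - 2 * b * (d * B) * r := by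
    have : σ * (-(-(σ * A * (1 / (2 * q))) +
      d / 2 * ((-1 / (4 * (q ^ 2) ^ 2) - σ / (8 * q ^ 2 * q)) / b)) -
      (-(-1 / (4 * (q ^ 2) ^ 2) - σ / (8 * q ^ 2 * q))) * r ^ 2 +
      4 * b ^ 2 * r ^ 2 - 2 * b * d) - 2 * b * (d * B) * r =
      σ ^ 2 * (A / (2 * q)) - d / 2 * (σ * e) * (1 / b) + (σ * e) * r ^ 2 - 2 * b * (d * B) * r := by
      rw [he]
      clear_value e
      clear hbd hb1 hb2 he1 he2 hee he
      field_simp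
      ring
    rw [this, hσ2, one_mul]
  rw [key]
  have hib : 1 / b ≤ 8 * q ^ 2 := by
    rw [div_le_iff₀ hb]
    rw [div_le_iff₀ (by positivity)] at hb1
    linarith
  have hd0 : (0 : ℝ) ≤ d := Nat.cast_nonneg d
  have t1 : d / 2 * (σ * e) * (1 / b) ≤ 2 * d / q := by
    calc d / 2 * (σ * e) * (1 / b) ≤ d / 2 * (1 / (2 * q ^ 3)) * (8 * q ^ 2) := by gcongr
      _ = 2 * d / q := by field_simp; ring
  have t2 : 2 * b * (d * B) * r ≤ 2 * (3 / (8 * q ^ 2)) * (d * B) * r := by gcongr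
  have t3 : 1 / (4 * q ^ 3) * r ^ 2 ≤ (σ * e) * r ^ 2 := by gcongr
  have t4 : 0 ≤ 1 / (4 * q ^ 3) * r ^ 2 - 2 * (3 / (8 * q ^ 2)) * (d * B) * r +
      9 / 16 * (d * B) ^ 2 / q := by
    have : 1 / (4 * q ^ 3) * r ^ 2 - 2 * (3 / (8 * q ^ 2)) * (d * B) * r +
      9 / 16 * (d * B) ^ 2 / q = 1 / (4 * q ^ 3) * (r - 3 / 2 * (d * B) * q) ^ 2 := by
      field_simp; ring
    rw [this]; positivity
  have t5 : A / (2 * q) = 2 * d / q + 9 / 16 * (d * B) ^ 2 / q := by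
    rw [hA]; field_simp; ring
  rw [t5]
  linarith

lemma continuousAt_integral_heat {σ τ : ℝ} (hσ : |σ| ≤ 1) (A : ℝ) (h0 : 0 < τ) (h : τ < 1 / 4)
    {g : E d → ℝ} (hg : Continuous g) {K : ℝ} (hK : ∀ x, |g x| ≤ K) :
    ContinuousAt (fun τ => ∫ x, heat σ A τ x * g x) τ := by
  have hcA : ContinuousAt (heatAmp d σ A) τ := (hasDerivAt_heatAmp hσ A h0 h.le).continuousAt
  have hcR : ContinuousAt (heatRate σ) τ := (hasDerivAt_heatRate σ h0).continuousAt
  have hb := heatRate_pos hσ h0 h.le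
  refine continuousAt_of_dominated
    (bound := fun x => gauss (heatAmp d σ A τ + 1) (heatRate σ τ / 2) x * K) ?_ ?_ ?_ ?_
  · exact Filter.Eventually.of_forall fun r => ((continuous_heat σ A r).mul hg).aestronglyMeasurable
  · filter_upwards [hcA.eventually (gt_mem_nhds (lt_add_one _)),
      hcR.eventually (lt_mem_nhds (half_lt_self hb))] with r h1 h2
    refine Filter.Eventually.of_forall fun x => ?_
    rw [Real.norm_eq_abs, abs_mul, abs_of_pos (heat_pos _ _ _ _)]
    refine mul_le_mul (Real.exp_le_exp.2 (sub_le_sub h1.le ?_)) (hK x) (abs_nonneg _) (gauss_pos _ _ _).le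
    exact mul_le_mul_of_nonneg_right h2.le (sq_nonneg _)
  · exact (integrable_gauss (half_pos hb) _).mul_const K
  · refine Filter.Eventually.of_forall fun x => ContinuousAt.mul ?_ continuousAt_const
    exact Real.continuous_exp.continuousAt.comp (hcA.sub (hcR.mul continuousAt_const))

lemma tendsto_integral_heat {σ A : ℝ} (hσ : |σ| ≤ 1) (hA : 0 ≤ A) {g : E d → ℝ}
    (hg : Continuous g) {K : ℝ} (hK0 : 0 ≤ K) (x₀ : E d)
    (hK : ∀ x, |g (x₀ + x) - g x₀| ≤ K * ‖x‖) :
    Filter.Tendsto (fun τ => ∫ x, heat σ A τ x * g (x₀ + x)) (nhdsWithin 0 (Ioi 0)) (nhds (g x₀)) := by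
  have h1 : Filter.Tendsto (fun τ : ℝ => Real.exp (-(σ * A * √τ)) * g x₀) (nhdsWithin 0 (Ioi 0))
      (nhds (g x₀)) := by
    have : ContinuousAt (fun τ : ℝ => Real.exp (-(σ * A * √τ)) * g x₀) 0 := by fun_prop
    have := this.tendsto
    simp only [Real.sqrt_zero, mul_zero, neg_zero, Real.exp_zero, one_mul] at this
    exact this.mono_left nhdsWithin_le_nhds
  have h2 : Filter.Tendsto (fun τ : ℝ => K * (Real.exp A * 2 ^ (d / 2 : ℝ) * (3 * √τ)))
      (nhdsWithin 0 (Ioi 0)) (nhds 0) := by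
    have : ContinuousAt (fun τ : ℝ => K * (Real.exp A * 2 ^ (d / 2 : ℝ) * (3 * √τ))) 0 := by fun_prop
    have := this.tendsto
    simp only [Real.sqrt_zero, mul_zero] at this
    exact this.mono_left nhdsWithin_le_nhds
  have h3 : Filter.Tendsto (fun τ => (∫ x, heat σ A τ x * g (x₀ + x)) -
      Real.exp (-(σ * A * √τ)) * g x₀) (nhdsWithin 0 (Ioi 0)) (nhds 0) := by
    refine squeeze_zero_norm' ?_ h2
    filter_upwards [Ioo_mem_nhdsGT (show (0 : ℝ) < 1 / 4 by norm_num)] with τ hτ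
    exact abs_integral_heat_sub_le hσ hτ.1 hτ.2.le hA hK0 hg x₀ hK
  have := h3.add h1
  simpa using this

lemma SP.exists_lip {g : E d → ℝ} (hl : 0 < l) (hg : SP l g) :
    ∃ K, 0 ≤ K ∧ ∀ x y, |g y - g x| ≤ K * ‖y - x‖ := by
  obtain ⟨K, hK, h⟩ := IsPeriodic.exists_bound hl (g := fun x => fderiv ℝ g x) hg.periodic.fderiv
    (hg.smooth.continuous_fderiv (by simp))
  exact ⟨K, hK, fun x y => convex_univ.norm_image_sub_le_of_norm_fderiv_le
    (fun z _ => hg.differentiable z) (fun z _ => h z) (mem_univ x) (mem_univ y)⟩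

/-- Two-sided comparison of a Fokker–Planck solution with Gaussian averages. -/
lemma FPData.heat_barrier (h : FPData l T B V α) {σ A s t : ℝ} (hσ : σ = 1 ∨ σ = -1)
    (hA : A = 4 * d + 9 / 8 * (d * B) ^ 2) (hs0 : 0 ≤ s) (hst : s < t) (ht : t ≤ T)
    (hts : t - s < 1 / 4) (hruc : ∀ r ∈ Ico s t, RUC T α r) (x₀ : E d) :
    σ * ∫ x, heat σ A (t - s) x * α s (x₀ + x) ≤ σ * α t x₀ := by
  have hσ1 : |σ| ≤ 1 := by rcases hσ with rfl | rfl <;> simp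
  have hB := h.hB
  have hA0 : 0 ≤ A := by rw [hA]; positivity
  have hsT : s ∈ Icc 0 T := ⟨hs0, hst.le.trans ht⟩
  have htT : t ∈ Icc 0 T := ⟨hs0.trans hst.le, ht⟩
  obtain ⟨K, hK, hlip⟩ := (h.sα t htT).exists_lip h.hl
  have l1 := (tendsto_integral_heat hσ1 hA0 (h.sα t htT).continuous hK x₀
    (fun x => by simpa using hlip x₀ (x₀ + x))).const_mul σ
  obtain ⟨K', hK', hb⟩ := ((h.sα s hsT).comp_add x₀).exists_bound h.hl
  have l2 : Filter.Tendsto (fun ε => σ * ∫ x, heat σ A (t - s + ε) x * α s (x₀ + x))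
      (nhdsWithin 0 (Ioi 0)) (nhds (σ * ∫ x, heat σ A (t - s) x * α s (x₀ + x))) := by
    have c1 := continuousAt_integral_heat hσ1 A (sub_pos.2 hst) hts
      ((h.sα s hsT).comp_add x₀).continuous hb
    have c2 : ContinuousAt (fun ε => ∫ x, heat σ A (t - s + ε) x * α s (x₀ + x)) 0 :=
      ContinuousAt.comp (g := fun τ => ∫ x, heat σ A τ x * α s (x₀ + x)) (f := fun ε => t - s + ε)
        (by simpa using c1) (by fun_prop)
    have := (c2.tendsto.mono_left (nhdsWithin_le_nhds (s := Ioi 0))).const_mul σ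
    simpa using this
  refine le_of_tendsto_of_tendsto l2 l1 ?_
  filter_upwards [Ioo_mem_nhdsGT (show 0 < 1 / 4 - (t - s) by linarith)] with ε hε
  have hτ : ∀ r ∈ Icc s t, 0 < t + ε - r ∧ t + ε - r ≤ 1 / 4 := fun r hr =>
    ⟨by linarith [hr.2, hε.1], by linarith [hr.1, hε.2]⟩
  set p : ℝ → ℝ := fun r => heatAmp d σ A (t + ε - r) with hp
  set b : ℝ → ℝ := fun r => heatRate σ (t + ε - r) with hb
  set b' : ℝ → ℝ := fun r => -(-1 / (4 * (t + ε - r) ^ 2) - σ / (8 * (t + ε - r) * √(t + ε - r)))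
    with hb'
  set p' : ℝ → ℝ := fun r => -(-(σ * A * (1 / (2 * √(t + ε - r)))) +
    d / 2 * ((-1 / (4 * (t + ε - r) ^ 2) - σ / (8 * (t + ε - r) * √(t + ε - r))) /
      heatRate σ (t + ε - r))) with hp'
  have hpd : ∀ r ∈ Icc s t, HasDerivAt p (p' r) r := fun r hr => by
    have := (hasDerivAt_heatAmp (d := d) hσ1 A (hτ r hr).1 (hτ r hr).2).comp_const_sub (t + ε) r
    exact this
  have hbd : ∀ r ∈ Icc s t, HasDerivAt b (b' r) r := fun r hr =>
    (hasDerivAt_heatRate σ (hτ r hr).1).comp_const_sub (t + ε) r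
  have hbc : ContinuousOn b (Icc s t) := fun r hr => (hbd r hr).continuousAt.continuousWithinAt
  have hpc : ContinuousOn p (Icc s t) := fun r hr => (hpd r hr).continuousAt.continuousWithinAt
  have hsq : ∀ r ∈ Icc s t, √(t + ε - r) ≠ 0 := fun r hr => (Real.sqrt_pos.2 (hτ r hr).1).ne'
  have hne : ∀ r ∈ Icc s t, t + ε - r ≠ 0 := fun r hr => (hτ r hr).1.ne'
  have hb'c : ContinuousOn b' (Icc s t) := by
    refine ContinuousOn.neg (ContinuousOn.sub (ContinuousOn.div (by fun_prop) (by fun_prop) ?_)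
      (ContinuousOn.div (by fun_prop) (by fun_prop) ?_))
    · intro r hr
      have := hne r hr
      positivity
    · intro r hr
      have := hne r hr
      have := hsq r hr
      positivity
  have hp'c : ContinuousOn p' (Icc s t) := by
    refine ContinuousOn.neg (ContinuousOn.add (ContinuousOn.neg (ContinuousOn.mul (by fun_prop)
      (ContinuousOn.div (by fun_prop) (by fun_prop) ?_))) (ContinuousOn.mul (by fun_prop)
      (ContinuousOn.div ?_ hbc ?_)))
    · intro r hr
      have := hsq r hr
      positivity
    · have := hb'c.neg
      exact this.congr fun r _ => by simp only [hb', Pi.neg_apply, neg_neg]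
    · intro r hr
      exact (heatRate_pos hσ1 (hτ r hr).1 (hτ r hr).2).ne'
  obtain ⟨M1, hM1⟩ := isCompact_Icc.exists_bound_of_continuousOn hp'c
  obtain ⟨M2, hM2⟩ := isCompact_Icc.exists_bound_of_continuousOn hb'c
  obtain ⟨M3, hM3⟩ := isCompact_Icc.exists_bound_of_continuousOn hpc
  have hMM : M1 ≤ max (max M1 M2) M3 ∧ M2 ≤ max (max M1 M2) M3 ∧ M3 ≤ max (max M1 M2) M3 :=
    ⟨(le_max_left _ _).trans (le_max_left _ _), (le_max_right _ _).trans (le_max_left _ _),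
      le_max_right _ _⟩
  have hl' := left_mem_Icc.2 hst.le
  have := (h.comp_add x₀).gauss_mono hs0 hst.le ht (fun r hr => (hruc r hr).comp_add x₀)
    (p := p) (b := b) (p' := p') (b' := b') (M := max (max M1 M2) M3) (β := 1 / 2) (σ := σ)
    (by norm_num) (((norm_nonneg _).trans (hM1 s hl')).trans hMM.1) hσ1 hpd hbd
    (fun r hr => (hM1 r hr).trans hMM.1) (fun r hr => (hM2 r hr).trans hMM.2.1)
    (fun r hr => ((le_abs_self _).trans (hM3 r hr)).trans hMM.2.2)
    (fun r hr => (by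
      refine le_trans ?_ (heatRate_ge hσ1 (hτ r hr).1 (hτ r hr).2)
      rw [div_le_div_iff₀ (by norm_num) (by have := (hτ r hr).1; positivity)]
      linarith [(hτ r hr).2]))
    (fun r hr q hq => heat_subsol hσ (hτ r hr).1 (hτ r hr).2 hB hA hq)
  simp only [hp, hb] at this
  have e1 : t + ε - s = t - s + ε := by ring
  have e2 : t + ε - t = ε := by ring
  rw [e1, e2] at this
  exact this

end

section
variable {d : ℕ} {l : ℝ}

lemma norm_le_sqrt_mul {x : E d} {r : ℝ} (hr : 0 ≤ r) (h : ∀ i, |x i| ≤ r) : ‖x‖ ≤ √d * r := by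
  rw [EuclideanSpace.norm_eq]
  calc √(∑ i, ‖x i‖ ^ 2) ≤ √(∑ _i : Fin d, r ^ 2) := by
        apply Real.sqrt_le_sqrt
        exact Finset.sum_le_sum fun i _ => pow_le_pow_left₀ (norm_nonneg _) (h i) 2
    _ = √(d * r ^ 2) := by simp
    _ = √d * r := by rw [Real.sqrt_mul (Nat.cast_nonneg d), Real.sqrt_sq hr]

/-- A local-to-global principle for eventual nonpositivity of integrals, by subdivision. -/
lemma eventually_integral_box_nonpos (hd : 0 < d) (hl : 0 < l) {ι : Type*} {F : Filter ι}
    {u : ι → E d → ℝ} (hu : ∀ᶠ s in F, Continuous (u s))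
    (hloc : ∀ z : E d, ∃ r₀ > 0, ∀ r, 0 < r → r < r₀ → ∀ S : Set (E d), MeasurableSet S →
      volume.real S = r ^ d → (∀ x ∈ S, ‖x - z‖ ≤ √d * r) → ∀ᶠ s in F, ∫ x in S, u s x ≤ 0) :
    ∀ᶠ s in F, ∫ x in box d l, u s x ≤ 0 := by
  set e := (MeasurableEquiv.toLp 2 (Fin d → ℝ)).symm with he
  have hvp : MeasurePreserving e := EuclideanSpace.volume_preserving_symm_measurableEquiv_toLp (Fin d)
  set I : BoxIntegral.Box (Fin d) := ⟨fun _ => -(l / 2), fun _ => l / 2, fun _ => by linarith⟩ with hI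
  set S : BoxIntegral.Box (Fin d) → Set (E d) := fun J => e ⁻¹' (J : Set (Fin d → ℝ)) with hS
  have hSm : ∀ J, MeasurableSet (S J) := fun J => e.measurable J.measurableSet_coe
  have hvol : ∀ J : BoxIntegral.Box (Fin d), volume.real (S J) = ∏ i, (J.upper i - J.lower i) := by
    intro J
    have : volume (S J) = volume (J : Set (Fin d → ℝ)) :=
      hvp.measure_preimage J.measurableSet_coe.nullMeasurableSet
    rw [measureReal_def, this]
    exact BoxIntegral.Box.volume_apply' J
  have key : ∀ᶠ s in F, ∫ x in S I, u s x ≤ 0 := by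
    refine BoxIntegral.Box.subbox_induction_on' (p := fun J => ∀ᶠ s in F, ∫ x in S J, u s x ≤ 0) I ?_ ?_
    · intro J hJ hp
      filter_upwards [Filter.eventually_all.2 hp, hu] with s hs hus
      have hU : S J = ⋃ t, S (BoxIntegral.Box.splitCenterBox J t) := by
        simp only [hS, ← preimage_iUnion, BoxIntegral.Box.iUnion_coe_splitCenterBox]
      have hintg : ∀ J, IntegrableOn (u s) (S J) := by
        intro J
        refine (hus.continuousOn.integrableOn_compact
          ((EuclideanSpace.equiv (Fin d) ℝ).toHomeomorph.isCompact_preimage.2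
          (isCompact_Icc (a := J.lower) (b := J.upper)))).mono_set ?_
        exact preimage_mono BoxIntegral.Box.coe_subset_Icc
      rw [hU, integral_iUnion_fintype (fun t => hSm _) (fun t t' htt => by
        exact Disjoint.preimage e (BoxIntegral.Box.disjoint_splitCenterBox J htt)) (fun t => hintg _)]
      exact Finset.sum_nonpos fun t _ => hs t
    · intro z hz
      obtain ⟨r₀, hr₀, h⟩ := hloc (e.symm z)
      refine ⟨BoxIntegral.Box.Icc I ∩ Metric.closedBall z (r₀ / 4),
        inter_mem_nhdsWithin _ (Metric.closedBall_mem_nhds _ (by positivity)), ?_⟩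
      intro J hJ m hzJ hJU hside
      have hside' : ∀ i, J.upper i - J.lower i = l / 2 ^ m := by
        intro i; rw [hside i]; simp [hI]
      refine h (l / 2 ^ m) (by positivity) ?_ (S J) (hSm J) ?_ ?_
      · have h1 := (hJU J.upper_mem_Icc).2
        have h2 := (hJU J.lower_mem_Icc).2
        have h3 : dist J.upper J.lower ≤ r₀ / 4 + r₀ / 4 :=
          (dist_triangle_right _ _ z).trans (add_le_add h1 h2)
        have h4 := (dist_le_pi_dist J.upper J.lower ⟨0, hd⟩).trans h3
        rw [Real.dist_eq, hside', abs_of_pos (by positivity)] at h4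
        linarith
      · rw [hvol]; simp [hside', div_pow]
      · intro x hx
        refine norm_le_sqrt_mul (by positivity) fun i => ?_
        have h1 : e x ∈ BoxIntegral.Box.Icc J := BoxIntegral.Box.coe_subset_Icc hx
        have a1 := h1.1 i
        have a2 := h1.2 i
        have a3 := hzJ.1 i
        have a4 := hzJ.2 i
        have := hside' i
        change |e x i - z i| ≤ _
        rw [abs_le]
        constructor <;> linarith
  have hae : (box d l : Set (E d)) =ᵐ[volume] S I := by
    have h2 : (box d l : Set (E d)) = e ⁻¹' (Set.pi univ fun _ => Icc (-(l / 2)) (l / 2)) := by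
      ext x; simp only [box, mem_ofPred_eq, mem_preimage, mem_pi, mem_univ, true_imp_iff]; rfl
    rw [h2, hS]
    refine hvp.quasiMeasurePreserving.preimage_ae_eq ?_
    rw [BoxIntegral.Box.coe_eq_pi, pi_univ_Icc]
    exact (Measure.univ_pi_Ioc_ae_eq_Icc (μ := fun _ : Fin d => (volume : Measure ℝ))
      (f := fun _ => -(l / 2)) (g := fun _ => l / 2)).symm
  filter_upwards [key] with s hs
  rwa [setIntegral_congr_set hae]

/-- Gaussian averages of nonnegative periodic functions are controlled by their mass. -/
lemma exists_integral_gauss_le (hl : 0 < l) (c : ℝ) {b : ℝ} (hb : 0 < b) :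
    ∃ C, 0 ≤ C ∧ ∀ g : E d → ℝ, Continuous g → IsPeriodic l g → (∀ x, 0 ≤ g x) → ∀ x₀,
      ∫ x, gauss c b x * g (x₀ + x) ≤ C * ∫ x in box d l, g x := by
  obtain ⟨D, hD⟩ := (isCompact_box d l).isBounded.exists_norm_le
  set c' := c + b * D ^ 2 with hc'
  have hcomp : ∀ u : E d, ∀ v ∈ box d l, gauss c b (u + v) ≤ gauss c' (b / 2) u := by
    intro u v hv
    refine Real.exp_le_exp.2 ?_
    have h1 := hD v hv
    have h2 : ‖u‖ ^ 2 ≤ 2 * ‖u + v‖ ^ 2 + 2 * ‖v‖ ^ 2 := by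
      have : ‖u‖ ≤ ‖u + v‖ + ‖v‖ := by simpa using norm_sub_le (u + v) v
      nlinarith [sq_nonneg (‖u + v‖ - ‖v‖), norm_nonneg u, norm_nonneg (u + v), norm_nonneg v]
    have h3 : ‖v‖ ^ 2 ≤ D ^ 2 := pow_le_pow_left₀ (norm_nonneg _) h1 2
    rw [hc']
    nlinarith
  set w := volume.real (box d l) with hw
  have hw0 : 0 < w := by
    rw [hw, measureReal_def]
    refine ENNReal.toReal_pos ?_ (volume_box_lt_top d l).ne
    have : (box d l) ∈ nhds (0 : E d) := by
      have : Metric.ball (0 : E d) (l / 2) ⊆ box d l := by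
        intro x hx i
        rw [mem_ball_zero_iff] at hx
        have := abs_le.1 ((abs_coord_le x i).trans hx.le)
        exact this
      exact Filter.mem_of_superset (Metric.ball_mem_nhds _ (by positivity)) this
    exact (Measure.measure_pos_of_mem_nhds volume this).ne'
  refine ⟨(∫ x : E d, gauss c' (b / 2) x) / w, div_nonneg
    (integral_nonneg fun x => (gauss_pos _ _ _).le) hw0.le, fun g hg hp h0 x₀ => ?_⟩
  obtain ⟨K, hK, hgK⟩ := hp.exists_bound hl hg
  have e1 : ∀ v, ∫ x, gauss c b x * g (x₀ + x) = ∫ u, gauss c b (u + v) * g (x₀ + (u + v)) := fun v =>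
    (integral_add_right_eq_self (fun x => gauss c b x * g (x₀ + x)) v).symm
  have hg' : ∀ v, Continuous fun u => g (x₀ + (u + v)) := fun v => by fun_prop
  have h1 : ∀ v ∈ box d l, ∫ x, gauss c b x * g (x₀ + x) ≤
      ∫ u, gauss c' (b / 2) u * g (x₀ + (u + v)) := by
    intro v hv
    rw [e1 v]
    have i1 : Integrable fun x => gauss c b x * g (x₀ + x) :=
      integrable_gauss_mul_bdd hb c (by fun_prop) (fun x => hgK _)
    refine integral_mono (i1.comp_add_right v)
      (integrable_gauss_mul_bdd (half_pos hb) _ (hg' v) (fun x => hgK _)) fun u => ?_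
    exact mul_le_mul_of_nonneg_right (hcomp u v hv) (h0 _)
  have hintg : Integrable (Function.uncurry fun v u => gauss c' (b / 2) u * g (x₀ + (u + v)))
      ((volume.restrict (box d l)).prod volume) := by
    have i1 : Integrable (fun z : E d × E d => K * gauss c' (b / 2) z.2)
        ((volume.restrict (box d l)).prod volume) :=
      (integrable_const K).mul_prod (integrable_gauss (half_pos hb) c')
    refine i1.mono' ?_ (Filter.Eventually.of_forall fun z => ?_)
    · have := continuous_gauss (d := d) c' (b / 2)
      exact Continuous.aestronglyMeasurable (by unfold Function.uncurry; fun_prop)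
    · simp only [Function.uncurry, norm_mul]
      rw [Real.norm_of_nonneg (gauss_pos _ _ _).le, mul_comm]
      exact mul_le_mul_of_nonneg_right (hgK _) (gauss_pos _ _ _).le
  have h2 : w * ∫ x, gauss c b x * g (x₀ + x) ≤
      ∫ v in box d l, ∫ u, gauss c' (b / 2) u * g (x₀ + (u + v)) := by
    have := setIntegral_mono_on (integrable_const (μ := volume.restrict (box d l))
      (∫ x, gauss c b x * g (x₀ + x))) hintg.integral_prod_left (measurableSet_box d l) h1
    simpa using this
  rw [integral_integral_swap hintg] at h2
  have h3 : ∀ u, ∫ v in box d l, gauss c' (b / 2) u * g (x₀ + (u + v)) =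
      gauss c' (b / 2) u * ∫ x in box d l, g x := by
    intro u
    rw [integral_const_mul, ← integral_box_add hl hp (x₀ + u)]
    congr 1
    refine setIntegral_congr_fun (measurableSet_box d l) fun v _ => ?_
    congr 1; abel
  simp only [h3] at h2
  rw [integral_mul_const] at h2
  rw [div_mul_eq_mul_div, le_div_iff₀ hw0]
  linarith

end

section
variable {d : ℕ} {l T B : ℝ} {V α : ℝ → E d → ℝ}

lemma eventually_heat_le {σ τ : ℝ} (hσ : |σ| ≤ 1) (A : ℝ) (h0 : 0 < τ) (h : τ < 1 / 4) :
    ∀ᶠ r in nhds τ, ∀ x : E d,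
      heat σ A r x ≤ gauss (heatAmp d σ A τ + 1) (heatRate σ τ / 2) x := by
  have hcA : ContinuousAt (heatAmp d σ A) τ := (hasDerivAt_heatAmp hσ A h0 h.le).continuousAt
  have hcR : ContinuousAt (heatRate σ) τ := (hasDerivAt_heatRate σ h0).continuousAt
  filter_upwards [hcA.eventually (gt_mem_nhds (lt_add_one _)),
    hcR.eventually (lt_mem_nhds (half_lt_self (heatRate_pos hσ h0 h.le)))] with r h1 h2 x
  exact Real.exp_le_exp.2 (sub_le_sub h1.le (mul_le_mul_of_nonneg_right h2.le (sq_nonneg _)))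

lemma continuousAt_heat {σ τ : ℝ} (hσ : |σ| ≤ 1) (A : ℝ) (h0 : 0 < τ) (h : τ < 1 / 4) (x : E d) :
    ContinuousAt (fun r => heat σ A r x) τ := by
  have hcA : ContinuousAt (heatAmp d σ A) τ := (hasDerivAt_heatAmp hσ A h0 h.le).continuousAt
  have hcR : ContinuousAt (heatRate σ) τ := (hasDerivAt_heatRate σ h0).continuousAt
  exact Real.continuous_exp.continuousAt.comp (hcA.sub (hcR.mul continuousAt_const))

lemma tendsto_integral_heat_mul {σ τ : ℝ} (hσ : |σ| ≤ 1) (A : ℝ) (h0 : 0 < τ) (h : τ < 1 / 4)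
    {ι : Type*} {F : Filter ι} [F.IsCountablyGenerated] {r : ι → ℝ}
    (hr : Filter.Tendsto r F (nhds τ)) {g : ι → E d → ℝ} {g₀ : E d → ℝ} {K : ℝ}
    (hg : ∀ᶠ s in F, Continuous (g s)) (hK : ∀ᶠ s in F, ∀ x, |g s x| ≤ K)
    (hlim : ∀ x, Filter.Tendsto (fun s => g s x) F (nhds (g₀ x))) :
    Filter.Tendsto (fun s => ∫ x, heat σ A (r s) x * g s x) F
      (nhds (∫ x, heat σ A τ x * g₀ x)) := by
  refine tendsto_integral_filter_of_dominated_convergence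
    (fun x => gauss (heatAmp d σ A τ + 1) (heatRate σ τ / 2) x * K) ?_ ?_ ?_ ?_
  · filter_upwards [hg] with s hs
    exact ((continuous_heat σ A _).mul hs).aestronglyMeasurable
  · filter_upwards [hK, hr.eventually (eventually_heat_le hσ A h0 h)] with s h1 h2
    refine Filter.Eventually.of_forall fun x => ?_
    rw [Real.norm_eq_abs, abs_mul, abs_of_pos (heat_pos _ _ _ _)]
    exact mul_le_mul (h2 x) (h1 x) (abs_nonneg _) (gauss_pos _ _ _).le
  · exact (integrable_gauss (half_pos (heatRate_pos hσ h0 h.le)) _).mul_const K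
  · exact Filter.Eventually.of_forall fun x =>
      ((continuousAt_heat hσ A h0 h x).tendsto.comp hr).mul (hlim x)

/-- Pointwise lower bound for the heat kernel on the natural parabolic scale. -/
lemma heat_ge {A r τ : ℝ} (hA : 0 ≤ A) (hr : 0 < r) (hτ0 : r ^ 2 / 2 ≤ τ) (hτ1 : τ ≤ r ^ 2)
    (hτ : τ ≤ 1 / 4) {x : E d} (hx : ‖x‖ ≤ √d * r) :
    Real.exp (-A - 3 / 4 * d) * (1 / (8 * Real.pi)) ^ (d / 2 : ℝ) / r ^ d ≤ heat 1 A τ x := by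
  have hτp : 0 < τ := lt_of_lt_of_le (by positivity) hτ0
  have hσ : |(1 : ℝ)| ≤ 1 := by simp
  have hrate := heatRate_le hσ hτp hτ
  have hrate' := heatRate_ge hσ hτp hτ
  have hx2 : ‖x‖ ^ 2 ≤ d * r ^ 2 := by
    calc ‖x‖ ^ 2 ≤ (√d * r) ^ 2 := pow_le_pow_left₀ (norm_nonneg _) hx 2
      _ = d * r ^ 2 := by rw [mul_pow, Real.sq_sqrt (Nat.cast_nonneg d)]
  have e1 : Real.exp (-A - 3 / 4 * d) ≤
      Real.exp (-(1 * A * √τ)) * Real.exp (-(heatRate 1 τ * ‖x‖ ^ 2)) := by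
    rw [← Real.exp_add]
    refine Real.exp_le_exp.2 ?_
    have h1 : A * √τ ≤ A := by
      have := sqrt_le_half hτ
      nlinarith
    have h2 : heatRate 1 τ * ‖x‖ ^ 2 ≤ 3 / 4 * d := by
      calc heatRate 1 τ * ‖x‖ ^ 2 ≤ 3 / (8 * τ) * (d * r ^ 2) :=
            mul_le_mul hrate hx2 (sq_nonneg _) (by positivity)
        _ ≤ 3 / 4 * d := by
            rw [div_mul_eq_mul_div, div_le_iff₀ (by positivity)]
            have : (0 : ℝ) ≤ d := Nat.cast_nonneg d
            nlinarith
    linarith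
  have e2 : (1 / (8 * Real.pi)) ^ (d / 2 : ℝ) / r ^ d ≤ (heatRate 1 τ / Real.pi) ^ (d / 2 : ℝ) := by
    have h3 : (1 / (8 * Real.pi)) ^ (d / 2 : ℝ) / r ^ d =
        (1 / (8 * Real.pi) / r ^ 2) ^ (d / 2 : ℝ) := by
      rw [Real.div_rpow (x := 1 / (8 * Real.pi)) (y := r ^ 2) (by positivity) (by positivity)]
      congr 1
      rw [← Real.rpow_natCast r 2, ← Real.rpow_mul hr.le, ← Real.rpow_natCast]
      congr 1
      push_cast; ring
    rw [h3]
    refine Real.rpow_le_rpow (by positivity) ?_ (by positivity)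
    calc 1 / (8 * Real.pi) / r ^ 2 = 1 / (8 * r ^ 2) / Real.pi := by field_simp
      _ ≤ 1 / (8 * τ) / Real.pi := by gcongr
      _ ≤ _ := by gcongr
  have e3 : heat 1 A τ x = Real.exp (-(1 * A * √τ)) * Real.exp (-(heatRate 1 τ * ‖x‖ ^ 2)) *
      (heatRate 1 τ / Real.pi) ^ (d / 2 : ℝ) := by
    rw [heat, gauss, sub_eq_add_neg, Real.exp_add, exp_heatAmp hσ hτp hτ]
    ring
  rw [e3, mul_div_assoc]
  exact mul_le_mul e1 e2 (by positivity) (by positivity)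

/-- Extra mass in a set is felt from above at later times. -/
lemma integral_heat_min_add_le {A τ m : ℝ} (h0 : 0 < τ) (h : τ ≤ 1 / 4) (hm : 0 ≤ m)
    {f g : E d → ℝ} (hf : Continuous f) (hg : Continuous g) {K : ℝ} (hfK : ∀ x, |f x| ≤ K)
    (hgK : ∀ x, |g x| ≤ K) (z : E d) {S : Set (E d)} (hS : MeasurableSet S) (hSf : volume S ≠ ⊤)
    (hmS : ∀ y ∈ S, m ≤ heat 1 A τ (y - z)) :
    (∫ x, heat 1 A τ x * min (f (z + x)) (g (z + x))) + m * ∫ y in S, (f y - g y) ≤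
      ∫ x, heat 1 A τ x * f (z + x) := by
  have hb := heatRate_pos (σ := 1) (by simp) h0 h
  set p : E d → ℝ := fun y => max (f y - g y) 0 with hp
  have hpc : Continuous p := (hf.sub hg).max continuous_const
  have hpK : ∀ x, |p x| ≤ 2 * K := by
    intro x
    rw [hp, abs_of_nonneg (le_max_right _ _)]
    have h1 := abs_le.1 (hfK x); have h2 := abs_le.1 (hgK x)
    exact max_le (by linarith) (by linarith)
  have hmin : ∀ y, f y = min (f y) (g y) + p y := by
    intro y
    simp only [hp]
    rcases le_total (f y) (g y) with h | h
    · rw [min_eq_left h, max_eq_right (by linarith), add_zero]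
    · rw [min_eq_right h, max_eq_left (by linarith)]; ring
  have i1 : Integrable fun x => heat 1 A τ x * min (f (z + x)) (g (z + x)) :=
    integrable_gauss_mul_bdd hb _ (by fun_prop) (K := K) fun x => by
      rcases min_choice (f (z + x)) (g (z + x)) with h | h <;> rw [h]
      exacts [hfK _, hgK _]
  have i2 : Integrable fun x => heat 1 A τ x * p (z + x) :=
    integrable_gauss_mul_bdd hb _ (by fun_prop) (K := 2 * K) fun x => hpK _
  have e1 : ∫ x, heat 1 A τ x * f (z + x) =
      (∫ x, heat 1 A τ x * min (f (z + x)) (g (z + x))) + ∫ x, heat 1 A τ x * p (z + x) := by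
    rw [← integral_add i1 i2]
    refine integral_congr_ae (Filter.Eventually.of_forall fun x => ?_)
    change heat 1 A τ x * f (z + x) = _
    rw [hmin (z + x)]; ring
  have e2 : ∫ x, heat 1 A τ x * p (z + x) = ∫ y, heat 1 A τ (y - z) * p y := by
    rw [← integral_sub_right_eq_self (fun x => heat 1 A τ x * p (z + x)) z]
    simp
  have i3 : Integrable fun y => heat 1 A τ (y - z) * p y := by
    have := i2.comp_sub_right z
    simpa using this
  have hbd : ∀ u : E d → ℝ, Continuous u → (∀ x, |u x| ≤ 2 * K) → IntegrableOn u S := by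
    intro u hu hK
    have : IsFiniteMeasure (volume.restrict S) := ⟨by simpa using hSf.lt_top⟩
    exact Integrable.of_bound hu.aestronglyMeasurable (2 * K) (Filter.Eventually.of_forall hK)
  have e3 : m * ∫ y in S, (f y - g y) ≤ ∫ y, heat 1 A τ (y - z) * p y := by
    calc m * ∫ y in S, (f y - g y) ≤ m * ∫ y in S, p y := by
          refine mul_le_mul_of_nonneg_left ?_ hm
          refine setIntegral_mono (hbd _ (hf.sub hg) fun x => ?_) (hbd _ hpc hpK) fun y => le_max_left _ _
          exact (abs_sub _ _).trans (by linarith [hfK x, hgK x])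
      _ = ∫ y in S, m * p y := (integral_const_mul _ _).symm
      _ ≤ ∫ y in S, heat 1 A τ (y - z) * p y :=
          setIntegral_mono_on ((hbd _ hpc hpK).const_mul m) i3.integrableOn hS fun y hy =>
            mul_le_mul_of_nonneg_right (hmS y hy) (le_max_right _ _)
      _ ≤ _ := setIntegral_le_integral i3 (Filter.Eventually.of_forall fun y =>
          mul_nonneg (heat_pos _ _ _ _).le (le_max_right _ _))
  rw [e1, e2]
  linarith

end

section
variable {d : ℕ} {l T B : ℝ} {V α : ℝ → E d → ℝ}

namespace FPData

lemma tendsto_right (h : FPData l T B V α) {a : ℝ} (ha : a ∈ Icc 0 T) (x : E d) :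
    Filter.Tendsto (fun s => α s x) (nhdsWithin a (Ioi a)) (nhds (α a x)) :=
  (h.der a ha x).continuousAt.tendsto.mono_left nhdsWithin_le_nhds

/-- Lower bound starting from a time where right uniform continuity may fail. -/
lemma heat_lower (h : FPData l T B V α) {A a t : ℝ} (hA : A = 4 * d + 9 / 8 * (d * B) ^ 2)
    (ha0 : 0 ≤ a) (hat : a < t) (ht : t ≤ T) (hta : t - a < 1 / 4)
    (hruc : ∀ r ∈ Ioo a t, RUC T α r) (z : E d) {S : Set (E d)} (hS : MeasurableSet S)
    (hSf : volume S ≠ ⊤) {m c : ℝ} (hm : 0 ≤ m)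
    (hmS : ∀ᶠ s in nhdsWithin a (Ioi a), ∀ y ∈ S, m ≤ heat 1 A (t - s) (y - z))
    (hc : ∃ᶠ s in nhdsWithin a (Ioi a), c ≤ ∫ y in S, (α s y - α a y)) :
    (∫ x, heat 1 A (t - a) x * α a (z + x)) + m * c ≤ α t z := by
  have haT : a ∈ Icc 0 T := ⟨ha0, hat.le.trans ht⟩
  obtain ⟨K, hK0, hK⟩ := (h.sα a haT).exists_bound h.hl
  have hlim : Filter.Tendsto (fun s => ∫ x, heat 1 A (t - s) x * min (α s (z + x)) (α a (z + x)))
      (nhdsWithin a (Ioi a)) (nhds (∫ x, heat 1 A (t - a) x * α a (z + x))) := by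
    have hr : Filter.Tendsto (fun s => t - s) (nhdsWithin a (Ioi a)) (nhds (t - a)) :=
      ((continuous_const.sub continuous_id).tendsto a).mono_left nhdsWithin_le_nhds
    refine tendsto_integral_heat_mul (by simp) A (by linarith) hta hr (K := K) ?_ ?_ fun x => ?_
    · filter_upwards [Ioo_mem_nhdsGT hat] with s hs
      have h1 := (h.sα s ⟨ha0.trans hs.1.le, hs.2.le.trans ht⟩).continuous
      have h2 := (h.sα a haT).continuous
      fun_prop
    · filter_upwards [Ioo_mem_nhdsGT hat] with s hs x
      have hp := h.pos s ⟨ha0.trans hs.1.le, hs.2.le.trans ht⟩ (z + x)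
      rw [abs_of_pos (lt_min hp (h.pos a haT _))]
      exact (min_le_right _ _).trans ((le_abs_self _).trans (hK _))
    · have := (h.tendsto_right haT (z + x)).min (tendsto_const_nhds (x := α a (z + x)))
      simpa using this
  have hfr : ∃ᶠ s in nhdsWithin a (Ioi a),
      (∫ x, heat 1 A (t - s) x * min (α s (z + x)) (α a (z + x))) + m * c ≤ α t z := by
    refine (hc.and_eventually (hmS.and (Ioo_mem_nhdsGT hat))).mono fun s hs => ?_
    obtain ⟨h1, h2, h3⟩ := hs
    have hsT : s ∈ Icc 0 T := ⟨ha0.trans h3.1.le, h3.2.le.trans ht⟩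
    obtain ⟨K', hK0', hK'⟩ := (h.sα s hsT).exists_bound h.hl
    have := h.heat_barrier (Or.inl rfl) hA hsT.1 h3.2 ht (by linarith [h3.1])
      (fun r hr => hruc r ⟨h3.1.trans_le hr.1, hr.2⟩) z
    rw [one_mul, one_mul] at this
    have h4 := integral_heat_min_add_le (A := A) (sub_pos.2 h3.2) (by linarith [h3.1]) hm
      (h.sα s hsT).continuous (h.sα a haT).continuous (K := max K K')
      (fun x => (hK' x).trans (le_max_right _ _)) (fun x => (hK x).trans (le_max_left _ _)) z hS hSf h2
    have h5 := mul_le_mul_of_nonneg_left h1 hm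
    linarith
  exact le_of_tendsto_of_frequently (hlim.add_const _) hfr

/-- No mass concentrates instantaneously: convergence in `L¹` from the right. -/
lemma eventually_integral_abs_le (h : FPData l T B V α) (hd : 0 < d) {a b : ℝ}
    (ha0 : 0 ≤ a) (hab : a < b) (hb : b ≤ T) (hruc : ∀ r ∈ Ioo a b, RUC T α r) {η : ℝ} (hη : 0 < η) :
    ∀ᶠ s in nhdsWithin a (Ioi a), ∫ x in box d l, |α s x - α a x| ≤ η := by
  have haT : a ∈ Icc 0 T := ⟨ha0, hab.le.trans hb⟩
  have hIoo := Ioo_mem_nhdsGT hab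
  have hmem : ∀ s ∈ Ioo a b, s ∈ Icc 0 T := fun s hs => ⟨ha0.trans hs.1.le, hs.2.le.trans hb⟩
  set A : ℝ := 4 * d + 9 / 8 * (d * B) ^ 2 with hA
  have hA0 : 0 ≤ A := by rw [hA]; positivity
  set w := volume.real (box d l) with hw
  have hw0 : 0 ≤ w := measureReal_nonneg
  set ε := η / (2 * (w + 1)) with hε
  have hε0 : 0 < ε := by positivity
  have hIncr : ∀ᶠ s in nhdsWithin a (Ioi a), ∫ x in box d l, (α s x - α a x - ε) ≤ 0 := by
    refine eventually_integral_box_nonpos hd h.hl ?_ fun z => ?_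
    · filter_upwards [hIoo] with s hs
      have h1 := (h.sα s (hmem s hs)).continuous
      have h2 := (h.sα a haT).continuous
      fun_prop
    set c := Real.exp (-A - 3 / 4 * d) * (1 / (8 * Real.pi)) ^ (d / 2 : ℝ) with hc
    have hc0 : 0 < c := by positivity
    obtain ⟨L, hL0, hL⟩ := (h.sα a haT).exists_lip h.hl
    set D := L * (Real.exp A * 2 ^ (d / 2 : ℝ) * 3) with hD
    have hcont : ContinuousAt (fun r : ℝ => α (a + r ^ 2) z - Real.exp (-(A * r)) * α a z + D * r) 0 := by
      have h1 : ContinuousAt (fun r : ℝ => α (a + r ^ 2) z) 0 := by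
        have h2 : ContinuousAt (fun τ => α τ z) (a + 0 ^ 2) := by
          simpa using (h.der a haT z).continuousAt
        exact ContinuousAt.comp (f := fun r : ℝ => a + r ^ 2) (g := fun τ => α τ z) h2 (by fun_prop)
      have h3 : ContinuousAt (fun r : ℝ => Real.exp (-(A * r)) * α a z) 0 := by fun_prop
      exact (h1.sub h3).add (by fun_prop)
    have hev := hcont.tendsto.eventually_lt_const (u := c * ε) (by simpa using mul_pos hc0 hε0)
    obtain ⟨r₁, hr₁, hr₁'⟩ := Metric.eventually_nhds_iff.1 hev
    refine ⟨min (min r₁ (1 / 2)) (min 1 (b - a)), by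
      have := sub_pos.2 hab
      positivity, fun r hr0 hr S hS hSv hSz => ?_⟩
    simp only [lt_min_iff] at hr
    obtain ⟨⟨hr1, hr2⟩, hr3, hr4⟩ := hr
    have hrb : r ^ 2 < b - a := by nlinarith
    have hrq : r ^ 2 < 1 / 4 := by nlinarith
    have hr2p : 0 < r ^ 2 := by positivity
    have hSf : volume S ≠ ⊤ := by
      intro hS'
      rw [measureReal_def, hS'] at hSv
      simp only [ENNReal.toReal_top] at hSv
      exact (pow_pos hr0 d).ne hSv
    have hnot : ¬ ∃ᶠ s in nhdsWithin a (Ioi a), ε * r ^ d ≤ ∫ y in S, (α s y - α a y) := by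
      intro hfr
      have h1 := h.heat_lower hA ha0 (t := a + r ^ 2) (by linarith) (by linarith) (by linarith)
        (fun s hs => hruc s ⟨hs.1, hs.2.trans (by linarith)⟩) z hS hSf
        (m := c / r ^ d) (by positivity) (by
          have hI : Ioo a (a + r ^ 2 / 2) ∈ nhdsWithin a (Ioi a) := Ioo_mem_nhdsGT (by linarith)
          filter_upwards [hI] with s hs y hy
          exact heat_ge hA0 hr0 (by linarith [hs.2]) (by linarith [hs.1]) (by linarith [hs.1]) (hSz y hy))
        hfr
      have h2 := hr₁' (y := r) (by simpa [abs_of_pos hr0] using hr1)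
      have h3 := abs_integral_heat_sub_le (σ := 1) (A := A) (τ := a + r ^ 2 - a) (K := L) (by simp)
        (by linarith) (by linarith) hA0 hL0 (h.sα a haT).continuous z (fun x => by
          simpa using hL z (z + x))
      have h4 : √(a + r ^ 2 - a) = r := by rw [add_sub_cancel_left, Real.sqrt_sq hr0.le]
      rw [h4, one_mul] at h3
      have h5 := (abs_le.1 h3).1
      have h6 : c / r ^ d * (ε * r ^ d) = c * ε := by
        field_simp
      have h7 : L * (Real.exp A * 2 ^ (d / 2 : ℝ) * (3 * r)) = D * r := by rw [hD]; ring
      rw [h7] at h5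
      rw [h6] at h1
      linarith
    rw [Filter.not_frequently] at hnot
    filter_upwards [hnot, hIoo] with s hs hs'
    have : IsFiniteMeasure (volume.restrict S) := ⟨by simpa using hSf.lt_top⟩
    have hi : ∀ t ∈ Icc 0 T, IntegrableOn (α t) S := by
      intro t ht
      obtain ⟨K, hK0, hK⟩ := (h.sα t ht).exists_bound h.hl
      exact Integrable.of_bound (h.sα t ht).continuous.aestronglyMeasurable K
        (Filter.Eventually.of_forall hK)
    rw [integral_sub (f := fun x => α s x - α a x) ((hi s (hmem s hs')).sub (hi a haT))
      (integrable_const ε)]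
    simp only [integral_const, measureReal_restrict_apply_univ, hSv, smul_eq_mul]
    linarith
  have hNegPart : Filter.Tendsto (fun s => ∫ x in box d l, max (α a x - α s x) 0)
      (nhdsWithin a (Ioi a)) (nhds (∫ x in box d l, (0 : ℝ))) := by
    refine tendsto_integral_filter_of_dominated_convergence (fun x => α a x) ?_ ?_ ?_ ?_
    · filter_upwards [hIoo] with s hs
      have h1 := (h.sα s (hmem s hs)).continuous
      have h2 := (h.sα a haT).continuous
      exact Continuous.aestronglyMeasurable (by fun_prop)
    · filter_upwards [hIoo] with s hs
      refine Filter.Eventually.of_forall fun x => ?_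
      have h1 := h.pos s (hmem s hs) x
      have h2 := h.pos a haT x
      rw [Real.norm_eq_abs, abs_of_nonneg (le_max_right _ _)]
      exact max_le (by linarith) h2.le
    · exact integrableOn_box (h.sα a haT).continuous
    · refine Filter.Eventually.of_forall fun x => ?_
      have := ((tendsto_const_nhds (x := α a x)).sub (h.tendsto_right haT x)).max
        (tendsto_const_nhds (x := (0 : ℝ)))
      simpa using this
  rw [integral_zero] at hNegPart
  filter_upwards [hIncr, hNegPart.eventually (gt_mem_nhds (show (0 : ℝ) < η / 4 by positivity)), hIoo]
    with s h1 h2 hs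
  have hcs := (h.sα s (hmem s hs)).continuous
  have hca := (h.sα a haT).continuous
  have e : ∀ x, |α s x - α a x| = (α s x - α a x - ε) + ε + 2 * max (α a x - α s x) 0 := by
    intro x
    rcases le_total (α s x) (α a x) with h | h
    · rw [abs_of_nonpos (by linarith), max_eq_left (by linarith)]; ring
    · rw [abs_of_nonneg (by linarith), max_eq_right (by linarith)]; ring
  have j1 : IntegrableOn (fun x => α s x - α a x - ε) (box d l) := integrableOn_box (by fun_prop)
  have j2 : IntegrableOn (fun _ : E d => ε) (box d l) := integrableOn_box (by fun_prop)
  have j3 : IntegrableOn (fun x => 2 * max (α a x - α s x) 0) (box d l) := integrableOn_box (by fun_prop)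
  simp only [e]
  rw [integral_add (f := fun x => α s x - α a x - ε + ε) (j1.add j2) j3, integral_add j1 j2, integral_const_mul]
  simp only [integral_const, measureReal_restrict_apply_univ, smul_eq_mul]
  have : w * ε ≤ η / 2 := by
    rw [hε, mul_div_assoc', div_le_div_iff₀ (by positivity) (by positivity)]
    nlinarith
  linarith

/-- Upper bound starting from a time where right uniform continuity may fail. -/
lemma heat_upper (h : FPData l T B V α) (hd : 0 < d) {A a t : ℝ}
    (hA : A = 4 * d + 9 / 8 * (d * B) ^ 2)
    (ha0 : 0 ≤ a) (hat : a < t) (ht : t ≤ T) (hta : t - a < 1 / 4)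
    (hruc : ∀ r ∈ Ioo a t, RUC T α r) (z : E d) :
    α t z ≤ ∫ x, heat (-1) A (t - a) x * α a (z + x) := by
  have haT : a ∈ Icc 0 T := ⟨ha0, hat.le.trans ht⟩
  have hca := (h.sα a haT).continuous
  obtain ⟨K, hK0, hK⟩ := (h.sα a haT).exists_bound h.hl
  have hσ : |(-1 : ℝ)| ≤ 1 := by simp
  set τ := t - a with hτ
  have hτ0 : 0 < τ := sub_pos.2 hat
  have hrate := heatRate_pos hσ hτ0 hta.le
  obtain ⟨C, hC0, hC⟩ := exists_integral_gauss_le (d := d) h.hl (heatAmp d (-1) A τ + 1) (half_pos hrate)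
  have hr : Filter.Tendsto (fun s => t - s) (nhdsWithin a (Ioi a)) (nhds τ) :=
    ((continuous_const.sub continuous_id).tendsto a).mono_left nhdsWithin_le_nhds
  have hlim : Filter.Tendsto (fun s => ∫ x, heat (-1) A (t - s) x * α a (z + x))
      (nhdsWithin a (Ioi a)) (nhds (∫ x, heat (-1) A τ x * α a (z + x))) := by
    refine tendsto_integral_heat_mul (g := fun _ x => α a (z + x)) hσ A hτ0 hta hr (K := K)
      (Filter.Eventually.of_forall fun s => ?_)
      (Filter.Eventually.of_forall fun s x => hK _) fun x => tendsto_const_nhds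
    fun_prop
  refine le_of_forall_pos_le_add fun η hη => ?_
  refine ge_of_tendsto (hlim.add_const η) ?_
  filter_upwards [h.eventually_integral_abs_le hd ha0 hat ht hruc (η := η / (C + 1)) (by positivity),
    hr.eventually (eventually_heat_le (d := d) hσ A hτ0 hta), Ioo_mem_nhdsGT hat] with s h1 h2 h3
  have hsT : s ∈ Icc 0 T := ⟨ha0.trans h3.1.le, h3.2.le.trans ht⟩
  have hcs := (h.sα s hsT).continuous
  obtain ⟨K', hK0', hK'⟩ := (h.sα s hsT).exists_bound h.hl
  have h4 := h.heat_barrier (Or.inr rfl) hA hsT.1 h3.2 ht (by linarith [h3.1])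
    (fun r hr => hruc r ⟨h3.1.trans_le hr.1, hr.2⟩) z
  have hrs := heatRate_pos (σ := -1) hσ (sub_pos.2 h3.2) (by linarith [h3.1])
  have hD : ∀ x, |(|α s x - α a x|)| ≤ K' + K := fun x => by
    rw [abs_abs]; exact (abs_sub _ _).trans (add_le_add (hK' x) (hK x))
  have i1 : Integrable fun x => heat (-1) A (t - s) x * α a (z + x) :=
    integrable_gauss_mul_bdd hrs _ (by fun_prop) (K := K) fun x => hK _
  have i2 : Integrable fun x => heat (-1) A (t - s) x * α s (z + x) :=
    integrable_gauss_mul_bdd hrs _ (by fun_prop) (K := K') fun x => hK' _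
  have i3 : Integrable fun x => heat (-1) A (t - s) x * |α s (z + x) - α a (z + x)| :=
    integrable_gauss_mul_bdd hrs _ (by fun_prop) (K := K' + K) fun x => hD _
  have h5 : ∫ x, heat (-1) A (t - s) x * α s (z + x) ≤ (∫ x, heat (-1) A (t - s) x * α a (z + x)) +
      ∫ x, heat (-1) A (t - s) x * |α s (z + x) - α a (z + x)| := by
    rw [← integral_add i1 i3]
    refine integral_mono i2 (i1.add i3) fun x => ?_
    have e1 := heat_pos (-1) A (t - s) x
    have e2 := le_abs_self (α s (z + x) - α a (z + x))
    change _ ≤ heat (-1) A (t - s) x * α a (z + x) + heat (-1) A (t - s) x * |α s (z + x) - α a (z + x)|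
    nlinarith
  have h6 : ∫ x, heat (-1) A (t - s) x * |α s (z + x) - α a (z + x)| ≤
      C * ∫ x in box d l, |α s x - α a x| := by
    refine le_trans (integral_mono i3 (integrable_gauss_mul_bdd (half_pos hrate) _
      (by fun_prop) (K := K' + K) fun x => hD _) fun x => ?_)
      (hC (fun x => |α s x - α a x|) (by fun_prop) (fun x i => ?_) (fun x => abs_nonneg _) z)
    · exact mul_le_mul_of_nonneg_right (h2 x) (abs_nonneg _)
    · simp only [(h.sα s hsT).periodic x i, (h.sα a haT).periodic x i]
  have h7 : C * ∫ x in box d l, |α s x - α a x| ≤ η := by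
    calc C * ∫ x in box d l, |α s x - α a x| ≤ C * (η / (C + 1)) := mul_le_mul_of_nonneg_left h1 hC0
      _ ≤ η := by
        rw [mul_div_assoc', div_le_iff₀ (by positivity)]
        nlinarith
  linarith

/-- Right uniform continuity at `a` follows from right uniform continuity just after `a`. -/
lemma ruc_left_endpoint (h : FPData l T B V α) (hd : 0 < d) {a b : ℝ}
    (ha0 : 0 ≤ a) (hab : a < b) (hb : b ≤ T) (hruc : ∀ r ∈ Ioo a b, RUC T α r) : RUC T α a := by
  have haT : a ∈ Icc 0 T := ⟨ha0, hab.le.trans hb⟩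
  have hca := (h.sα a haT).continuous
  set A : ℝ := 4 * d + 9 / 8 * (d * B) ^ 2 with hA
  have hA0 : 0 ≤ A := by rw [hA]; positivity
  obtain ⟨K, hK0, hK⟩ := (h.sα a haT).exists_bound h.hl
  obtain ⟨L, hL0, hL⟩ := (h.sα a haT).exists_lip h.hl
  set D := L * (Real.exp A * 2 ^ (d / 2 : ℝ) * 3) with hD
  intro ε hε
  have hcont : ContinuousAt (fun τ : ℝ => (|Real.exp (-(1 * A * √τ)) - 1| +
      |Real.exp (-(-1 * A * √τ)) - 1|) * K + D * √τ) 0 := by fun_prop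
  have hev := hcont.tendsto.eventually_lt_const (u := ε) (by simpa using hε)
  obtain ⟨δ, hδ, hδ'⟩ := Metric.eventually_nhds_iff.1 hev
  refine ⟨min (δ / 2) (min (1 / 8) ((b - a) / 2)), by
    have := sub_pos.2 hab
    positivity, fun s hs hsT x => ?_⟩
  have q1 := min_le_left (δ / 2) (min (1 / 8) ((b - a) / 2))
  have q2 := (min_le_right (δ / 2) (min (1 / 8) ((b - a) / 2))).trans (min_le_left _ _)
  have q3 := (min_le_right (δ / 2) (min (1 / 8) ((b - a) / 2))).trans (min_le_right _ _)
  obtain ⟨hs1, hs2⟩ := hs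
  rcases hs1.eq_or_lt with rfl | has
  · simpa using hε.le
  have hq : s - a < 1 / 4 := by linarith
  have hru : ∀ r ∈ Ioo a s, RUC T α r := fun r hr => hruc r ⟨hr.1, hr.2.trans (by linarith)⟩
  have h1 := hδ' (y := s - a) (by
    rw [Real.dist_eq, sub_zero, abs_of_pos (by linarith)]; linarith)
  have lo := h.heat_lower hA ha0 has hsT hq hru x (S := ∅) MeasurableSet.empty (by simp)
    (m := 0) (c := 0) le_rfl (by simp) (by
      refine Filter.Eventually.frequently (Filter.Eventually.of_forall fun s => by simp))
  have up := h.heat_upper hd hA ha0 has hsT hq hru x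
  have hl1 := (abs_le.1 (abs_integral_heat_sub_le (σ := 1) (A := A) (τ := s - a) (K := L) (by simp)
    (by linarith) (by linarith) hA0 hL0 hca x (fun y => by simpa using hL x (x + y)))).1
  have hu1 := (abs_le.1 (abs_integral_heat_sub_le (σ := -1) (A := A) (τ := s - a) (K := L) (by simp)
    (by linarith) (by linarith) hA0 hL0 hca x (fun y => by simpa using hL x (x + y)))).2
  have e1 : L * (Real.exp A * 2 ^ (d / 2 : ℝ) * (3 * √(s - a))) = D * √(s - a) := by rw [hD]; ring
  rw [e1] at hl1 hu1
  have hp := h.pos a haT x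
  have hpK := (le_abs_self _).trans (hK x)
  have m1 : ∀ u : ℝ, |u - 1| * α a x ≤ |u - 1| * K := fun u =>
    mul_le_mul_of_nonneg_left hpK (abs_nonneg _)
  have m2 := m1 (Real.exp (-(1 * A * √(s - a))))
  have m3 := m1 (Real.exp (-(-1 * A * √(s - a))))
  have m4 : -|Real.exp (-(1 * A * √(s - a))) - 1| * α a x ≤
      (Real.exp (-(1 * A * √(s - a))) - 1) * α a x :=
    mul_le_mul_of_nonneg_right (neg_abs_le _) hp.le
  have m5 : (Real.exp (-(-1 * A * √(s - a))) - 1) * α a x ≤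
      |Real.exp (-(-1 * A * √(s - a))) - 1| * α a x :=
    mul_le_mul_of_nonneg_right (le_abs_self _) hp.le
  have m6 : 0 ≤ |Real.exp (-(1 * A * √(s - a))) - 1| * K := by positivity
  have m7 : 0 ≤ |Real.exp (-(-1 * A * √(s - a))) - 1| * K := by positivity
  rw [abs_le]
  constructor <;> nlinarith

end FPData
end

/-- Baire category: a closed set covered by countably many closed sets has a portion in one of them. -/
lemma exists_portion {F : Set ℝ} (hF : IsClosed F) (hne : F.Nonempty) {K : ℕ → Set ℝ}
    (hK : ∀ n, IsClosed (K n)) (hcov : F ⊆ ⋃ n, K n) :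
    ∃ n, ∃ t ∈ F, ∃ δ > 0, ∀ s ∈ F, |s - t| < δ → s ∈ K n := by
  have : CompleteSpace F := hF.completeSpace_coe
  have : Nonempty F := hne.to_subtype
  obtain ⟨n, ⟨t, htF⟩, ht⟩ := nonempty_interior_of_iUnion_of_closed
    (f := fun n => ((↑) : F → ℝ) ⁻¹' K n) (fun n => (hK n).preimage continuous_subtype_val)
    (by rw [← preimage_iUnion]; exact eq_univ_of_forall fun x => hcov x.2)
  rw [mem_interior_iff_mem_nhds, Metric.mem_nhds_iff] at ht
  obtain ⟨δ, hδ, h⟩ := ht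
  exact ⟨n, t, htF, δ, hδ, fun s hs hst => @h ⟨s, hs⟩ (by
    rw [Metric.mem_ball]; exact hst)⟩

/-- Uniform `C²`-type bounds formulated in terms of values only. -/
structure TBd {d : ℕ} (N : ℝ) (g : E d → ℝ) : Prop where
  bd : ∀ x, |g x| ≤ N
  lip : ∀ x y, |g (x + y) - g x| ≤ N * ‖y‖
  tay : ∀ x y, ∀ s ∈ Icc (0 : ℝ) 1, |g (x + s • y) - g x - s * (g (x + y) - g x)| ≤ N * s * ‖y‖ ^ 2

section
variable {d : ℕ} {l T B N : ℝ} {V α : ℝ → E d → ℝ} {g : E d → ℝ}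

lemma TBd.of_tendsto {ι : Type*} {Fl : Filter ι} {G : ι → E d → ℝ} (hG : ∃ᶠ i in Fl, TBd N (G i))
    (hlim : ∀ x, Filter.Tendsto (fun i => G i x) Fl (nhds (g x))) : TBd N g where
  bd x := le_of_tendsto_of_frequently (hlim x).abs (hG.mono fun _ hi => hi.bd x)
  lip x y := le_of_tendsto_of_frequently ((hlim (x + y)).sub (hlim x)).abs
    (hG.mono fun _ hi => hi.lip x y)
  tay x y s hs := le_of_tendsto_of_frequently (((hlim (x + s • y)).sub (hlim x)).sub
    (((hlim (x + y)).sub (hlim x)).const_mul s)).abs (hG.mono fun _ hi => hi.tay x y s hs)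

/-- Second-order Taylor estimate for a function with Lipschitz derivative. -/
lemma abs_taylor_le {M : ℝ} (hg : Differentiable ℝ g)
    (hM : ∀ x y, ‖fderiv ℝ g y - fderiv ℝ g x‖ ≤ M * ‖y - x‖) (x y : E d) :
    |g (x + y) - g x - fderiv ℝ g x y| ≤ M * ‖y‖ ^ 2 := by
  have h := (convex_closedBall x ‖y‖).norm_image_sub_le_of_norm_hasFDerivWithin_le
    (f := fun z => g z - fderiv ℝ g x (z - x)) (C := M * ‖y‖)
    (f' := fun z => fderiv ℝ g z - fderiv ℝ g x) (x := x) (y := x + y)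
    (fun z _ => by
      have h1 := ((fderiv ℝ g x).hasFDerivAt (x := z - x)).comp z ((hasFDerivAt_id z).sub_const x)
      exact ((hg z).hasFDerivAt.sub h1).hasFDerivWithinAt)
    (fun z hz => ?_) (Metric.mem_closedBall_self (norm_nonneg _)) (by simp)
  · simp only [add_sub_cancel_left, sub_self, map_zero, sub_zero] at h
    rw [Real.norm_eq_abs] at h
    calc _ = |g (x + y) - fderiv ℝ g x y - g x| := by congr 1; ring
      _ ≤ _ := h
      _ = _ := by ring
  · rw [Metric.mem_closedBall, dist_eq_norm] at hz
    have hM0 : 0 ≤ M * ‖y‖ ∨ y = 0 := by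
      rcases eq_or_ne y 0 with h | h
      · exact Or.inr h
      · left
        exact (norm_nonneg _).trans ((hM 0 y).trans (by simp))
    rcases hM0 with h0 | rfl
    · refine (hM x z).trans ?_
      rcases le_or_gt 0 M with hM1 | hM1
      · gcongr
      · have : ‖y‖ = 0 := by nlinarith [norm_nonneg y]
        have hz' : ‖z - x‖ = 0 := le_antisymm (hz.trans this.le) (norm_nonneg _)
        rw [hz', this]
    · simp only [norm_zero, norm_le_zero_iff, sub_eq_zero] at hz
      simp [hz]

lemma SP.exists_fderiv_lip (hl : 0 < l) (hg : SP l g) :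
    ∃ M, 0 ≤ M ∧ ∀ x y, ‖fderiv ℝ g y - fderiv ℝ g x‖ ≤ M * ‖y - x‖ := by
  have hc : ContDiff ℝ (⊤ : ℕ∞) (fderiv ℝ g) := hg.smooth.fderiv_right (by simp)
  obtain ⟨K, hK, h⟩ := IsPeriodic.exists_bound hl (g := fun x => fderiv ℝ (fderiv ℝ g) x)
    hg.periodic.fderiv.fderiv (hc.continuous_fderiv (by simp))
  exact ⟨K, hK, fun x y => convex_univ.norm_image_sub_le_of_norm_fderiv_le
    (fun z _ => hc.differentiable (by simp) z) (fun z _ => h z) (mem_univ x) (mem_univ y)⟩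

lemma SP.exists_TBd (hl : 0 < l) (hg : SP l g) : ∃ N : ℕ, TBd N g := by
  obtain ⟨C, hC0, hC⟩ := hg.exists_bound hl
  obtain ⟨K, hK0, hK⟩ := hg.exists_lip hl
  obtain ⟨M, hM0, hM⟩ := hg.exists_fderiv_lip hl
  obtain ⟨n, hn⟩ := exists_nat_ge (C + K + 2 * M)
  refine ⟨n, fun x => (hC x).trans (by linarith), fun x y => ?_, fun x y s hs => ?_⟩
  · refine (hK x (x + y)).trans ?_
    rw [add_sub_cancel_left]
    gcongr; linarith
  · have h1 := abs_taylor_le hg.differentiable hM x (s • y)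
    have h2 := abs_taylor_le hg.differentiable hM x y
    rw [map_smul, smul_eq_mul, norm_smul, Real.norm_of_nonneg hs.1] at h1
    have h3 : M * (s * ‖y‖) ^ 2 ≤ M * s * ‖y‖ ^ 2 := by
      have := hs.1; have := hs.2
      have : s ^ 2 ≤ s := by nlinarith
      calc M * (s * ‖y‖) ^ 2 = M * ‖y‖ ^ 2 * s ^ 2 := by ring
        _ ≤ M * ‖y‖ ^ 2 * s := by gcongr
        _ = _ := by ring
    have e : g (x + s • y) - g x - s * (g (x + y) - g x) =
        (g (x + s • y) - g x - s * fderiv ℝ g x y) - s * (g (x + y) - g x - fderiv ℝ g x y) := by ring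
    rw [e]
    refine (abs_sub _ _).trans ?_
    rw [abs_mul, abs_of_nonneg hs.1]
    have h4 := mul_le_mul_of_nonneg_left h2 hs.1
    have h5 : (2 * M) * s * ‖y‖ ^ 2 ≤ n * s * ‖y‖ ^ 2 := by
      have := hs.1
      gcongr; linarith
    nlinarith

lemma TBd.taylor (h : TBd N g) (hg : Differentiable ℝ g) (x y : E d) :
    |g (x + y) - g x - fderiv ℝ g x y| ≤ N * ‖y‖ ^ 2 := by
  have h1 : HasDerivAt (fun s : ℝ => g (x + s • y) - g x - s * (g (x + y) - g x))
      (fderiv ℝ g x y - 1 * (g (x + y) - g x)) 0 := by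
    have h2 : HasDerivAt (fun s : ℝ => x + s • y) ((1 : ℝ) • y) 0 :=
      ((hasDerivAt_id (0 : ℝ)).smul_const y).const_add x
    have h3 : HasFDerivAt g (fderiv ℝ g x) (x + (0 : ℝ) • y) := by
      simpa using (hg x).hasFDerivAt
    have := h3.comp_hasDerivAt (0 : ℝ) h2
    rw [one_smul] at this
    exact (this.sub_const (g x)).sub ((hasDerivAt_id (0 : ℝ)).mul_const _)
  have hN : 0 ≤ N := (abs_nonneg _).trans (h.bd x)
  have h4 := h1.hasDerivWithinAt (s := Ici 0)
  have h5 : Filter.Tendsto (slope (fun s : ℝ => g (x + s • y) - g x - s * (g (x + y) - g x)) 0)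
      (nhdsWithin 0 (Ioi 0)) (nhds (fderiv ℝ g x y - 1 * (g (x + y) - g x))) :=
    (hasDerivWithinAt_iff_tendsto_slope' self_notMem_Ioi).1 h4.Ioi_of_Ici
  rw [abs_sub_comm, ← one_mul (g (x + y) - g x)]
  refine le_of_tendsto h5.abs ?_
  filter_upwards [Ioo_mem_nhdsGT (show (0 : ℝ) < 1 by norm_num)] with s hs
  have h6 := h.tay x y s ⟨hs.1.le, hs.2.le⟩
  simp only [slope_def_field, zero_smul, add_zero, sub_self, zero_mul, sub_zero]
  rw [abs_div, abs_of_pos hs.1, div_le_iff₀ hs.1]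
  linarith

lemma TBd.norm_fderiv_le (h : TBd N g) (x : E d) : ‖fderiv ℝ g x‖ ≤ N := by
  have hN : 0 ≤ N := (abs_nonneg _).trans (h.bd x)
  refine norm_fderiv_le_of_lip' ℝ hN (Filter.Eventually.of_forall fun y => ?_)
  simpa using h.lip x (y - x)

lemma TBd.abs_fderiv_sub_le (h : TBd N g) (hg : Differentiable ℝ g) (x y : E d) :
    |fderiv ℝ g (x + y) y - fderiv ℝ g x y| ≤ 2 * N * ‖y‖ ^ 2 := by
  have h1 := abs_le.1 (h.taylor hg x y)
  have h2 := abs_le.1 (h.taylor hg (x + y) (-y))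
  rw [add_neg_cancel_right, map_neg, norm_neg] at h2
  rw [abs_le]
  constructor <;> linarith [h1.1, h1.2, h2.1, h2.2]

lemma TBd.abs_pd_pd_le (h : TBd N g) (hg : ContDiff ℝ (⊤ : ℕ∞) g) (x : E d) (i : Fin d) :
    |pd i (pd i g) x| ≤ 2 * N := by
  have hN : 0 ≤ N := (abs_nonneg _).trans (h.bd x)
  have hd := hasDerivAt_line ((contDiff_pd hg i).differentiable (by simp)) x i 0
  have h1 := hd.le_of_lip' (C := 2 * N) (by positivity) (Filter.Eventually.of_forall fun s => ?_)
  · simpa using h1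
  have h2 := h.abs_fderiv_sub_le (hg.differentiable (by simp)) x (s • uvec d i)
  have hu : ‖uvec d i‖ = 1 := by simp [uvec]
  rw [norm_smul, hu, mul_one, map_smul, map_smul, smul_eq_mul, smul_eq_mul, ← mul_sub, abs_mul] at h2
  simp only [Real.norm_eq_abs, zero_smul, add_zero, sub_zero] at h2 ⊢
  rcases eq_or_ne s 0 with rfl | hs
  · simp
  have hs' : 0 < |s| := abs_pos.2 hs
  refine le_of_mul_le_mul_left ?_ hs'
  refine h2.trans (le_of_eq (by ring))

lemma TBd.abs_fpOp_le (h : TBd N g) (hg : ContDiff ℝ (⊤ : ℕ∞) g) {W : E d → ℝ} (hB : 0 ≤ B)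
    (hW : ∀ x i, |pd i W x| ≤ B) (hW2 : ∀ x, |∑ i, pd i (pd i W) x| ≤ B) (x : E d) :
    |fpOp W g x| ≤ d * (2 * N) + d * (B * N) + B * N := by
  have hN : 0 ≤ N := (abs_nonneg _).trans (h.bd x)
  have hu : ∀ i, ‖uvec d i‖ = 1 := by simp [uvec]
  have h1 : |∑ i, pd i (pd i g) x| ≤ d * (2 * N) := by
    refine (Finset.abs_sum_le_sum_abs _ _).trans
      ((Finset.sum_le_sum fun i _ => h.abs_pd_pd_le hg x i).trans (by simp))
  have h2 : |∑ i, pd i W x * pd i g x| ≤ d * (B * N) := by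
    refine (Finset.abs_sum_le_sum_abs _ _).trans
      ((Finset.sum_le_sum (g := fun _ => B * N) fun i _ => ?_).trans (by simp))
    rw [abs_mul]
    refine mul_le_mul (hW x i) ?_ (abs_nonneg _) hB
    have := (fderiv ℝ g x).le_opNorm (uvec d i)
    rw [hu, mul_one] at this
    exact this.trans (h.norm_fderiv_le x)
  have h3 : |(∑ i, pd i (pd i W) x) * g x| ≤ B * N := by
    rw [abs_mul]
    exact mul_le_mul (hW2 x) (h.bd x) (abs_nonneg _) hB
  exact (abs_add_three _ _ _).trans (by linarith)

/-- Equi-Lipschitz periodic functions converging pointwise converge uniformly. -/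
lemma eventually_abs_sub_le_of_lip (hl : 0 < l) {ι : Type*} {Fl : Filter ι} {G : ι → E d → ℝ}
    (hN : 0 ≤ N) (hper : ∀ᶠ i in Fl, IsPeriodic l (G i)) (hper₀ : IsPeriodic l g)
    (hlip : ∀ᶠ i in Fl, ∀ x y, |G i (x + y) - G i x| ≤ N * ‖y‖)
    (hlip₀ : ∀ x y, |g (x + y) - g x| ≤ N * ‖y‖)
    (hlim : ∀ x, Filter.Tendsto (fun i => G i x) Fl (nhds (g x))) {ε : ℝ} (hε : 0 < ε) :
    ∀ᶠ i in Fl, ∀ x, |G i x - g x| ≤ ε := by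
  set r := ε / (4 * (N + 1)) with hr
  have hr0 : 0 < r := by positivity
  have hNr : N * r ≤ ε / 4 := by
    rw [hr, mul_div_assoc', div_le_div_iff₀ (by positivity) (by positivity)]
    nlinarith
  obtain ⟨S, -, hSf, hS⟩ := (isCompact_box d l).finite_cover_balls hr0
  have hev : ∀ᶠ i in Fl, ∀ z ∈ S, |G i z - g z| < ε / 4 := by
    rw [Filter.eventually_all_finite hSf]
    intro z _
    have := ((hlim z).sub_const (g z)).abs
    rw [sub_self, abs_zero] at this
    exact this.eventually_lt_const (by positivity)
  filter_upwards [hper, hlip, hev] with i h1 h2 h3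
  have hp : IsPeriodic l fun x => (G i x - g x) := h1.comp₂ hper₀ (· - ·)
  refine hp.forall_of_box hl (p := fun y => |y| ≤ ε) fun x hx => ?_
  obtain ⟨z, hz, hxz⟩ := mem_iUnion₂.1 (hS hx)
  rw [Metric.mem_ball, dist_eq_norm] at hxz
  have h4 := h2 z (x - z)
  have h5 := hlip₀ z (x - z)
  rw [add_sub_cancel] at h4 h5
  have h6 : N * ‖x - z‖ ≤ ε / 4 := (mul_le_mul_of_nonneg_left hxz.le hN).trans hNr
  have h7 := h3 z hz
  rw [abs_le] at *
  rw [abs_lt] at h7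
  constructor <;> linarith [h4.1, h4.2, h5.1, h5.2, h7.1, h7.2]

end

section
variable {d : ℕ} {l T B N : ℝ} {V α : ℝ → E d → ℝ} {g : E d → ℝ}

/-- The times at which a trajectory satisfies a uniform `C²`-type bound form a closed set. -/
lemma isClosed_setOf_TBd {u : ℝ → E d → ℝ} {N : ℝ}
    (hu : ∀ t ∈ Icc 0 T, ∀ x, ContinuousAt (fun τ => u τ x) t) :
    IsClosed {t | t ∈ Icc 0 T ∧ TBd N (u t)} := by
  refine isClosed_of_closure_subset fun t ht => ?_
  have htI : t ∈ Icc 0 T := closure_minimal (fun s hs => hs.1) isClosed_Icc ht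
  rw [mem_closure_iff_frequently] at ht
  exact ⟨htI, TBd.of_tendsto (ht.mono fun s hs => hs.2) fun x => hu t htI x⟩

lemma exists_last_mem {F : Set ℝ} (hF : IsClosed F) {t s : ℝ} (ht : t ∈ F) (hts : t ≤ s) :
    ∃ a ∈ F, t ≤ a ∧ a ≤ s ∧ ∀ r ∈ Ioc a s, r ∉ F := by
  have hc : IsCompact (F ∩ Icc t s) := isCompact_Icc.inter_left hF
  obtain ⟨a, ha, hmax⟩ := hc.exists_isMaxOn ⟨t, ht, le_rfl, hts⟩ continuous_id.continuousOn
  refine ⟨a, ha.1, ha.2.1, ha.2.2, fun r hr hrF => ?_⟩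
  exact absurd (hmax ⟨hrF, ha.2.1.trans hr.1.le, hr.2⟩) (not_le.2 hr.1)

lemma exists_first_mem {F : Set ℝ} (hF : IsClosed F) {t s : ℝ} (ht : t ∈ F) (hts : s ≤ t) :
    ∃ a ∈ F, s ≤ a ∧ a ≤ t ∧ ∀ r ∈ Ico s a, r ∉ F := by
  have hc : IsCompact (F ∩ Icc s t) := isCompact_Icc.inter_left hF
  obtain ⟨a, ha, hmin⟩ := hc.exists_isMinOn ⟨t, ht, hts, le_rfl⟩ continuous_id.continuousOn
  refine ⟨a, ha.1, ha.2.1, ha.2.2, fun r hr hrF => ?_⟩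
  exact absurd (hmin ⟨hrF, hr.1, hr.2.le.trans ha.2.2⟩) (not_le.2 hr.2)

/-- Right uniform continuity at a point of a closed exceptional set with uniform bounds. -/
lemma FPData.ruc_of_portion (h : FPData l T B V α) (hd : 0 < d) {F : Set ℝ} (hF : IsClosed F)
    {t δ : ℝ} (ht : t ∈ F) (ht0 : t ∈ Ico 0 T) (hδ : 0 < δ)
    (hFN : ∀ s ∈ F, t ≤ s → s < t + δ → s ≤ T → TBd N (α s))
    (hgood : ∀ s ∈ Ico t T, s < t + δ → s ∉ F → RUC T α s) : RUC T α t := by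
  have hN : 0 ≤ N := (abs_nonneg _).trans ((hFN t ht le_rfl (by linarith) ht0.2.le).bd 0)
  have hB := h.hB
  have htI : t ∈ Icc 0 T := ⟨ht0.1, ht0.2.le⟩
  set C : ℝ := d * (2 * N) + d * (B * N) + B * N with hC
  have hC0 : 0 ≤ C := by positivity
  have hev : ∀ ε > 0, ∀ᶠ a in nhdsWithin t (F ∩ Icc t T), ∀ x, |α a x - α t x| ≤ ε := by
    intro ε hε
    have hm : ∀ᶠ a in nhdsWithin t (F ∩ Icc t T), a ∈ F ∩ Icc t T ∧ a < t + δ :=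
      (eventually_mem_nhdsWithin).and
        (Filter.Eventually.filter_mono nhdsWithin_le_nhds (gt_mem_nhds (by linarith)))
    refine eventually_abs_sub_le_of_lip h.hl hN ?_ (h.sα t htI).periodic ?_
      (hFN t ht le_rfl (by linarith) ht0.2.le).lip
      (fun x => (h.der t htI x).continuousAt.tendsto.mono_left nhdsWithin_le_nhds) hε
    · filter_upwards [hm] with a ha
      exact (h.sα a ⟨ht0.1.trans ha.1.2.1, ha.1.2.2⟩).periodic
    · filter_upwards [hm] with a ha
      exact (hFN a ha.1.1 ha.1.2.1 ha.2 ha.1.2.2).lip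
  intro ε hε
  have h1 := hev (ε / 2) (by positivity)
  rw [eventually_nhdsWithin_iff, Metric.eventually_nhds_iff] at h1
  obtain ⟨δ₁, hδ₁, h1⟩ := h1
  have hcont : ContinuousAt (fun τ : ℝ => C * τ * Real.exp (B * τ)) 0 := by fun_prop
  obtain ⟨δ₂, hδ₂, h2⟩ := Metric.eventually_nhds_iff.1
    (hcont.tendsto.eventually_lt_const (u := ε / 2) (by simpa using hε))
  refine ⟨min (δ / 2) (min (δ₁ / 2) (δ₂ / 2)), by positivity, fun s hs hsT x => ?_⟩
  have q1 := min_le_left (δ / 2) (min (δ₁ / 2) (δ₂ / 2))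
  have q2 := (min_le_right (δ / 2) (min (δ₁ / 2) (δ₂ / 2))).trans (min_le_left _ _)
  have q3 := (min_le_right (δ / 2) (min (δ₁ / 2) (δ₂ / 2))).trans (min_le_right _ _)
  obtain ⟨hs1, hs2⟩ := hs
  obtain ⟨a, haF, hta, has, ha⟩ := exists_last_mem hF ht hs1
  have h3 := h1 (y := a) (by rw [Real.dist_eq, abs_of_nonneg (by linarith)]; linarith)
    ⟨haF, hta, has.trans hsT⟩ x
  have haB := hFN a haF hta (by linarith) (has.trans hsT)
  have haI : a ∈ Icc 0 T := ⟨ht0.1.trans hta, has.trans hsT⟩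
  have h4 : |α s x - α a x| ≤ ε / 2 := by
    rcases has.eq_or_lt with rfl | has'
    · simpa using (half_pos hε).le
    have hr : ∀ r ∈ Ioo a s, RUC T α r := fun r hr =>
      hgood r ⟨hta.trans hr.1.le, hr.2.trans_le hsT⟩ (by linarith [hr.2]) (ha r ⟨hr.1, hr.2.le⟩)
    have hra := h.ruc_left_endpoint hd haI.1 has' hsT hr
    have h5 := h.abs_sub_le haI.1 hsT hC0 (fun r hr' => by
      rcases hr'.1.eq_or_lt with rfl | h
      · exact hra
      · exact hr r ⟨h, hr'.2⟩) (fun r hr' y =>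
      haB.abs_fpOp_le (h.sα a haI).smooth hB (h.bV r ⟨haI.1.trans hr'.1, hr'.2.trans hsT⟩)
        (h.bV2 r ⟨haI.1.trans hr'.1, hr'.2.trans hsT⟩) y) s ⟨has, le_rfl⟩ x
    refine h5.trans (h2 (y := s - a) ?_).le
    rw [Real.dist_eq, sub_zero, abs_of_nonneg (by linarith)]; linarith
  have := _root_.abs_sub_le (α s x) (α a x) (α t x)
  linarith

/-- Solutions are right uniformly continuous in time. -/
lemma FPData.ruc (h : FPData l T B V α) (hd : 0 < d) {t : ℝ} (ht : t ∈ Ico 0 T) : RUC T α t := by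
  set G : Set ℝ := {t | ∃ δ > 0, ∀ s ∈ Ico 0 T, |s - t| < δ → RUC T α s} with hG
  have hGo : IsOpen G := by
    rw [Metric.isOpen_iff]
    rintro t ⟨δ, hδ, h⟩
    refine ⟨δ / 2, by positivity, fun t' ht' => ⟨δ / 2, by positivity, fun s hs hst => h s hs ?_⟩⟩
    rw [Metric.mem_ball, Real.dist_eq] at ht'
    have := _root_.abs_sub_le s t' t
    linarith
  have hGr : ∀ s ∈ Ico 0 T, s ∈ G → RUC T α s := by
    rintro s hs ⟨δ, hδ, h⟩
    exact h s hs (by simpa using hδ)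
  set F := Icc 0 T \ G with hFdef
  have hF : IsClosed F := isClosed_Icc.sdiff hGo
  have hcov : F ⊆ ⋃ n : ℕ, {t | t ∈ Icc 0 T ∧ TBd (n : ℝ) (α t)} := by
    intro t ht
    obtain ⟨n, hn⟩ := (h.sα t ht.1).exists_TBd h.hl
    exact mem_iUnion.2 ⟨n, ht.1, hn⟩
  rcases F.eq_empty_or_nonempty with hE | hne
  · refine hGr t ht (by_contra fun hc => ?_)
    have : t ∈ F := ⟨⟨ht.1, ht.2.le⟩, hc⟩
    rw [hE] at this
    exact this
  obtain ⟨n, t₀, ht₀, δ, hδ, hn⟩ := exists_portion hF hne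
    (fun n => isClosed_setOf_TBd fun t ht x => (h.der t ht x).continuousAt) hcov
  refine absurd ⟨δ / 2, by positivity, fun s hs hst => ?_⟩ ht₀.2
  by_cases hsF : s ∈ F
  · refine h.ruc_of_portion hd hF hsF hs (half_pos hδ) (N := n) (fun r hr hr1 hr2 hr3 => (hn r hr ?_).2)
      (fun r hr hr1 hr2 => hGr r ⟨hs.1.trans hr.1, hr.2⟩ ?_)
    · rw [abs_lt] at *
      constructor <;> linarith
    · by_contra hc
      exact hr2 ⟨⟨hs.1.trans hr.1, hr.2.le⟩, hc⟩
  · refine hGr s hs (by_contra fun hc => hsF ⟨⟨hs.1, hs.2.le⟩, hc⟩)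

end

/-- A two-sided Grönwall bound on a compact interval. -/
lemma norm_le_mul_exp_of_norm_deriv_le {F : Type*} [NormedAddCommGroup F] [NormedSpace ℝ F]
    {T K ε t : ℝ} {z z' : ℝ → F} (hK : 0 ≤ K) (hε : 0 ≤ ε) (ht : t ∈ Icc 0 T)
    (hz : ∀ s ∈ Icc 0 T, HasDerivAt z (z' s) s) (hb : ∀ s ∈ Icc 0 T, ‖z' s‖ ≤ K * ‖z s‖ + ε) :
    ∀ s ∈ Icc 0 T, ‖z s‖ ≤ (‖z t‖ + ε * T) * Real.exp (K * T) := by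
  have hT : 0 ≤ T := ht.1.trans ht.2
  have aux : ∀ r ∈ Icc 0 T, gronwallBound ‖z t‖ K ε r ≤ (‖z t‖ + ε * T) * Real.exp (K * T) := by
    intro r hr
    have h0 : ∀ x ∈ Icc 0 r, ‖(‖z t‖ + ε * x) * Real.exp (K * x)‖ =
        (‖z t‖ + ε * x) * Real.exp (K * x) := fun x hx => by
      have := hx.1
      rw [Real.norm_of_nonneg]; positivity
    have h1 : gronwallBound ‖z t‖ K ε r ≤ (‖z t‖ + ε * r) * Real.exp (K * r) := by
      rcases hK.eq_or_lt with rfl | hK'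
      · simp [gronwallBound_K0]
      · rw [gronwallBound_of_K_ne_0 hK'.ne']
        have h2 : Real.exp (K * r) - 1 ≤ K * r * Real.exp (K * r) := by
          have h3 := Real.add_one_le_exp (-(K * r))
          have h4 : Real.exp (-(K * r)) * Real.exp (K * r) = 1 := by
            rw [← Real.exp_add]; simp
          nlinarith [Real.exp_pos (K * r)]
        have h5 : ε / K * (Real.exp (K * r) - 1) ≤ ε / K * (K * r * Real.exp (K * r)) := by
          gcongr
        have h6 : ε / K * (K * r * Real.exp (K * r)) = ε * r * Real.exp (K * r) := by
          field_simp
        linarith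
    refine h1.trans ?_
    have := hr.1
    have := hr.2
    gcongr
  intro s hs
  rcases le_total t s with hts | hst
  · refine (norm_le_gronwallBound_of_norm_deriv_right_le (f := z) (f' := z') (a := t) (b := T)
      (fun r hr => (hz r ⟨ht.1.trans hr.1, hr.2⟩).continuousAt.continuousWithinAt)
      (fun r hr => (hz r ⟨ht.1.trans hr.1, hr.2.le⟩).hasDerivWithinAt) le_rfl
      (fun r hr => hb r ⟨ht.1.trans hr.1, hr.2.le⟩) s ⟨hts, hs.2⟩).trans (aux _ ?_)
    exact ⟨by linarith, by linarith [ht.1, hs.2]⟩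
  · have hd : ∀ r ∈ Icc (-t) 0, HasDerivAt (fun r => z (-r)) (-(z' (-r))) r := fun r hr => by
      have := (hz (-r) ⟨by linarith [hr.2], by linarith [hr.1, ht.2]⟩).scomp r (hasDerivAt_neg r)
      simpa [Function.comp_def] using this
    have := (norm_le_gronwallBound_of_norm_deriv_right_le (f := fun r => z (-r))
      (f' := fun r => -(z' (-r))) (a := -t) (b := 0) (δ := ‖z t‖) (K := K) (ε := ε)
      (fun r hr => (hd r hr).continuousAt.continuousWithinAt)
      (fun r hr => (hd r ⟨hr.1, hr.2.le⟩).hasDerivWithinAt) (by simp)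
      (fun r hr => by
        rw [norm_neg]
        exact hb (-r) ⟨by linarith [hr.2], by linarith [hr.1, ht.2]⟩) (-s)
      ⟨by linarith, by linarith [hs.1]⟩).trans (aux _ ?_)
    · simpa using this
    · exact ⟨by linarith, by linarith [ht.2, hs.1]⟩

/-- A smooth periodic trajectory `u` satisfying `∂ₜu + v·∇u + q = 0` on `[0,T]`. -/
structure TransData {d : ℕ} (l T K : ℝ) (v : ℝ → E d → E d) (q u : ℝ → E d → ℝ) : Prop where
  hl : 0 < l
  hT : 0 < T
  hK : 0 ≤ K
  cv : Continuous (Function.uncurry v)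
  bv : ∀ t x, ‖v t x‖ ≤ K
  lv : ∀ t x y, ‖v t x - v t y‖ ≤ K * ‖x - y‖
  cq : Continuous (Function.uncurry q)
  lq : ∀ t x y, |q t x - q t y| ≤ K * ‖x - y‖
  su : ∀ t ∈ Icc 0 T, SP l (u t)
  der : ∀ t ∈ Icc 0 T, ∀ x, HasDerivAt (fun τ => u τ x) (-(fderiv ℝ (u t) x (v t x)) - q t x) t

/-- Characteristics of a velocity field on `[0,T]`. -/
structure IsChar {d : ℕ} (T : ℝ) (v : ℝ → E d → E d) (x : ℝ → E d) : Prop where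
  cont : Continuous x
  der : ∀ t ∈ Icc 0 T, HasDerivAt x (v t (x t)) t

section
variable {d : ℕ} {l T K N : ℝ} {v : ℝ → E d → E d} {q u : ℝ → E d → ℝ}

lemma exists_isChar (hK : 0 ≤ K) (hT : 0 < T) (cv : Continuous (Function.uncurry v))
    (bv : ∀ t x, ‖v t x‖ ≤ K) (lv : ∀ t x y, ‖v t x - v t y‖ ≤ K * ‖x - y‖) {t : ℝ}
    (ht : t ∈ Icc 0 T) (y : E d) : ∃ x, IsChar T v x ∧ x t = y := by
  set k : NNReal := ⟨K, hK⟩ with hk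
  have hkK : (k : ℝ) = K := rfl
  have hab : (-1 : ℝ) ≤ T + 1 := by linarith
  have ht' : t ∈ Icc (-1) (T + 1) := ⟨by linarith [ht.1], by linarith [ht.2]⟩
  have hpl : IsPicardLindelof v (⟨t, ht'⟩ : Icc (-1) (T + 1)) y
      (k * Real.toNNReal (T + 2)) 0 k k :=
  { lipschitzOnWith := fun s _ => (LipschitzWith.of_dist_le_mul (K := k) fun x y => by
      rw [dist_eq_norm, dist_eq_norm, hkK]; exact lv s x y).lipschitzOnWith
    continuousOn := fun x _ => (cv.comp (by fun_prop : Continuous fun s : ℝ => (s, x))).continuousOn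
    norm_le := fun s _ x _ => bv s x
    mul_max_le := by
      have : ((T + 2).toNNReal : ℝ) = T + 2 := Real.coe_toNNReal _ (by linarith)
      rw [NNReal.coe_mul, this, NNReal.coe_zero, sub_zero]
      gcongr
      exact max_le (by linarith [ht.1]) (by linarith [ht.2]) }
  obtain ⟨x, hx0, hx⟩ := hpl.exists_eq_forall_mem_Icc_hasDerivWithinAt₀
  have hxc : ContinuousOn x (Icc (-1) (T + 1)) := fun s hs => (hx s hs).continuousWithinAt
  refine ⟨IccExtend hab ((Icc (-1) (T + 1)).domRestrict x), ⟨?_, fun s hs => ?_⟩, ?_⟩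
  · exact (continuousOn_iff_continuous_domRestrict.1 hxc).Icc_extend'
  · have hs' : s ∈ Icc (-1) (T + 1) := ⟨by linarith [hs.1], by linarith [hs.2]⟩
    have hn : Icc (-1) (T + 1) ∈ nhds s := Icc_mem_nhds (by linarith [hs.1]) (by linarith [hs.2])
    rw [IccExtend_of_mem _ _ hs']
    refine ((hx s hs').hasDerivAt hn).congr_of_eventuallyEq ?_
    filter_upwards [hn] with r hr
    rw [IccExtend_of_mem _ _ hr, domRestrict_apply]
  · rw [IccExtend_of_mem _ _ ht', domRestrict_apply]
    exact hx0

lemma IsChar.norm_sub_le (hK : 0 ≤ K) (lv : ∀ t x y, ‖v t x - v t y‖ ≤ K * ‖x - y‖)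
    {x y : ℝ → E d} (hx : IsChar T v x) (hy : IsChar T v y) {s t : ℝ} (hs : s ∈ Icc 0 T)
    (ht : t ∈ Icc 0 T) : ‖x s - y s‖ ≤ Real.exp (K * T) * ‖x t - y t‖ := by
  have := norm_le_mul_exp_of_norm_deriv_le (z := fun s => x s - y s) (ε := 0) hK le_rfl ht
    (fun s hs => (hx.der s hs).sub (hy.der s hs)) (fun s _ => by simpa using lv s (x s) (y s)) s hs
  simpa [mul_comm] using this

/-- The quantity which is conserved along characteristics. -/
def charQ (q u : ℝ → E d → ℝ) (x : ℝ → E d) (t : ℝ) : ℝ :=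
  u t (x t) + ∫ s in (0 : ℝ)..t, q s (x s)

/-- Conservation along all characteristics on a set of times. -/
def CharConst (T : ℝ) (v : ℝ → E d → E d) (q u : ℝ → E d → ℝ) (I : Set ℝ) : Prop :=
  ∀ x, IsChar T v x → ∀ s ∈ I, ∀ t ∈ I, charQ q u x s = charQ q u x t

lemma TransData.continuous_q (h : TransData l T K v q u) {x : ℝ → E d} (hx : Continuous x) :
    Continuous fun s => q s (x s) := h.cq.comp (continuous_id.prodMk hx)

lemma TransData.exists_lip_of_const (h : TransData l T K v q u) {I : Set ℝ} (hI : I ⊆ Icc 0 T)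
    (hc : CharConst T v q u I) : ∃ L, 0 ≤ L ∧ ∀ s ∈ I, ∀ x y, |u s y - u s x| ≤ L * ‖y - x‖ := by
  rcases I.eq_empty_or_nonempty with rfl | ⟨s₀, hs₀⟩
  · exact ⟨0, le_rfl, by simp⟩
  obtain ⟨L, hL0, hL⟩ := (h.su s₀ (hI hs₀)).exists_lip h.hl
  have hT := h.hT
  have hK := h.hK
  refine ⟨L * Real.exp (K * T) + K * Real.exp (K * T) * T, by positivity, fun s hs x y => ?_⟩
  obtain ⟨X, hX, rfl⟩ := exists_isChar h.hK h.hT h.cv h.bv h.lv (hI hs) x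
  obtain ⟨Y, hY, rfl⟩ := exists_isChar h.hK h.hT h.cv h.bv h.lv (hI hs) y
  have hlip : ∀ r ∈ Icc 0 T, ‖Y r - X r‖ ≤ Real.exp (K * T) * ‖Y s - X s‖ := fun r hr =>
    hY.norm_sub_le h.hK h.lv hX hr (hI hs)
  have e1 := hc X hX s hs s₀ hs₀
  have e2 := hc Y hY s hs s₀ hs₀
  unfold charQ at e1 e2
  have i1 := fun a b => (h.continuous_q hX.cont).intervalIntegrable (μ := volume) a b
  have i2 := fun a b => (h.continuous_q hY.cont).intervalIntegrable (μ := volume) a b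
  have e3 := intervalIntegral.integral_interval_sub_left (i1 0 s) (i1 0 s₀)
  have e4 := intervalIntegral.integral_interval_sub_left (i2 0 s) (i2 0 s₀)
  have e5 : u s (Y s) - u s (X s) = (u s₀ (Y s₀) - u s₀ (X s₀))
      - ∫ r in s₀..s, (q r (Y r) - q r (X r)) := by
    rw [intervalIntegral.integral_sub (i2 _ _) (i1 _ _)]
    linarith
  have hsub : uIcc s₀ s ⊆ Icc 0 T := by
    rw [← uIcc_of_le hT.le]
    exact uIcc_subset_uIcc (by rw [uIcc_of_le hT.le]; exact hI hs₀)
      (by rw [uIcc_of_le hT.le]; exact hI hs)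
  have e6 := intervalIntegral.norm_integral_le_of_norm_le_const (a := s₀) (b := s)
    (f := fun r => q r (Y r) - q r (X r)) (C := K * (Real.exp (K * T) * ‖Y s - X s‖))
    (fun r hr => (h.lq r _ _).trans (by
      gcongr
      exact hlip r (hsub (uIoc_subset_uIcc hr))))
  have e7 : |s - s₀| ≤ T := by
    have := hI hs
    have := hI hs₀
    rw [abs_le]
    constructor <;> linarith [(hI hs).1, (hI hs).2, (hI hs₀).1, (hI hs₀).2]
  have e8 : K * (Real.exp (K * T) * ‖Y s - X s‖) * |s - s₀| ≤
      K * (Real.exp (K * T) * ‖Y s - X s‖) * T := by gcongr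
  have e9 := (hL (X s₀) (Y s₀)).trans (mul_le_mul_of_nonneg_left (hlip s₀ (hI hs₀)) hL0)
  rw [e5]
  rw [Real.norm_eq_abs] at e6
  refine (abs_sub _ _).trans ?_
  linarith

/-- Conservation on a set of times gives convergence at the points of its closure. -/
lemma TransData.tendsto_charQ (h : TransData l T K v q u) {I : Set ℝ} (hI : I ⊆ Icc 0 T)
    (hc : CharConst T v q u I) {c : ℝ} (hcI : c ∈ Icc 0 T) {x : ℝ → E d} (hx : IsChar T v x) :
    Filter.Tendsto (charQ q u x) (nhdsWithin c I) (nhds (charQ q u x c)) := by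
  obtain ⟨L, hL0, hL⟩ := h.exists_lip_of_const hI hc
  refine Filter.Tendsto.add ?_ (Filter.Tendsto.mono_left ?_ nhdsWithin_le_nhds)
  · have h1 : Filter.Tendsto (fun s => u s (x s) - u s (x c)) (nhdsWithin c I) (nhds 0) := by
      refine squeeze_zero_norm' (a := fun s => L * ‖x s - x c‖) ?_ ?_
      · filter_upwards [self_mem_nhdsWithin] with s hs
        exact hL s hs _ _
      · have : Filter.Tendsto (fun s => L * ‖x s - x c‖) (nhds c) (nhds (L * ‖x c - x c‖)) :=
          ((((hx.cont.sub continuous_const).norm).const_mul L).tendsto c)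
        simpa using this.mono_left nhdsWithin_le_nhds
    have h2 := h1.add ((h.der c hcI (x c)).continuousAt.tendsto.mono_left
      (nhdsWithin_le_nhds (s := I)))
    simpa using h2
  · exact (intervalIntegral.continuous_primitive
      (fun a b => (h.continuous_q hx.cont).intervalIntegrable a b) 0).tendsto c

lemma TransData.charConst_closure (h : TransData l T K v q u) {I : Set ℝ} (hI : I ⊆ Icc 0 T)
    (hc : CharConst T v q u I) : CharConst T v q u (closure I) := by
  have key : ∀ x, IsChar T v x → ∀ s ∈ I, ∀ t ∈ closure I, charQ q u x t = charQ q u x s := by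
    intro x hx s hs t ht
    have htI : t ∈ Icc 0 T := closure_minimal hI isClosed_Icc ht
    have : (nhdsWithin t I).NeBot := mem_closure_iff_nhdsWithin_neBot.1 ht
    refine tendsto_nhds_unique (h.tendsto_charQ hI hc htI hx) (tendsto_const_nhds.congr' ?_)
    filter_upwards [self_mem_nhdsWithin] with r hr
    exact hc x hx s hs r hr
  intro x hx s hs t ht
  obtain ⟨r, hr⟩ := closure_nonempty_iff.1 ⟨s, hs⟩
  rw [key x hx r hr s hs, key x hx r hr t ht]

end

section
variable {d : ℕ} {l T K N : ℝ} {v : ℝ → E d → E d} {q u : ℝ → E d → ℝ}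

/-- Under uniform `C²`-type bounds, pointwise convergence implies convergence of derivatives. -/
lemma TBd.tendsto_fderiv {ι : Type*} {Fl : Filter ι} {G : ι → E d → ℝ} {g : E d → ℝ}
    (hG : ∀ᶠ i in Fl, TBd N (G i) ∧ Differentiable ℝ (G i)) (hg : TBd N g)
    (hgd : Differentiable ℝ g) (hlim : ∀ x, Filter.Tendsto (fun i => G i x) Fl (nhds (g x)))
    (x w : E d) : Filter.Tendsto (fun i => fderiv ℝ (G i) x w) Fl (nhds (fderiv ℝ g x w)) := by
  have hN : 0 ≤ N := (abs_nonneg _).trans (hg.bd 0)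
  rw [Metric.tendsto_nhds]
  intro ε hε
  obtain ⟨σ, hσ, hσε⟩ : ∃ σ > 0, 2 * N * σ * ‖w‖ ^ 2 < ε / 2 := by
    refine ⟨ε / 2 / (2 * N * ‖w‖ ^ 2 + 1), by positivity, ?_⟩
    rw [show 2 * N * (ε / 2 / (2 * N * ‖w‖ ^ 2 + 1)) * ‖w‖ ^ 2 =
      (ε / 2) * ((2 * N * ‖w‖ ^ 2) / (2 * N * ‖w‖ ^ 2 + 1)) by ring]
    refine mul_lt_of_lt_one_right (by positivity) ?_
    rw [div_lt_one (by positivity)]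
    linarith
  have h1 := (((hlim (x + σ • w)).sub (hlim x)).eventually
    (Metric.ball_mem_nhds _ (show 0 < σ * ε / 2 by positivity)))
  filter_upwards [hG, h1] with i hi h1
  have a1 := hi.1.taylor hi.2 x (σ • w)
  have a2 := hg.taylor hgd x (σ • w)
  rw [Real.dist_eq] at h1
  rw [map_smul, norm_smul, Real.norm_of_nonneg hσ.le, smul_eq_mul] at a1 a2
  rw [Real.dist_eq]
  have a3 : |σ * (fderiv ℝ (G i) x w - fderiv ℝ g x w)| < σ * ε := by
    have a4 : N * (σ * ‖w‖) ^ 2 < σ * ε / 4 := by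
      have := mul_lt_mul_of_pos_left hσε hσ
      linarith
    rw [abs_le] at a1 a2
    rw [abs_lt] at h1 ⊢
    constructor <;> linarith [a1.1, a1.2, a2.1, a2.2, h1.1, h1.2]
  rw [abs_mul, abs_of_pos hσ] at a3
  exact lt_of_mul_lt_mul_left a3 hσ.le

/-- The chain rule along a set of times with uniform `C²`-type bounds. -/
lemma hasDerivWithinAt_comp_of_TBd {F : Set ℝ} {t c : ℝ} {x : ℝ → E d} {w : E d}
    (hF : ∀ s ∈ F, TBd N (u s) ∧ Differentiable ℝ (u s)) (htF : t ∈ F)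
    (hx : HasDerivAt x w t) (hu : ∀ y, ContinuousAt (fun τ => u τ y) t)
    (hd : HasDerivAt (fun τ => u τ (x t)) c t) :
    HasDerivWithinAt (fun τ => u τ (x τ)) (fderiv ℝ (u t) (x t) w + c) F t := by
  have hN : 0 ≤ N := (abs_nonneg _).trans ((hF t htF).1.bd 0)
  have hm : ∀ᶠ s in nhdsWithin t F, s ∈ F := eventually_mem_nhdsWithin
  have hxo : (fun s => x s - x t) =O[nhdsWithin t F] fun s => s - t :=
    (hx.isBigO_sub).mono nhdsWithin_le_nhds
  have hsub : Filter.Tendsto (fun s => s - t) (nhdsWithin t F) (nhds 0) := by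
    have : Filter.Tendsto (fun s => s - t) (nhds t) (nhds (t - t)) :=
      (continuous_id.sub continuous_const).tendsto t
    rw [sub_self] at this
    exact this.mono_left nhdsWithin_le_nhds
  have r1 : (fun s => u s (x s) - u s (x t) - fderiv ℝ (u s) (x t) (x s - x t))
      =o[nhdsWithin t F] fun s => s - t := by
    have b1 : (fun s => u s (x s) - u s (x t) - fderiv ℝ (u s) (x t) (x s - x t))
        =O[nhdsWithin t F] fun s => ‖x s - x t‖ ^ 2 := by
      refine Asymptotics.IsBigO.of_bound N ?_
      filter_upwards [hm] with s hs
      have := (hF s hs).1.taylor (hF s hs).2 (x t) (x s - x t)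
      simpa using this
    refine b1.trans_isLittleO ((hxo.norm_left.pow 2).trans_isLittleO ?_)
    have := (Asymptotics.isLittleO_one_iff ℝ).2 hsub
    have h2 := this.mul_isBigO (Asymptotics.isBigO_refl (fun s => s - t) (nhdsWithin t F))
    simpa [pow_two] using h2
  have r2 : (fun s => fderiv ℝ (u s) (x t) (x s - x t - (s - t) • w))
      =o[nhdsWithin t F] fun s => s - t := by
    have b1 : (fun s => fderiv ℝ (u s) (x t) (x s - x t - (s - t) • w))
        =O[nhdsWithin t F] fun s => x s - x t - (s - t) • w := by
      refine Asymptotics.IsBigO.of_bound N ?_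
      filter_upwards [hm] with s hs
      exact (ContinuousLinearMap.le_opNorm _ _).trans
        (mul_le_mul_of_nonneg_right ((hF s hs).1.norm_fderiv_le _) (norm_nonneg _))
    exact b1.trans_isLittleO ((hasDerivAt_iff_isLittleO.1 hx).mono nhdsWithin_le_nhds)
  have r3 : (fun s => (fderiv ℝ (u s) (x t) w - fderiv ℝ (u t) (x t) w) * (s - t))
      =o[nhdsWithin t F] fun s => s - t := by
    have h1 := TBd.tendsto_fderiv (Fl := nhdsWithin t F) (G := u) (hm.mono hF) (hF t htF).1
      (hF t htF).2 (fun y => (hu y).tendsto.mono_left nhdsWithin_le_nhds) (x t) w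
    have h2 := h1.sub_const (fderiv ℝ (u t) (x t) w)
    rw [sub_self] at h2
    have := ((Asymptotics.isLittleO_one_iff ℝ).2 h2).mul_isBigO
      (Asymptotics.isBigO_refl (fun s => s - t) (nhdsWithin t F))
    simpa using this
  have r4 := (hasDerivAt_iff_isLittleO.1 hd).mono (nhdsWithin_le_nhds (s := F))
  rw [hasDerivWithinAt_iff_isLittleO]
  refine (((r1.add r2).add r3).add r4).congr_left fun s => ?_
  simp only [map_sub, map_smul, smul_eq_mul]
  ring

lemma eqOn_Ioo_of_hasDerivAt_zero {g : ℝ → ℝ} {I : Set ℝ} (hI : Convex ℝ I)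
    (hg : ∀ s ∈ I, HasDerivWithinAt g 0 I s) : ∀ s ∈ I, ∀ t ∈ I, g s = g t := by
  intro s hs t ht
  have := hI.norm_image_sub_le_of_norm_hasDerivWithin_le (f' := fun _ => 0) (C := 0)
    hg (by simp) hs ht
  rw [zero_mul, norm_le_zero_iff, sub_eq_zero] at this
  exact this.symm

lemma TransData.const (h : TransData l T K v q u) : CharConst T v q u (Icc 0 T) := by
  set G : Set ℝ := {t | ∃ δ > 0, CharConst T v q u (Icc 0 T ∩ Ioo (t - δ) (t + δ))} with hG
  have hmono : ∀ {I J : Set ℝ}, J ⊆ I → CharConst T v q u I → CharConst T v q u J :=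
    fun hJ hI x hx s hs t ht => hI x hx s (hJ hs) t (hJ ht)
  have hGo : IsOpen G := by
    rw [Metric.isOpen_iff]
    rintro t ⟨δ, hδ, h⟩
    refine ⟨δ / 2, by positivity, fun t' ht' => ⟨δ / 2, by positivity, hmono ?_ h⟩⟩
    rw [Metric.mem_ball, Real.dist_eq, abs_lt] at ht'
    exact inter_subset_inter_right _ (Ioo_subset_Ioo (by linarith [ht'.1]) (by linarith [ht'.2]))
  have hconv : ∀ I, Convex ℝ I → I ⊆ Icc 0 T ∩ G → CharConst T v q u I := by
    intro I hI hIG x hx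
    refine eqOn_Ioo_of_hasDerivAt_zero hI fun s hs => ?_
    obtain ⟨hs0, δ, hδ, hc⟩ := hIG hs
    refine (hasDerivWithinAt_const s I (charQ q u x s)).congr_of_eventuallyEq ?_ rfl
    have hn : Ioo (s - δ) (s + δ) ∈ nhds s := Ioo_mem_nhds (by linarith) (by linarith)
    filter_upwards [mem_nhdsWithin_of_mem_nhds hn, self_mem_nhdsWithin] with r hr hrI
    exact hc x hx r ⟨(hIG hrI).1, hr⟩ s ⟨hs0, by constructor <;> linarith⟩
  set F := Icc 0 T \ G with hFdef
  have hF : IsClosed F := isClosed_Icc.sdiff hGo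
  have hcov : F ⊆ ⋃ n : ℕ, {t | t ∈ Icc 0 T ∧ TBd (n : ℝ) (u t)} := by
    intro t ht
    obtain ⟨n, hn⟩ := (h.su t ht.1).exists_TBd h.hl
    exact mem_iUnion.2 ⟨n, ht.1, hn⟩
  rcases F.eq_empty_or_nonempty with hE | hne
  · refine hconv _ (convex_Icc 0 T) fun t ht => ⟨ht, by_contra fun hc => ?_⟩
    have : t ∈ F := ⟨ht, hc⟩
    rw [hE] at this
    exact this
  obtain ⟨n, t₀, ht₀, δ, hδ, hn⟩ := exists_portion hF hne
    (fun n => isClosed_setOf_TBd fun t ht x => (h.der t ht x).continuousAt) hcov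
  refine absurd ⟨δ, hδ, ?_⟩ ht₀.2
  set J := Icc 0 T ∩ Ioo (t₀ - δ) (t₀ + δ) with hJ
  have hJc : Convex ℝ J := (convex_Icc 0 T).inter (convex_Ioo _ _)
  have hFG : ∀ r ∈ Icc 0 T, r ∉ F → r ∈ G := fun r hr hrF => by_contra fun hc => hrF ⟨hr, hc⟩
  intro x hx
  refine eqOn_Ioo_of_hasDerivAt_zero hJc fun t ht => ?_
  by_cases htF : t ∈ F
  swap
  · obtain ⟨δ', hδ', hc⟩ := hFG t ht.1 htF
    refine (hasDerivWithinAt_const t J (charQ q u x t)).congr_of_eventuallyEq ?_ rfl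
    have hn : Ioo (t - δ') (t + δ') ∈ nhds t := Ioo_mem_nhds (by linarith) (by linarith)
    filter_upwards [mem_nhdsWithin_of_mem_nhds hn, self_mem_nhdsWithin] with r hr hrJ
    exact hc x hx r ⟨hrJ.1, hr⟩ t ⟨ht.1, by constructor <;> linarith⟩
  have hFJ : HasDerivWithinAt (charQ q u x) 0 (F ∩ J) t := by
    have h1 := hasDerivWithinAt_comp_of_TBd (N := n) (u := u) (F := F ∩ J) (t := t) (x := x)
      (fun s hs => ⟨(hn s hs.1 (by
        have := hs.2.2
        rw [abs_lt]; constructor <;> linarith [this.1, this.2])).2, (h.su s hs.1.1).differentiable⟩)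
      ⟨htF, ht⟩ (hx.der t ht.1) (fun y => (h.der t ht.1 y).continuousAt) (h.der t ht.1 (x t))
    have h2 := intervalIntegral.integral_hasDerivAt_right
      ((h.continuous_q hx.cont).intervalIntegrable (μ := volume) 0 t)
      ((h.continuous_q hx.cont).stronglyMeasurableAtFilter _ _) (h.continuous_q hx.cont).continuousAt
    exact (h1.add h2.hasDerivWithinAt).congr_deriv (by ring)
  have hnear : ∀ s ∈ J, ∃ a ∈ F ∩ J, |a - t| ≤ |s - t| ∧ charQ q u x s = charQ q u x a := by
    intro s hs
    rcases le_total t s with hts | hst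
    · obtain ⟨a, haF, hta, has, ha⟩ := exists_last_mem hF htF hts
      refine ⟨a, ⟨haF, hJc.ordConnected.out ht hs ⟨hta, has⟩⟩, ?_, ?_⟩
      · rw [abs_of_nonneg (by linarith), abs_of_nonneg (by linarith)]; linarith
      · rcases has.eq_or_lt with rfl | has'
        · rfl
        have h0 : Ioo a s ⊆ Icc 0 T := fun r hr =>
          ⟨(ht.1.1.trans hta).trans hr.1.le, hr.2.le.trans hs.1.2⟩
        have := h.charConst_closure h0 (hconv (Ioo a s) (convex_Ioo a s) fun r hr =>
          ⟨h0 hr, hFG r (h0 hr) (ha r ⟨hr.1, hr.2.le⟩)⟩)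
        rw [closure_Ioo has'.ne] at this
        exact this x hx s ⟨has, le_rfl⟩ a ⟨le_rfl, has⟩
    · obtain ⟨a, haF, hsa, hat, ha⟩ := exists_first_mem hF htF hst
      refine ⟨a, ⟨haF, hJc.ordConnected.out hs ht ⟨hsa, hat⟩⟩, ?_, ?_⟩
      · rw [abs_of_nonpos (by linarith), abs_of_nonpos (by linarith)]; linarith
      · rcases hsa.eq_or_lt with rfl | hsa'
        · rfl
        have h0 : Ioo s a ⊆ Icc 0 T := fun r hr =>
          ⟨hs.1.1.trans hr.1.le, (hr.2.le.trans hat).trans ht.1.2⟩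
        have := h.charConst_closure h0 (hconv (Ioo s a) (convex_Ioo s a) fun r hr =>
          ⟨h0 hr, hFG r (h0 hr) (ha r ⟨hr.1.le, hr.2⟩)⟩)
        rw [closure_Ioo hsa'.ne] at this
        exact this x hx s ⟨le_rfl, hsa⟩ a ⟨hsa, le_rfl⟩
  rw [hasDerivWithinAt_iff_isLittleO, Asymptotics.isLittleO_iff] at hFJ ⊢
  intro c hc
  have h1 := hFJ hc
  rw [eventually_nhdsWithin_iff, Metric.eventually_nhds_iff] at h1 ⊢
  obtain ⟨η, hη, h1⟩ := h1
  refine ⟨η, hη, fun s hs hsJ => ?_⟩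
  obtain ⟨a, ha, hle, heq⟩ := hnear s hsJ
  have h2 := h1 (y := a) ((by rw [Real.dist_eq] at *; exact hle.trans_lt hs)) ha
  simp only [smul_zero, sub_zero, Real.norm_eq_abs] at h2 ⊢
  rw [heq]
  exact h2.trans (mul_le_mul_of_nonneg_left hle hc.le)

end

/-- Uniform bounds on the first three derivatives. -/
structure D3 {F G : Type*} [NormedAddCommGroup F] [NormedSpace ℝ F] [NormedAddCommGroup G]
    [NormedSpace ℝ G] (M : ℝ) (f : F → G) : Prop where
  smooth : ContDiff ℝ (⊤ : ℕ∞) f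
  b1 : ∀ x, ‖fderiv ℝ f x‖ ≤ M
  b2 : ∀ x, ‖fderiv ℝ (fderiv ℝ f) x‖ ≤ M
  b3 : ∀ x y, ‖fderiv ℝ (fderiv ℝ f) y - fderiv ℝ (fderiv ℝ f) x‖ ≤ M * ‖y - x‖

section
variable {F G : Type*} [NormedAddCommGroup F] [NormedSpace ℝ F] [NormedAddCommGroup G]
  [NormedSpace ℝ G] {M A η : ℝ} {f : F → G}

lemma D3.nonneg (h : D3 M f) : 0 ≤ M := (norm_nonneg _).trans (h.b1 0)

lemma D3.lip (h : D3 M f) (x y : F) : ‖f y - f x‖ ≤ M * ‖y - x‖ :=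
  convex_univ.norm_image_sub_le_of_norm_fderiv_le
    (fun z _ => (h.smooth.differentiable (by simp)) z) (fun z _ => h.b1 z) (mem_univ _) (mem_univ _)

lemma D3.smooth_fderiv (h : D3 M f) : ContDiff ℝ (⊤ : ℕ∞) (fderiv ℝ f) :=
  h.smooth.fderiv_right (by simp)

lemma D3.fderiv_lip (h : D3 M f) (x y : F) : ‖fderiv ℝ f y - fderiv ℝ f x‖ ≤ M * ‖y - x‖ :=
  convex_univ.norm_image_sub_le_of_norm_fderiv_le
    (fun z _ => (h.smooth_fderiv.differentiable (by simp)) z) (fun z _ => h.b2 z)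
    (mem_univ _) (mem_univ _)

lemma norm_sub_le_of_hasDerivAt_Icc {g g' : ℝ → G} {C : ℝ}
    (hg : ∀ s ∈ Icc (0 : ℝ) 1, HasDerivAt g (g' s) s) (hC : ∀ s ∈ Icc (0 : ℝ) 1, ‖g' s‖ ≤ C) :
    ‖g 1 - g 0‖ ≤ C := by
  have := (convex_Icc (0 : ℝ) 1).norm_image_sub_le_of_norm_hasDerivWithin_le
    (fun s hs => (hg s hs).hasDerivWithinAt) hC (left_mem_Icc.2 zero_le_one)
    (right_mem_Icc.2 zero_le_one)
  simpa using this

lemma hasDerivAt_comp_add_smul (h : Differentiable ℝ f) (x z : F) (s : ℝ) :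
    HasDerivAt (fun s : ℝ => f (x + s • z)) (fderiv ℝ f (x + s • z) z) s := by
  have h2 : HasDerivAt (fun s : ℝ => x + s • z) ((1 : ℝ) • z) s :=
    ((hasDerivAt_id s).smul_const z).const_add x
  rw [one_smul] at h2
  exact (h _).hasFDerivAt.comp_hasDerivAt s h2

lemma norm_taylor₂_le (hM : 0 ≤ M) (h : Differentiable ℝ f)
    (hlip : ∀ x y, ‖fderiv ℝ f y - fderiv ℝ f x‖ ≤ M * ‖y - x‖) (x z : F) :
    ‖f (x + z) - f x - fderiv ℝ f x z‖ ≤ M * ‖z‖ ^ 2 := by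
  have := norm_sub_le_of_hasDerivAt_Icc (g := fun s : ℝ => f (x + s • z) - s • fderiv ℝ f x z)
    (g' := fun s => fderiv ℝ f (x + s • z) z - (1 : ℝ) • fderiv ℝ f x z) (C := M * ‖z‖ ^ 2)
    (fun s _ => (hasDerivAt_comp_add_smul h x z s).sub ((hasDerivAt_id s).smul_const _))
    (fun s hs => by
      rw [one_smul, ← sub_apply]
      refine (ContinuousLinearMap.le_opNorm _ _).trans ?_
      have h1 := hlip x (x + s • z)
      rw [add_sub_cancel_left, norm_smul, Real.norm_of_nonneg hs.1] at h1
      have h2 : s * ‖z‖ ≤ 1 * ‖z‖ := by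
        have := hs.2
        gcongr
      calc _ ≤ M * (s * ‖z‖) * ‖z‖ := by gcongr
        _ ≤ M * (1 * ‖z‖) * ‖z‖ := by gcongr
        _ = M * ‖z‖ ^ 2 := by ring)
  convert this using 2
  simp
  abel

lemma D3.taylor₂ (h : D3 M f) (x z : F) :
    ‖f (x + z) - f x - fderiv ℝ f x z‖ ≤ M * ‖z‖ ^ 2 :=
  norm_taylor₂_le h.nonneg (h.smooth.differentiable (by simp)) h.fderiv_lip x z

lemma D3.taylor₂_fderiv (h : D3 M f) (x z : F) :
    ‖fderiv ℝ f (x + z) - fderiv ℝ f x - fderiv ℝ (fderiv ℝ f) x z‖ ≤ M * ‖z‖ ^ 2 :=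
  norm_taylor₂_le h.nonneg (h.smooth_fderiv.differentiable (by simp)) h.b3 x z

lemma D3.taylor₃ (h : D3 M f) (x z : F) :
    ‖f (x + z) - f x - fderiv ℝ f x z - (1 / 2 : ℝ) • fderiv ℝ (fderiv ℝ f) x z z‖
      ≤ M * ‖z‖ ^ 3 := by
  have hM := h.nonneg
  have := norm_sub_le_of_hasDerivAt_Icc (g := fun s : ℝ => f (x + s • z) - s • fderiv ℝ f x z
      - (s ^ 2 / 2) • fderiv ℝ (fderiv ℝ f) x z z)
    (g' := fun s => fderiv ℝ f (x + s • z) z - (1 : ℝ) • fderiv ℝ f x z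
      - s • fderiv ℝ (fderiv ℝ f) x z z) (C := M * ‖z‖ ^ 3)
    (fun s _ => by
      refine ((hasDerivAt_comp_add_smul (h.smooth.differentiable (by simp)) x z s).sub ((hasDerivAt_id s).smul_const _)).sub
        (HasDerivAt.smul_const ?_ _)
      exact ((hasDerivAt_pow 2 s).div_const 2).congr_deriv (by simp)) (fun s hs => by
      have h1 := h.taylor₂_fderiv x (s • z)
      have h3 : fderiv ℝ f (x + s • z) z - (1 : ℝ) • fderiv ℝ f x z
          - s • fderiv ℝ (fderiv ℝ f) x z z =
          (fderiv ℝ f (x + s • z) - fderiv ℝ f x - fderiv ℝ (fderiv ℝ f) x (s • z)) z := by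
        simp
      rw [h3]
      refine (ContinuousLinearMap.le_opNorm _ _).trans ?_
      rw [norm_smul, Real.norm_of_nonneg hs.1] at h1
      have h2 : s * ‖z‖ ≤ 1 * ‖z‖ := by
        have := hs.2
        gcongr
      have h4 : 0 ≤ s * ‖z‖ := mul_nonneg hs.1 (norm_nonneg _)
      calc _ ≤ M * (s * ‖z‖) ^ 2 * ‖z‖ := by gcongr
        _ ≤ M * (1 * ‖z‖) ^ 2 * ‖z‖ := by gcongr
        _ = M * ‖z‖ ^ 3 := by ring)
  convert this using 2
  simp
  abel

lemma D3.second_diff (h : D3 M f) {y₀ y₁ y₂ : F} (h1 : ‖y₁ - y₀‖ ≤ A * η) (h2 : ‖y₂ - y₁‖ ≤ A * η) :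
    ‖f y₂ - (2 : ℝ) • f y₁ + f y₀‖ ≤ M * ‖y₂ - (2 : ℝ) • y₁ + y₀‖ + 6 * M * A ^ 2 * η ^ 2 := by
  have hM := h.nonneg
  have hA : 0 ≤ A * η := (norm_nonneg _).trans h1
  have h3 : ‖y₂ - y₀‖ ≤ 2 * (A * η) := by
    have := norm_sub_le_norm_sub_add_norm_sub y₂ y₁ y₀
    linarith
  have t1 := h.taylor₂ y₀ (y₁ - y₀)
  have t2 := h.taylor₂ y₀ (y₂ - y₀)
  rw [add_sub_cancel] at t1 t2
  have t3 := (fderiv ℝ f y₀).le_of_opNorm_le (h.b1 y₀) (y₂ - (2 : ℝ) • y₁ + y₀)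
  have e : f y₂ - (2 : ℝ) • f y₁ + f y₀ = fderiv ℝ f y₀ (y₂ - (2 : ℝ) • y₁ + y₀)
      + ((f y₂ - f y₀ - fderiv ℝ f y₀ (y₂ - y₀))
      - (2 : ℝ) • (f y₁ - f y₀ - fderiv ℝ f y₀ (y₁ - y₀))) := by
    simp only [map_sub, map_add, map_smul]
    module
  rw [e]
  refine (norm_add_le _ _).trans (add_le_add t3 ((norm_sub_le _ _).trans ?_))
  rw [norm_smul, Real.norm_ofNat]
  have s1 : M * ‖y₁ - y₀‖ ^ 2 ≤ M * (A * η) ^ 2 := by gcongr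
  have s2 : M * ‖y₂ - y₀‖ ^ 2 ≤ M * (2 * (A * η)) ^ 2 := by gcongr
  calc _ ≤ M * (2 * (A * η)) ^ 2 + 2 * (M * (A * η) ^ 2) := by linarith
    _ = _ := by ring

lemma D3.third_diff (h : D3 M f) (hA0 : 0 ≤ A) (hη0 : 0 ≤ η) (hη : η ≤ 1) {y₀ y₁ y₂ y₃ : F}
    (h1 : ‖y₁ - y₀‖ ≤ A * η)
    (h2 : ‖y₂ - y₁‖ ≤ A * η) (h3 : ‖y₃ - y₂‖ ≤ A * η)
    (hr : ‖y₂ - (2 : ℝ) • y₁ + y₀‖ ≤ A * η ^ 2) :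
    ‖f y₃ - (3 : ℝ) • f y₂ + (3 : ℝ) • f y₁ - f y₀‖ ≤
      M * (1 + 3 * A) * ‖y₃ - (3 : ℝ) • y₂ + (3 : ℝ) • y₁ - y₀‖
        + M * (6 * A ^ 2 + 54 * A ^ 3) * η ^ 3 := by
  have hM := h.nonneg
  have hAη : A * η ≤ A := mul_le_of_le_one_right hA0 hη
  have h20 : ‖y₂ - y₀‖ ≤ 2 * (A * η) := by
    have := norm_sub_le_norm_sub_add_norm_sub y₂ y₁ y₀
    linarith
  have h30 : ‖y₃ - y₀‖ ≤ 3 * (A * η) := by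
    have := norm_sub_le_norm_sub_add_norm_sub y₃ y₂ y₀
    linarith
  have t1 := h.taylor₃ y₀ (y₁ - y₀)
  have t2 := h.taylor₃ y₀ (y₂ - y₀)
  have t3 := h.taylor₃ y₀ (y₃ - y₀)
  rw [add_sub_cancel] at t1 t2 t3
  set w := y₃ - (3 : ℝ) • y₂ + (3 : ℝ) • y₁ - y₀ with hw
  set r := y₂ - (2 : ℝ) • y₁ + y₀ with hr'
  set p := y₁ - y₀ with hp
  set L := fderiv ℝ f y₀ with hL
  set Q := fderiv ℝ (fderiv ℝ f) y₀ with hQ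
  have bL : ‖L w‖ ≤ M * ‖w‖ := L.le_of_opNorm_le (h.b1 y₀) w
  have bQ : ∀ a b, ‖Q a b‖ ≤ M * ‖a‖ * ‖b‖ := fun a b =>
    (Q a).le_of_opNorm_le (Q.le_of_opNorm_le (h.b2 y₀) a) b
  have e : f y₃ - (3 : ℝ) • f y₂ + (3 : ℝ) • f y₁ - f y₀ =
      L w + (1 / 2 : ℝ) • (Q w (y₃ - y₀) + (3 : ℝ) • Q (y₂ - y₁) w + (3 : ℝ) • Q p r
        + (3 : ℝ) • Q r p + (6 : ℝ) • Q r r)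
      + ((f y₃ - f y₀ - L (y₃ - y₀) - (1 / 2 : ℝ) • Q (y₃ - y₀) (y₃ - y₀))
        - (3 : ℝ) • (f y₂ - f y₀ - L (y₂ - y₀) - (1 / 2 : ℝ) • Q (y₂ - y₀) (y₂ - y₀))
        + (3 : ℝ) • (f y₁ - f y₀ - L p - (1 / 2 : ℝ) • Q p p)) := by
    simp only [hw, hr', hp, map_sub, map_add, map_smul, sub_apply,
      add_apply, smul_apply]
    module
  have b1 : ‖Q w (y₃ - y₀)‖ ≤ M * ‖w‖ * (3 * A) := (bQ _ _).trans (by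
    gcongr
    linarith)
  have b2 : ‖(3 : ℝ) • Q (y₂ - y₁) w‖ ≤ 3 * (M * A * ‖w‖) := by
    rw [norm_smul, Real.norm_ofNat]
    refine mul_le_mul_of_nonneg_left ((bQ _ _).trans ?_) (by norm_num)
    gcongr
    linarith
  have b3 : ‖(3 : ℝ) • Q p r‖ ≤ 3 * (M * (A * η) * (A * η ^ 2)) := by
    rw [norm_smul, Real.norm_ofNat]
    refine mul_le_mul_of_nonneg_left ((bQ _ _).trans ?_) (by norm_num)
    gcongr
  have b4 : ‖(3 : ℝ) • Q r p‖ ≤ 3 * (M * (A * η ^ 2) * (A * η)) := by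
    rw [norm_smul, Real.norm_ofNat]
    refine mul_le_mul_of_nonneg_left ((bQ _ _).trans ?_) (by norm_num)
    gcongr
  have b5 : ‖(6 : ℝ) • Q r r‖ ≤ 6 * (M * (A * η ^ 2) * (A * η)) := by
    rw [norm_smul, Real.norm_ofNat]
    refine mul_le_mul_of_nonneg_left ((bQ _ _).trans ?_) (by norm_num)
    have : A * η ^ 2 ≤ A * η := by
      rw [pow_two]
      exact mul_le_mul_of_nonneg_left (mul_le_of_le_one_left hη0 hη) hA0
    gcongr
    exact hr.trans this
  have s1 : M * ‖p‖ ^ 3 ≤ M * (A * η) ^ 3 := by gcongr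
  have s2 : M * ‖y₂ - y₀‖ ^ 3 ≤ M * (2 * (A * η)) ^ 3 := by gcongr
  have s3 : M * ‖y₃ - y₀‖ ^ 3 ≤ M * (3 * (A * η)) ^ 3 := by gcongr
  rw [e]
  refine (norm_add_le _ _).trans ?_
  have n1 := norm_add_le (L w) ((1 / 2 : ℝ) • (Q w (y₃ - y₀) + (3 : ℝ) • Q (y₂ - y₁) w
    + (3 : ℝ) • Q p r + (3 : ℝ) • Q r p + (6 : ℝ) • Q r r))
  rw [norm_smul, Real.norm_of_nonneg (by norm_num : (0 : ℝ) ≤ 1 / 2)] at n1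
  have n2 := norm_add_le (Q w (y₃ - y₀) + (3 : ℝ) • Q (y₂ - y₁) w
    + (3 : ℝ) • Q p r + (3 : ℝ) • Q r p) ((6 : ℝ) • Q r r)
  have n3 := norm_add_le (Q w (y₃ - y₀) + (3 : ℝ) • Q (y₂ - y₁) w
    + (3 : ℝ) • Q p r) ((3 : ℝ) • Q r p)
  have n4 := norm_add_le (Q w (y₃ - y₀) + (3 : ℝ) • Q (y₂ - y₁) w) ((3 : ℝ) • Q p r)
  have n5 := norm_add_le (Q w (y₃ - y₀)) ((3 : ℝ) • Q (y₂ - y₁) w)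
  have n6 := norm_add_le ((f y₃ - f y₀ - L (y₃ - y₀) - (1 / 2 : ℝ) • Q (y₃ - y₀) (y₃ - y₀))
        - (3 : ℝ) • (f y₂ - f y₀ - L (y₂ - y₀) - (1 / 2 : ℝ) • Q (y₂ - y₀) (y₂ - y₀)))
        ((3 : ℝ) • (f y₁ - f y₀ - L p - (1 / 2 : ℝ) • Q p p))
  have n7 := norm_sub_le (f y₃ - f y₀ - L (y₃ - y₀) - (1 / 2 : ℝ) • Q (y₃ - y₀) (y₃ - y₀))
        ((3 : ℝ) • (f y₂ - f y₀ - L (y₂ - y₀) - (1 / 2 : ℝ) • Q (y₂ - y₀) (y₂ - y₀)))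
  rw [norm_smul, Real.norm_ofNat] at n6 n7
  have fin : M * (1 + 3 * A) * ‖w‖ + M * (6 * A ^ 2 + 54 * A ^ 3) * η ^ 3 =
    M * ‖w‖ + 1 / 2 * (M * ‖w‖ * (3 * A) + 3 * (M * A * ‖w‖) + 3 * (M * (A * η) * (A * η ^ 2))
      + 3 * (M * (A * η ^ 2) * (A * η)) + 6 * (M * (A * η ^ 2) * (A * η)))
      + (M * (3 * (A * η)) ^ 3 + 3 * (M * (2 * (A * η)) ^ 3) + 3 * (M * (A * η) ^ 3)) := by ring
  rw [fin]
  linarith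

end

section
variable {d : ℕ} {l T K M : ℝ} {v : ℝ → E d → E d} {q u : ℝ → E d → ℝ}

lemma TransData.abs_sum_le (h : TransData l T K v q u) {ι : Type*} [Fintype ι] (c : ι → ℝ)
    {Y : ι → ℝ → E d} (hY : ∀ j, IsChar T v (Y j)) {D t : ℝ} (ht : t ∈ Icc 0 T)
    (h0 : |∑ j, c j * u 0 (Y j 0)| ≤ D) (hq : ∀ s ∈ Icc 0 T, |∑ j, c j * q s (Y j s)| ≤ D) :
    |∑ j, c j * u t (Y j t)| ≤ D * (1 + T) := by
  have h0T : (0 : ℝ) ∈ Icc 0 T := ⟨le_rfl, h.hT.le⟩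
  have hD : 0 ≤ D := (abs_nonneg _).trans h0
  have e : ∑ j, c j * u t (Y j t) = ∑ j, c j * u 0 (Y j 0)
      - ∫ s in (0 : ℝ)..t, ∑ j, c j * q s (Y j s) := by
    rw [intervalIntegral.integral_finsetSum fun j _ =>
      ((h.continuous_q (hY j).cont).const_mul (c j)).intervalIntegrable _ _,
      ← Finset.sum_sub_distrib]
    refine Finset.sum_congr rfl fun j _ => ?_
    have := h.const (Y j) (hY j) t ht 0 h0T
    simp only [charQ, intervalIntegral.integral_same, add_zero] at this
    rw [intervalIntegral.integral_const_mul, ← this]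
    ring
  have h1 := intervalIntegral.norm_integral_le_of_norm_le_const (a := 0) (b := t)
    (f := fun s => ∑ j, c j * q s (Y j s)) (C := D) (fun s hs => by
      rw [uIoc_of_le ht.1] at hs
      exact hq s ⟨hs.1.le, hs.2.trans ht.2⟩)
  rw [sub_zero, abs_of_nonneg ht.1, Real.norm_eq_abs] at h1
  have h2 : D * t ≤ D * T := mul_le_mul_of_nonneg_left ht.2 hD
  rw [e]
  refine (abs_sub _ _).trans ?_
  linarith

lemma TransData.exists_diff_bound (h : TransData l T K v q u) (hv : ∀ t ∈ Icc 0 T, D3 M (v t))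
    (hq : ∀ t ∈ Icc 0 T, D3 M (q t)) (h0 : D3 M (u 0)) :
    ∃ C, 0 ≤ C ∧ ∀ t ∈ Icc 0 T, ∀ x e : E d, ‖e‖ ≤ 1 →
      |u t (x + e) - u t x| ≤ C * ‖e‖ ∧
      |u t (x + (2 : ℝ) • e) - 2 * u t (x + e) + u t x| ≤ C * ‖e‖ ^ 2 ∧
      |u t (x + (3 : ℝ) • e) - 3 * u t (x + (2 : ℝ) • e) + 3 * u t (x + e) - u t x|
        ≤ C * ‖e‖ ^ 3 := by
  have hT := h.hT
  have hM := h0.nonneg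
  have h0T : (0 : ℝ) ∈ Icc 0 T := ⟨le_rfl, h.hT.le⟩
  set A₁ := Real.exp (K * T) with hA₁
  have hA₁0 : 0 ≤ A₁ := (Real.exp_pos _).le
  set A₂ := 6 * M * A₁ ^ 2 * T * Real.exp (M * T) with hA₂
  have hA₂0 : 0 ≤ A₂ := by positivity
  set A := A₁ + A₂ with hA
  have hA0 : 0 ≤ A := by positivity
  set B := M * (6 * A ^ 2 + 54 * A ^ 3) with hB
  have hB0 : 0 ≤ B := by positivity
  set A₃ := B * T * Real.exp (M * (1 + 3 * A) * T) with hA₃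
  have hA₃0 : 0 ≤ A₃ := by positivity
  refine ⟨(M * A₁ + (M * A₂ + 6 * M * A₁ ^ 2) + (M * (1 + 3 * A) * A₃ + B)) * (1 + T),
    by positivity, fun t ht x e he => ?_⟩
  have hex : ∀ j : Fin 4, ∃ Y, IsChar T v Y ∧ Y t = x + (j : ℝ) • e := fun j =>
    exists_isChar h.hK h.hT h.cv h.bv h.lv ht _
  choose Y hY hYt using hex
  have y0 : Y 0 t = x := by simpa using hYt 0
  have y1 : Y 1 t = x + e := by simpa using hYt 1
  have y2 : Y 2 t = x + (2 : ℝ) • e := by simpa using hYt 2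
  have y3 : Y 3 t = x + (3 : ℝ) • e := by simpa using hYt 3
  have s1 : ∀ s ∈ Icc 0 T, ‖Y 1 s - Y 0 s‖ ≤ A₁ * ‖e‖ := fun s hs => by
    have := (hY 1).norm_sub_le h.hK h.lv (hY 0) hs ht
    rwa [y0, y1, add_sub_cancel_left] at this
  have s2 : ∀ s ∈ Icc 0 T, ‖Y 2 s - Y 1 s‖ ≤ A₁ * ‖e‖ := fun s hs => by
    have := (hY 2).norm_sub_le h.hK h.lv (hY 1) hs ht
    rwa [y1, y2, show x + (2 : ℝ) • e - (x + e) = e by module] at this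
  have s3 : ∀ s ∈ Icc 0 T, ‖Y 3 s - Y 2 s‖ ≤ A₁ * ‖e‖ := fun s hs => by
    have := (hY 3).norm_sub_le h.hK h.lv (hY 2) hs ht
    rwa [y2, y3, show x + (3 : ℝ) • e - (x + (2 : ℝ) • e) = e by module] at this
  have hle : A₁ * ‖e‖ ≤ A * ‖e‖ := by
    gcongr
    linarith
  have r : ∀ s ∈ Icc 0 T, ‖Y 2 s - (2 : ℝ) • Y 1 s + Y 0 s‖ ≤ A₂ * ‖e‖ ^ 2 := fun s hs => by
    have := norm_le_mul_exp_of_norm_deriv_le (z := fun s => Y 2 s - (2 : ℝ) • Y 1 s + Y 0 s)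
      (K := M) (ε := 6 * M * A₁ ^ 2 * ‖e‖ ^ 2) hM (by positivity) ht
      (fun s hs => (((hY 2).der s hs).sub (((hY 1).der s hs).const_smul (2 : ℝ))).add
        ((hY 0).der s hs))
      (fun s hs => (hv s hs).second_diff (s1 s hs) (s2 s hs)) s hs
    simp only [y0, y1, y2] at this
    rw [show x + (2 : ℝ) • e - (2 : ℝ) • (x + e) + x = 0 by module, norm_zero] at this
    refine this.trans_eq ?_
    rw [hA₂]; ring
  have r' : ∀ s ∈ Icc 0 T, ‖Y 2 s - (2 : ℝ) • Y 1 s + Y 0 s‖ ≤ A * ‖e‖ ^ 2 := fun s hs =>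
    (r s hs).trans (by gcongr; linarith)
  have w : ∀ s ∈ Icc 0 T, ‖Y 3 s - (3 : ℝ) • Y 2 s + (3 : ℝ) • Y 1 s - Y 0 s‖ ≤ A₃ * ‖e‖ ^ 3 :=
    fun s hs => by
    have := norm_le_mul_exp_of_norm_deriv_le
      (z := fun s => Y 3 s - (3 : ℝ) • Y 2 s + (3 : ℝ) • Y 1 s - Y 0 s)
      (K := M * (1 + 3 * A)) (ε := B * ‖e‖ ^ 3) (by positivity) (by positivity) ht
      (fun s hs => ((((hY 3).der s hs).sub (((hY 2).der s hs).const_smul (3 : ℝ))).add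
        (((hY 1).der s hs).const_smul (3 : ℝ))).sub ((hY 0).der s hs))
      (fun s hs => (hv s hs).third_diff hA0 (norm_nonneg e) he ((s1 s hs).trans hle)
        ((s2 s hs).trans hle) ((s3 s hs).trans hle) (r' s hs)) s hs
    simp only [y0, y1, y2, y3] at this
    rw [show x + (3 : ℝ) • e - (3 : ℝ) • (x + (2 : ℝ) • e) + (3 : ℝ) • (x + e) - x = 0 by module,
      norm_zero] at this
    refine this.trans_eq ?_
    rw [hA₃]; ring
  have f1 : ∀ (g : E d → ℝ), D3 M g → ∀ s ∈ Icc 0 T,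
      |∑ j : Fin 4, ![-1, 1, 0, 0] j * g (Y j s)| ≤ M * A₁ * ‖e‖ := fun g hg s hs => by
    have := (hg.lip (Y 0 s) (Y 1 s)).trans (mul_le_mul_of_nonneg_left (s1 s hs) hM)
    simp only [Fin.sum_univ_four, Matrix.cons_val]
    rw [Real.norm_eq_abs] at this
    refine (le_of_eq (congrArg _ (by ring))).trans (this.trans_eq ?_)
    ring
  have f2 : ∀ (g : E d → ℝ), D3 M g → ∀ s ∈ Icc 0 T,
      |∑ j : Fin 4, ![1, -2, 1, 0] j * g (Y j s)| ≤ (M * A₂ + 6 * M * A₁ ^ 2) * ‖e‖ ^ 2 :=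
    fun g hg s hs => by
    have := (hg.second_diff (s1 s hs) (s2 s hs)).trans
      (add_le_add_left (mul_le_mul_of_nonneg_left (r s hs) hM) _)
    simp only [Fin.sum_univ_four, Matrix.cons_val]
    rw [Real.norm_eq_abs] at this
    simp only [smul_eq_mul] at this
    refine (le_of_eq (congrArg _ (by ring))).trans (this.trans_eq ?_)
    ring
  have f3 : ∀ (g : E d → ℝ), D3 M g → ∀ s ∈ Icc 0 T,
      |∑ j : Fin 4, ![-1, 3, -3, 1] j * g (Y j s)| ≤ (M * (1 + 3 * A) * A₃ + B) * ‖e‖ ^ 3 :=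
    fun g hg s hs => by
    have := (hg.third_diff hA0 (norm_nonneg e) he ((s1 s hs).trans hle)
        ((s2 s hs).trans hle) ((s3 s hs).trans hle) (r' s hs)).trans
      (add_le_add_left (mul_le_mul_of_nonneg_left (w s hs) (by positivity)) _)
    simp only [Fin.sum_univ_four, Matrix.cons_val]
    rw [Real.norm_eq_abs] at this
    simp only [smul_eq_mul] at this
    refine (le_of_eq (congrArg _ (by ring))).trans (this.trans_eq ?_)
    rw [hB]; ring
  have g1 := h.abs_sum_le _ hY ht (f1 _ h0 0 h0T) fun s hs => f1 _ (hq s hs) s hs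
  have g2 := h.abs_sum_le _ hY ht (f2 _ h0 0 h0T) fun s hs => f2 _ (hq s hs) s hs
  have g3 := h.abs_sum_le _ hY ht (f3 _ h0 0 h0T) fun s hs => f3 _ (hq s hs) s hs
  simp only [Fin.sum_univ_four, Matrix.cons_val, y0, y1, y2, y3] at g1 g2 g3
  have k1 : 0 ≤ M * A₁ := by positivity
  have k2 : 0 ≤ M * A₂ + 6 * M * A₁ ^ 2 := by positivity
  have k3 : 0 ≤ M * (1 + 3 * A) * A₃ + B := by positivity
  refine ⟨?_, ?_, ?_⟩
  · calc _ = |-1 * u t x + 1 * u t (x + e) + 0 * u t (x + (2 : ℝ) • e)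
        + 0 * u t (x + (3 : ℝ) • e)| := by ring_nf
      _ ≤ _ := g1
      _ = M * A₁ * (1 + T) * ‖e‖ := by ring
      _ ≤ _ := mul_le_mul_of_nonneg_right
        (mul_le_mul_of_nonneg_right (by linarith) (by positivity)) (by positivity)
  · calc _ = |1 * u t x + -2 * u t (x + e) + 1 * u t (x + (2 : ℝ) • e)
        + 0 * u t (x + (3 : ℝ) • e)| := by ring_nf
      _ ≤ _ := g2
      _ = (M * A₂ + 6 * M * A₁ ^ 2) * (1 + T) * ‖e‖ ^ 2 := by ring
      _ ≤ _ := mul_le_mul_of_nonneg_right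
        (mul_le_mul_of_nonneg_right (by linarith) (by positivity)) (by positivity)
  · calc _ = |-1 * u t x + 3 * u t (x + e) + -3 * u t (x + (2 : ℝ) • e)
        + 1 * u t (x + (3 : ℝ) • e)| := by ring_nf
      _ ≤ _ := g3
      _ = (M * (1 + 3 * A) * A₃ + B) * (1 + T) * ‖e‖ ^ 3 := by ring
      _ ≤ _ := mul_le_mul_of_nonneg_right
        (mul_le_mul_of_nonneg_right (by linarith) (by positivity)) (by positivity)

end

section
set_option maxSynthPendingDepth 4
variable {F : Type*} [NormedAddCommGroup F] [NormedSpace ℝ F]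

lemma abs_trilinear_le_of_diag (S : F →L[ℝ] F →L[ℝ] F →L[ℝ] ℝ) {C : ℝ}
    (h12 : ∀ a b c, S a b c = S b a c) (h23 : ∀ a b c, S a b c = S a c b)
    (hC : ∀ e, ‖e‖ ≤ 1 → |S e e e| ≤ C) {a b c : F} (ha : ‖a‖ ≤ 1) (hb : ‖b‖ ≤ 1)
    (hc : ‖c‖ ≤ 1) : |S a b c| ≤ 5 * C := by
  have key : ∀ w : F, ‖w‖ ≤ 3 → |S w w w| ≤ 27 * C := fun w hw => by
    have h := hC ((1 / 3 : ℝ) • w) (by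
      rw [norm_smul, Real.norm_of_nonneg (by norm_num)]; linarith)
    simp only [map_smul, _root_.smul_apply, smul_eq_mul, abs_mul] at h
    rw [abs_of_nonneg (by norm_num : (0 : ℝ) ≤ 1 / 3)] at h
    linarith
  have h1 := abs_le.1 (key (a + b + c) ((norm_add₃_le).trans (by linarith)))
  have h2 := abs_le.1 (key (a + b - c) ((norm_sub_le _ _).trans
    (by linarith [norm_add_le a b])))
  have h3 := abs_le.1 (key (a - b + c) ((norm_add_le _ _).trans
    (by linarith [norm_sub_le a b])))
  have h4 := abs_le.1 (key (a - b - c) ((norm_sub_le _ _).trans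
    (by linarith [norm_sub_le a b])))
  have hC0 : 0 ≤ C := (abs_nonneg _).trans (hC 0 (by simp))
  have e : 24 * S a b c = S (a + b + c) (a + b + c) (a + b + c)
      - S (a + b - c) (a + b - c) (a + b - c) - S (a - b + c) (a - b + c) (a - b + c)
      + S (a - b - c) (a - b - c) (a - b - c) := by
    simp only [map_add, map_sub, _root_.add_apply, _root_.sub_apply]
    have e1 : S a c b = S a b c := (h23 _ _ _)
    have e2 : S b a c = S a b c := (h12 _ _ _)
    have e3 : S b c a = S a b c := by rw [h23, h12]
    have e4 : S c a b = S a b c := by rw [h12, h23]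
    have e5 : S c b a = S a b c := by rw [h23, h12, h23]
    rw [e1, e2, e3, e4, e5]
    ring
  rw [abs_le]
  constructor <;> linarith [h1.1, h1.2, h2.1, h2.2, h3.1, h3.2, h4.1, h4.2]

lemma abs_bilinear_le_of_diag (S : F →L[ℝ] F →L[ℝ] ℝ) {C : ℝ}
    (h12 : ∀ a b, S a b = S b a)
    (hC : ∀ e, ‖e‖ ≤ 1 → |S e e| ≤ C) {a b : F} (ha : ‖a‖ ≤ 1) (hb : ‖b‖ ≤ 1) :
    |S a b| ≤ 5 * C := by
  have key : ∀ w : F, ‖w‖ ≤ 2 → |S w w| ≤ 4 * C := fun w hw => by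
    have h := hC ((1 / 2 : ℝ) • w) (by
      rw [norm_smul, Real.norm_of_nonneg (by norm_num)]; linarith)
    simp only [map_smul, _root_.smul_apply, smul_eq_mul, abs_mul] at h
    rw [abs_of_nonneg (by norm_num : (0 : ℝ) ≤ 1 / 2)] at h
    linarith
  have h1 := abs_le.1 (key (a + b) ((norm_add_le _ _).trans (by linarith)))
  have h2 := abs_le.1 (key (a - b) ((norm_sub_le _ _).trans (by linarith)))
  have hC0 : 0 ≤ C := (abs_nonneg _).trans (hC 0 (by simp))
  have e : 4 * S a b = S (a + b) (a + b) - S (a - b) (a - b) := by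
    simp only [map_add, map_sub, _root_.add_apply, _root_.sub_apply]
    rw [h12 b a]
    ring
  rw [abs_le]
  constructor <;> linarith [h1.1, h1.2, h2.1, h2.2]

lemma exists_slope_eq {φ φ' : ℝ → ℝ} (hφ : ∀ s, HasDerivAt φ (φ' s) s) {h : ℝ} (hh : 0 < h)
    (s : ℝ) : ∃ r ∈ Ioo s (s + h), φ (s + h) - φ s = h * φ' r := by
  obtain ⟨r, hr, e⟩ := exists_hasDerivAt_eq_slope φ φ' (a := s) (b := s + h) (by linarith)
    (fun x _ => (hφ x).continuousAt.continuousWithinAt) (fun x _ => hφ x)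
  refine ⟨r, hr, ?_⟩
  rw [e, add_sub_cancel_left]; field_simp

lemma abs_le_of_forall_near {φ : ℝ → ℝ} (hφ : ContinuousAt φ 0) {C : ℝ}
    (h : ∀ s ∈ Ioc (0 : ℝ) 1, ∃ r ∈ Icc 0 (3 * s), |φ r| ≤ C) : |φ 0| ≤ C := by
  by_contra! hlt
  obtain ⟨δ, hδ, hb⟩ := Metric.eventually_nhds_iff.1 (hφ.abs.eventually_const_lt hlt)
  have hs0 : 0 < min 1 (δ / 4) := lt_min one_pos (by linarith)
  obtain ⟨r, hr, hrC⟩ := h (min 1 (δ / 4)) ⟨hs0, min_le_left _ _⟩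
  have := hb (y := r) (by
    rw [Real.dist_eq, sub_zero, abs_of_nonneg hr.1]
    linarith [hr.2, min_le_right (1 : ℝ) (δ / 4)])
  linarith

lemma abs_deriv_le_of_diff {φ φ₁ : ℝ → ℝ} (h0 : ∀ s, HasDerivAt φ (φ₁ s) s)
    (hc : ContinuousAt φ₁ 0) {C : ℝ} (hC : ∀ s ∈ Ioc (0 : ℝ) 1, |φ s - φ 0| ≤ C * s) :
    |φ₁ 0| ≤ C :=
  abs_le_of_forall_near hc fun s hs => by
    obtain ⟨r, hr, e⟩ := exists_slope_eq h0 hs.1 0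
    refine ⟨r, ⟨hr.1.le, by linarith [hr.2, hs.1]⟩, ?_⟩
    have := hC s hs
    rw [zero_add] at e
    rw [e, abs_mul, abs_of_pos hs.1, mul_comm] at this
    exact le_of_mul_le_mul_right this hs.1

lemma abs_deriv₂_le_of_diff {φ φ₁ φ₂ : ℝ → ℝ} (h0 : ∀ s, HasDerivAt φ (φ₁ s) s)
    (h1 : ∀ s, HasDerivAt φ₁ (φ₂ s) s)
    (hc : ContinuousAt φ₂ 0) {C : ℝ}
    (hC : ∀ s ∈ Ioc (0 : ℝ) 1, |φ (2 * s) - 2 * φ s + φ 0| ≤ C * s ^ 2) :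
    |φ₂ 0| ≤ C :=
  abs_le_of_forall_near hc fun s hs => by
    obtain ⟨r, hr, e⟩ := exists_slope_eq (φ := fun r => φ (r + s) - φ r)
      (fun r => ((h0 (r + s)).comp_add_const r s).sub (h0 r)) hs.1 0
    obtain ⟨r', hr', e'⟩ := exists_slope_eq h1 hs.1 r
    refine ⟨r', ⟨by linarith [hr.1, hr'.1], by linarith [hr.2, hr'.2, hs.1]⟩, ?_⟩
    have := hC s hs
    have e2 : φ (2 * s) - 2 * φ s + φ 0 = s ^ 2 * φ₂ r' := by
      rw [e'] at e
      simp only [zero_add] at e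
      rw [two_mul]
      linarith
    rw [e2, abs_mul, abs_of_pos (by have := hs.1; positivity), mul_comm] at this
    exact le_of_mul_le_mul_right this (by have := hs.1; positivity)

lemma abs_deriv₃_le_of_diff {φ φ₁ φ₂ φ₃ : ℝ → ℝ} (h0 : ∀ s, HasDerivAt φ (φ₁ s) s)
    (h1 : ∀ s, HasDerivAt φ₁ (φ₂ s) s) (h2 : ∀ s, HasDerivAt φ₂ (φ₃ s) s)
    (hc : ContinuousAt φ₃ 0) {C : ℝ}
    (hC : ∀ s ∈ Ioc (0 : ℝ) 1, |φ (3 * s) - 3 * φ (2 * s) + 3 * φ s - φ 0| ≤ C * s ^ 3) :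
    |φ₃ 0| ≤ C :=
  abs_le_of_forall_near hc fun s hs => by
    obtain ⟨r, hr, e⟩ := exists_slope_eq (φ := fun r => φ (r + 2 * s) - 2 * φ (r + s) + φ r)
      (fun r => (((h0 (r + 2 * s)).comp_add_const r (2 * s)).sub
        (((h0 (r + s)).comp_add_const r s).const_mul 2)).add (h0 r)) hs.1 0
    obtain ⟨r', hr', e'⟩ := exists_slope_eq (φ := fun r => φ₁ (r + s) - φ₁ r)
      (fun r => ((h1 (r + s)).comp_add_const r s).sub (h1 r)) hs.1 r
    obtain ⟨r'', hr'', e''⟩ := exists_slope_eq h2 hs.1 r'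
    refine ⟨r'', ⟨by linarith [hr.1, hr'.1, hr''.1], by linarith [hr.2, hr'.2, hr''.2, hs.1]⟩, ?_⟩
    have := hC s hs
    have e2 : φ (3 * s) - 3 * φ (2 * s) + 3 * φ s - φ 0 = s ^ 3 * φ₃ r'' := by
      rw [e''] at e'
      have a1 : r + s + s = r + 2 * s := by ring
      have a2 : s + 2 * s = 3 * s := by ring
      have a3 : s + s = 2 * s := by ring
      simp only [zero_add, a1, a2, a3] at e e'
      have e3 : φ₁ (r + 2 * s) - 2 * φ₁ (r + s) + φ₁ r = s * (s * φ₃ r'') := by linarith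
      rw [e3] at e
      linarith
    rw [e2, abs_mul, abs_of_pos (by have := hs.1; positivity), mul_comm] at this
    exact le_of_mul_le_mul_right this (by have := hs.1; positivity)

lemma fderiv_fderiv_apply {G : Type*} [NormedAddCommGroup G] [NormedSpace ℝ G]
    {L : F → F →L[ℝ] G} {x : F} (hL : DifferentiableAt ℝ L x) (a b : F) :
    fderiv ℝ (fun y => L y b) x a = fderiv ℝ L x a b := by
  have := (hL.hasFDerivAt.clm_apply (hasFDerivAt_const b x)).fderiv
  rw [this]; simp

/-- Bounds for finite differences up to order three control the derivatives. -/
lemma fderiv_bounds_of_diff {g : F → ℝ} (hg : ContDiff ℝ (⊤ : ℕ∞) g) {C : ℝ} (hC0 : 0 ≤ C) (x : F)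
    (hC : ∀ e : F, ‖e‖ ≤ 1 → |g (x + e) - g x| ≤ C * ‖e‖
      ∧ |g (x + (2 : ℝ) • e) - 2 * g (x + e) + g x| ≤ C * ‖e‖ ^ 2
      ∧ |g (x + (3 : ℝ) • e) - 3 * g (x + (2 : ℝ) • e) + 3 * g (x + e) - g x| ≤ C * ‖e‖ ^ 3)
    {a b c : F} (ha : ‖a‖ ≤ 1) (hb : ‖b‖ ≤ 1) (hc : ‖c‖ ≤ 1) :
    |fderiv ℝ g x a| ≤ 5 * C ∧ |fderiv ℝ (fderiv ℝ g) x a b| ≤ 5 * C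
      ∧ |fderiv ℝ (fderiv ℝ (fderiv ℝ g)) x a b c| ≤ 5 * C := by
  have g1 : ContDiff ℝ (⊤ : ℕ∞) (fderiv ℝ g) := hg.fderiv_right (by simp)
  have g2 : ContDiff ℝ (⊤ : ℕ∞) (fderiv ℝ (fderiv ℝ g)) := g1.fderiv_right (by simp)
  have g3 : ContDiff ℝ (⊤ : ℕ∞) (fderiv ℝ (fderiv ℝ (fderiv ℝ g))) := g2.fderiv_right (by simp)
  have d0 : Differentiable ℝ g := hg.differentiable (by simp)
  have d1 : Differentiable ℝ (fderiv ℝ g) := g1.differentiable (by simp)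
  have d2 : Differentiable ℝ (fderiv ℝ (fderiv ℝ g)) := g2.differentiable (by simp)
  have H : ∀ e : F, ‖e‖ ≤ 1 → |fderiv ℝ g x e| ≤ C ∧ |fderiv ℝ (fderiv ℝ g) x e e| ≤ C
      ∧ |fderiv ℝ (fderiv ℝ (fderiv ℝ g)) x e e e| ≤ C := by
    intro e he
    have c0 : ∀ s, HasDerivAt (fun s : ℝ => g (x + s • e)) (fderiv ℝ g (x + s • e) e) s :=
      fun s => hasDerivAt_comp_add_smul d0 x e s
    have c1 : ∀ s, HasDerivAt (fun s : ℝ => fderiv ℝ g (x + s • e) e)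
        (fderiv ℝ (fderiv ℝ g) (x + s • e) e e) s := fun s => by
      have := hasDerivAt_comp_add_smul (f := fun y => fderiv ℝ g y e)
        (d1.clm_apply (differentiable_const e)) x e s
      rwa [fderiv_fderiv_apply (d1 _)] at this
    have c2 : ∀ s, HasDerivAt (fun s : ℝ => fderiv ℝ (fderiv ℝ g) (x + s • e) e e)
        (fderiv ℝ (fderiv ℝ (fderiv ℝ g)) (x + s • e) e e e) s := fun s => by
      have d2e : Differentiable ℝ (fun y => fderiv ℝ (fderiv ℝ g) y e) :=
        d2.clm_apply (differentiable_const e)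
      have := hasDerivAt_comp_add_smul (f := fun y => fderiv ℝ (fderiv ℝ g) y e e)
        (d2e.clm_apply (differentiable_const e)) x e s
      rwa [fderiv_fderiv_apply (d2e _), fderiv_fderiv_apply (d2 _)] at this
    have hn : ∀ s ∈ Ioc (0 : ℝ) 1, ‖s • e‖ ≤ s := fun s hs => by
      rw [norm_smul, Real.norm_of_nonneg hs.1.le]
      exact mul_le_of_le_one_right hs.1.le he
    have hn1 : ∀ s ∈ Ioc (0 : ℝ) 1, ‖s • e‖ ≤ 1 := fun s hs => (hn s hs).trans hs.2
    have cc : Continuous fun s : ℝ => x + s • e := by fun_prop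
    refine ⟨?_, ?_, ?_⟩
    · have := abs_deriv_le_of_diff c0 (C := C) (c1 0).continuousAt fun s hs => by
        have := (hC (s • e) (hn1 s hs)).1
        simp only [zero_smul, add_zero]
        exact this.trans (mul_le_mul_of_nonneg_left (hn s hs) hC0)
      simpa using this
    · have := abs_deriv₂_le_of_diff c0 c1 (C := C) (c2 0).continuousAt fun s hs => by
        have := (hC (s • e) (hn1 s hs)).2.1
        simp only [zero_smul, add_zero, mul_smul]
        exact this.trans (mul_le_mul_of_nonneg_left
          (pow_le_pow_left₀ (norm_nonneg _) (hn s hs) 2) hC0)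
      simpa using this
    · have hcont : Continuous fun s : ℝ =>
          fderiv ℝ (fderiv ℝ (fderiv ℝ g)) (x + s • e) e e e :=
        (((g3.continuous.comp cc).clm_apply continuous_const).clm_apply
          continuous_const).clm_apply continuous_const
      have := abs_deriv₃_le_of_diff c0 c1 c2 (C := C) hcont.continuousAt fun s hs => by
        have := (hC (s • e) (hn1 s hs)).2.2
        simp only [zero_smul, add_zero, mul_smul]
        exact this.trans (mul_le_mul_of_nonneg_left
          (pow_le_pow_left₀ (norm_nonneg _) (hn s hs) 3) hC0)
      simpa using this
  have s2 : ∀ y a b, fderiv ℝ (fderiv ℝ g) y a b = fderiv ℝ (fderiv ℝ g) y b a := fun y a b =>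
    (hg.contDiffAt.isSymmSndFDerivAt
      (by simp only [minSmoothness_of_isRCLikeNormedField]; exact WithTop.coe_le_coe.2 le_top)) a b
  have s12 : ∀ a b c, fderiv ℝ (fderiv ℝ (fderiv ℝ g)) x a b c
      = fderiv ℝ (fderiv ℝ (fderiv ℝ g)) x b a c := fun a b c =>
    congrArg (fun L => L c) ((g1.contDiffAt.isSymmSndFDerivAt
      (by simp only [minSmoothness_of_isRCLikeNormedField]; exact WithTop.coe_le_coe.2 le_top)) a b)
  have s23 : ∀ a b c, fderiv ℝ (fderiv ℝ (fderiv ℝ g)) x a b c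
      = fderiv ℝ (fderiv ℝ (fderiv ℝ g)) x a c b := fun a b c => by
    have d2e : ∀ b, Differentiable ℝ (fun y => fderiv ℝ (fderiv ℝ g) y b) := fun b =>
      d2.clm_apply (differentiable_const b)
    rw [← fderiv_fderiv_apply (d2 x), ← fderiv_fderiv_apply (d2e b x),
      ← fderiv_fderiv_apply (d2 x), ← fderiv_fderiv_apply (d2e c x)]
    simp only [s2 _ b c]
  refine ⟨(H a ha).1.trans (by linarith), ?_, ?_⟩
  · exact abs_bilinear_le_of_diag _ (s2 x) (fun e he => (H e he).2.1) ha hb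
  · exact abs_trilinear_le_of_diag _ s12 s23 (fun e he => (H e he).2.2) ha hb hc

end

section
set_option maxSynthPendingDepth 4
variable {d : ℕ} {l T K M : ℝ} {v : ℝ → E d → E d} {q u : ℝ → E d → ℝ}

lemma norm_uvec (i : Fin d) : ‖uvec d i‖ = 1 := by simp [uvec]

lemma TransData.exists_pd_bound (h : TransData l T K v q u)
    (hv : ∀ t ∈ Icc 0 T, D3 M (v t)) (hq : ∀ t ∈ Icc 0 T, D3 M (q t)) (h0 : D3 M (u 0)) :
    ∃ C, 0 ≤ C ∧ ∀ t ∈ Icc 0 T, ∀ x, ∀ i j k, |pd i (u t) x| ≤ C ∧ |pd j (pd i (u t)) x| ≤ C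
      ∧ |pd k (pd j (pd i (u t))) x| ≤ C := by
  obtain ⟨C, hC0, hC⟩ := h.exists_diff_bound hv hq h0
  refine ⟨5 * C, by positivity, fun t ht x i j k => ?_⟩
  have hg := (h.su t ht).smooth
  have g1 : ContDiff ℝ (⊤ : ℕ∞) (fderiv ℝ (u t)) := hg.fderiv_right (by simp)
  have g2 : ContDiff ℝ (⊤ : ℕ∞) (fderiv ℝ (fderiv ℝ (u t))) := g1.fderiv_right (by simp)
  have d1 : Differentiable ℝ (fderiv ℝ (u t)) := g1.differentiable (by simp)
  have d2 : Differentiable ℝ (fderiv ℝ (fderiv ℝ (u t))) := g2.differentiable (by simp)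
  have e2 : ∀ y, pd j (pd i (u t)) y
      = fderiv ℝ (fderiv ℝ (u t)) y (uvec d j) (uvec d i) := fun y =>
    fderiv_fderiv_apply (d1 y) _ _
  have e3 : pd k (pd j (pd i (u t))) x
      = fderiv ℝ (fderiv ℝ (fderiv ℝ (u t))) x (uvec d k) (uvec d j) (uvec d i) := by
    rw [show pd j (pd i (u t)) = _ from funext e2]
    have d2e : Differentiable ℝ (fun y => fderiv ℝ (fderiv ℝ (u t)) y (uvec d j)) :=
      d2.clm_apply (differentiable_const _)
    rw [pd, fderiv_fderiv_apply (d2e x), fderiv_fderiv_apply (d2 x)]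
  rw [e2, e3]
  have key := fun a b c ha hb hc =>
    fderiv_bounds_of_diff hg hC0 x (hC t ht x) (a := a) (b := b) (c := c) ha hb hc
  exact ⟨(key (uvec d i) (uvec d i) (uvec d i) (norm_uvec i).le (norm_uvec i).le
      (norm_uvec i).le).1,
    (key (uvec d j) (uvec d i) (uvec d i) (norm_uvec j).le (norm_uvec i).le (norm_uvec i).le).2.1,
    (key (uvec d k) (uvec d j) (uvec d i) (norm_uvec k).le (norm_uvec j).le (norm_uvec i).le).2.2⟩

end

section
variable {d : ℕ} {l T : ℝ}

lemma D3.of_iteratedFDeriv {F G : Type*} [NormedAddCommGroup F] [NormedSpace ℝ F]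
    [NormedAddCommGroup G] [NormedSpace ℝ G] {M : ℝ} {f : F → G} (hf : ContDiff ℝ (⊤ : ℕ∞) f)
    (h : ∀ i ∈ Finset.Icc 1 3, ∀ x, ‖iteratedFDeriv ℝ i f x‖ ≤ M) : D3 M f := by
  have s1 : ContDiff ℝ (⊤ : ℕ∞) (fderiv ℝ f) := hf.fderiv_right (by simp)
  have s2 : ContDiff ℝ (⊤ : ℕ∞) (fderiv ℝ (fderiv ℝ f)) := s1.fderiv_right (by simp)
  refine ⟨hf, fun x => ?_, fun x => ?_, fun x y => ?_⟩
  · simpa using h 1 (by simp) x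
  · have := h 2 (by simp) x
    rwa [← norm_iteratedFDeriv_fderiv, ← norm_iteratedFDeriv_fderiv, norm_iteratedFDeriv_zero]
      at this
  · refine convex_univ.norm_image_sub_le_of_norm_fderiv_le
      (fun z _ => (s2.differentiable (by simp)) z) (fun z _ => ?_) (mem_univ _) (mem_univ _)
    have := h 3 (by simp) z
    rwa [← norm_iteratedFDeriv_fderiv, ← norm_iteratedFDeriv_fderiv, ← norm_iteratedFDeriv_fderiv,
      norm_iteratedFDeriv_zero] at this

lemma D3.of_box {G : Type*} [NormedAddCommGroup G] [NormedSpace ℝ G] {M : ℝ} {f : E d → G}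
    (hl : 0 < l) (hf : ContDiff ℝ (⊤ : ℕ∞) f) (hp : IsPeriodic l f)
    (h : ∀ x ∈ box d l, ∀ i ∈ Finset.Icc 1 3, ‖iteratedFDeriv ℝ i f x‖ ≤ M) : D3 M f :=
  D3.of_iteratedFDeriv hf fun i hi =>
    (hp.iteratedFDeriv i).forall_of_box hl (p := fun y => ‖y‖ ≤ M) fun x hx => h x hx i hi

lemma D3.mono {F G : Type*} [NormedAddCommGroup F] [NormedSpace ℝ F]
    [NormedAddCommGroup G] [NormedSpace ℝ G] {M N : ℝ} {f : F → G} (h : D3 M f) (hMN : M ≤ N) :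
    D3 N f :=
  ⟨h.smooth, fun x => (h.b1 x).trans hMN, fun x => (h.b2 x).trans hMN,
    fun x y => (h.b3 x y).trans (mul_le_mul_of_nonneg_right hMN (norm_nonneg _))⟩

lemma contDiff_diverg {F : E d → E d} (hF : ContDiff ℝ (⊤ : ℕ∞) F) :
    ContDiff ℝ (⊤ : ℕ∞) (fun x => diverg F x) := by
  simp only [diverg_eq (hF.differentiable (by simp) _)]
  exact ContDiff.sum fun i _ => contDiff_pd (contDiff_coord_iff.1 hF i) i

lemma IsPeriodic.diverg {F : E d → E d} (hF : IsPeriodic l F) :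
    IsPeriodic l (fun x => diverg F x) :=
  hF.fderiv.comp_left (fun L => ∑ i, L (uvec d i) i)

/-- The projection of time onto `[0,T]`. -/
def clampT (T t : ℝ) : ℝ := max 0 (min T t)

lemma clampT_mem (hT : 0 < T) (t : ℝ) : clampT T t ∈ Icc 0 T :=
  ⟨le_max_left _ _, max_le hT.le (min_le_left _ _)⟩

lemma clampT_of_mem {t : ℝ} (ht : t ∈ Icc 0 T) : clampT T t = t := by
  rw [clampT, min_eq_right ht.2, max_eq_right ht.1]

lemma continuous_clampT : Continuous (clampT T) := by unfold clampT; fun_prop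

lemma continuous_diverg_of_lip {M : ℝ} {v : ℝ → E d → E d} (hc : Continuous (Function.uncurry v))
    (hv : ∀ t, D3 M (v t)) : Continuous (Function.uncurry fun t x => diverg (v t) x) := by
  have hM : 0 ≤ M := (hv 0).nonneg
  have hcont : ∀ i : Fin d, Continuous fun p : ℝ × E d => fderiv ℝ (v p.1) p.2 (uvec d i) i := by
    intro i
    refine continuous_of_uniform_approx_of_continuous fun U hU => ?_
    obtain ⟨ε, hε, hU⟩ := Metric.mem_uniformity_dist.1 hU
    obtain ⟨s, hs, hsε⟩ : ∃ s : ℝ, 0 < s ∧ M * s < ε :=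
      ⟨ε / (M + 1) , by positivity, by
        rw [mul_div_assoc', div_lt_iff₀ (by positivity)]; nlinarith⟩
    refine ⟨fun p => (v p.1 (p.2 + s • uvec d i) i - v p.1 p.2 i) / s, ?_, fun p => hU ?_⟩
    · have c1 : Continuous fun p : ℝ × E d => v p.1 (p.2 + s • uvec d i) :=
        hc.comp (f := fun p : ℝ × E d => (p.1, p.2 + s • uvec d i)) (by fun_prop)
      have c2 : Continuous fun p : ℝ × E d => v p.1 p.2 := hc
      have pr := (EuclideanSpace.proj i : E d →L[ℝ] ℝ).continuous
      exact ((pr.comp c1).sub (pr.comp c2)).div_const s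
    · have h1 := (hv p.1).taylor₂ p.2 (s • uvec d i)
      have h2 := (PiLp.norm_apply_le (p := 2) (v p.1 (p.2 + s • uvec d i) - v p.1 p.2
        - fderiv ℝ (v p.1) p.2 (s • uvec d i)) i).trans h1
      rw [norm_smul, norm_uvec, mul_one, Real.norm_of_nonneg hs.le, map_smul] at h2
      simp only [PiLp.sub_apply, PiLp.smul_apply, smul_eq_mul, Real.norm_eq_abs] at h2
      rw [dist_comm, Real.dist_eq]
      have : (v p.1 (p.2 + s • uvec d i) i - v p.1 p.2 i) / s - fderiv ℝ (v p.1) p.2 (uvec d i) i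
          = (v p.1 (p.2 + s • uvec d i) i - v p.1 p.2 i
            - s * fderiv ℝ (v p.1) p.2 (uvec d i) i) / s := by field_simp
      rw [this, abs_div, abs_of_pos hs, div_lt_iff₀ hs]
      nlinarith
  exact (continuous_finsetSum Finset.univ fun i _ => hcont i :)

lemma diverg_smul {g : E d → ℝ} {F : E d → E d} {x : E d} (hg : DifferentiableAt ℝ g x)
    (hF : DifferentiableAt ℝ F x) :
    diverg (fun y => g y • F y) x = fderiv ℝ g x (F x) + g x * diverg F x := by
  have e : F x = ∑ i, F x i • uvec d i := by
    ext j
    simp [uvec, Finset.sum_apply, Pi.single_apply]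
  conv_rhs => rw [e]
  simp only [diverg, fderiv_fun_smul hg hF, map_sum, map_smul, Finset.mul_sum,
    ← Finset.sum_add_distrib]
  refine Finset.sum_congr rfl fun i _ => ?_
  simp
  ring

/-- Uniform bounds on the derivatives of the log-density of a transported density. -/
lemma TransportedBy.exists_pd_log_bound {L₀ Lf : ℝ} {f : ℝ → E d → E d}
    {α₀ : E d → ℝ} {ρ : ℝ → E d → ℝ} (hl : 0 < l) (hT : 0 < T)
    (hfs : ∀ t, ContDiff ℝ (⊤ : ℕ∞) (f t)) (hfc : Continuous (Function.uncurry f))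
    (hA1 : RegInit d l L₀ α₀) (hA2 : RegVel d l T Lf f)
    (hρ : TransportedBy d l f α₀ ρ) :
    ∃ C, 0 ≤ C ∧ ∀ t ∈ Icc 0 T, ∀ x, ∀ i j k, |pd i (fun y => Real.log (ρ t y)) x| ≤ C
      ∧ |pd j (pd i (fun y => Real.log (ρ t y))) x| ≤ C
      ∧ |pd k (pd j (pd i (fun y => Real.log (ρ t y)))) x| ≤ C := by
  obtain ⟨hρs, hρ0, hρp, hρi, hρd⟩ := hρ
  set v : ℝ → E d → E d := fun t => f (clampT T t) with hv
  set q : ℝ → E d → ℝ := fun t x => diverg (v t) x with hq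
  have hvc : Continuous (Function.uncurry v) :=
    hfc.comp (f := fun p : ℝ × E d => (clampT T p.1, p.2))
      ((continuous_clampT.comp continuous_fst).prodMk continuous_snd)
  have hmem := clampT_mem hT
  have hvD : ∀ t, D3 Lf (v t) := fun t =>
    D3.of_box hl (hfs _) (hA2 _ (hmem t)).1 fun x hx i hi => ((hA2 _ (hmem t)).2 x hx i
      (by simp only [Finset.mem_Icc] at hi ⊢; omega)).1
  have hqD : ∀ t, D3 Lf (q t) := fun t =>
    D3.of_box hl (contDiff_diverg (hfs _)) (hA2 _ (hmem t)).1.diverg fun x hx i hi =>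
      ((hA2 _ (hmem t)).2 x hx i (by simp only [Finset.mem_Icc] at hi ⊢; omega)).2
  have hu : ∀ t, SP l (fun y => Real.log (ρ t y)) := fun t =>
    SP.log ⟨hρs t, hρp t⟩ (hρ0 t)
  have h0D : D3 L₀ (fun y => Real.log (ρ 0 y)) := by
    refine D3.of_box hl (hu 0).smooth (hu 0).periodic fun x hx i hi => ?_
    rw [hρi]
    exact (hA1 x hx).1 i hi
  obtain ⟨B, hB⟩ := ((isCompact_Icc (a := (0 : ℝ)) (b := T)).prod
    (isCompact_box d l)).exists_bound_of_continuousOn hfc.continuousOn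
  have hLf := (hvD 0).nonneg
  have hbv : ∀ t x, ‖v t x‖ ≤ max B Lf := fun t =>
    (hA2 _ (hmem t)).1.forall_of_box hl (p := fun y => ‖y‖ ≤ max B Lf) fun x hx =>
      (hB (clampT T t, x) ⟨hmem t, hx⟩).trans (le_max_left _ _)
  have hle : ∀ x y : E d, Lf * ‖x - y‖ ≤ max B Lf * ‖x - y‖ := fun x y =>
    mul_le_mul_of_nonneg_right (le_max_right _ _) (norm_nonneg _)
  have hTD : TransData l T (max B Lf) v q (fun t y => Real.log (ρ t y)) := by
    refine ⟨hl, hT, hLf.trans (le_max_right _ _), hvc, hbv,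
      fun t x y => ((hvD t).lip y x).trans (hle x y), continuous_diverg_of_lip hvc hvD,
      fun t x y => ((hqD t).lip y x).trans (hle x y), fun t _ => hu t, fun t ht x => ?_⟩
    refine ((hρd t x).log (hρ0 t x).ne').congr_deriv ?_
    have hd1 : DifferentiableAt ℝ (ρ t) x := (hρs t).differentiable (by simp) x
    have hd2 : DifferentiableAt ℝ (f t) x := (hfs t).differentiable (by simp) x
    rw [diverg_smul hd1 hd2]
    have := (hd1.hasFDerivAt.log (hρ0 t x).ne').fderiv
    simp only [hq, hv, clampT_of_mem ht, this]
    have := (hρ0 t x).ne'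
    simp only [_root_.smul_apply, smul_eq_mul]
    field_simp
    ring
  exact hTD.exists_pd_bound (M := max Lf L₀) (fun t _ => (hvD t).mono (le_max_left _ _))
    (fun t _ => (hqD t).mono (le_max_left _ _)) (h0D.mono (le_max_right _ _))

end

section
variable {d : ℕ} {l T B C : ℝ} {v : ℝ → E d → E d} {V α ρ : ℝ → E d → ℝ}

lemma hasDerivWithinAt_integral_box {F : ℝ → E d → ℝ} {F' : E d → ℝ} {s L : ℝ}
    (hs : s ∈ Ico 0 T) (hc : ∀ t ∈ Icc 0 T, Continuous (F t))
    (hL : ∀ r ∈ Icc s T, ∀ x, |F r x - F s x| ≤ L * (r - s))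
    (hder : ∀ x, HasDerivAt (fun r => F r x) (F' x) s) :
    HasDerivWithinAt (fun r => ∫ x in box d l, F r x) (∫ x in box d l, F' x) (Ioi s) s := by
  have hev : ∀ᶠ r in nhdsWithin s (Ioi s), r ∈ Icc s T := by
    filter_upwards [Ioo_mem_nhdsGT hs.2] with r hr using Ioo_subset_Icc_self hr
  refine hasDerivWithinAt_integral_right (b := fun _ => L)
    (integrableOn_box (hc s ⟨hs.1, hs.2.le⟩)) ?_ (integrableOn_box continuous_const) ?_
    fun x => (hder x).hasDerivWithinAt
  · filter_upwards [hev] with r hr using (hc r ⟨hs.1.trans hr.1, hr.2⟩).aestronglyMeasurable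
  · filter_upwards [hev] with r hr using hL r hr

lemma continuousOn_integral_box {F : ℝ → E d → ℝ} {M : ℝ} (hc : ∀ t ∈ Icc 0 T, Continuous (F t))
    (hM : ∀ t ∈ Icc 0 T, ∀ x, |F t x| ≤ M)
    (ht : ∀ x, ContinuousOn (fun t => F t x) (Icc 0 T)) :
    ContinuousOn (fun t => ∫ x in box d l, F t x) (Icc 0 T) :=
  fun t htm => tendsto_integral_filter_of_dominated_convergence (fun _ => M)
    (by filter_upwards [self_mem_nhdsWithin] with r hr using (hc r hr).aestronglyMeasurable)
    (by filter_upwards [self_mem_nhdsWithin] with r hr using ae_of_all _ fun x => hM r hr x)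
    (integrableOn_box continuous_const) (ae_of_all _ fun x => ht x t htm)

/-- A positive smooth periodic solution of a continuity equation on `[0,T]`, with bounds. -/
structure TPData {d : ℕ} (l T C : ℝ) (v : ℝ → E d → E d) (ρ : ℝ → E d → ℝ) : Prop where
  hl : 0 < l
  hT : 0 < T
  hC : 0 ≤ C
  sv : ∀ t ∈ Icc 0 T, ∀ i, SP l (fun x => v t x i)
  sρ : ∀ t ∈ Icc 0 T, SP l (ρ t)
  pos : ∀ t ∈ Icc 0 T, ∀ x, 0 < ρ t x
  der : ∀ t ∈ Icc 0 T, ∀ x,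
    HasDerivAt (fun τ => ρ τ x) (-∑ i, pd i (fun y => ρ t y * v t y i) x) t
  bv : ∀ t ∈ Icc 0 T, ∀ x i, |v t x i| ≤ C
  bv1 : ∀ t ∈ Icc 0 T, ∀ x, |∑ i, pd i (fun y => v t y i) x| ≤ C
  blog : ∀ t ∈ Icc 0 T, ∀ x i, |pd i (fun y => Real.log (ρ t y)) x| ≤ C

namespace TPData

lemma slog (h : TPData l T C v ρ) {t : ℝ} (ht : t ∈ Icc 0 T) : SP l (fun x => Real.log (ρ t x)) :=
  (h.sρ t ht).log (h.pos t ht)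

lemma pd_eq (h : TPData l T C v ρ) {t : ℝ} (ht : t ∈ Icc 0 T) (i : Fin d) (x : E d) :
    pd i (ρ t) x = ρ t x * pd i (fun y => Real.log (ρ t y)) x := by
  rw [pd_log (h.sρ t ht).differentiable (h.pos t ht)]
  have := (h.pos t ht x).ne'
  field_simp

lemma der_eq (h : TPData l T C v ρ) {t : ℝ} (ht : t ∈ Icc 0 T) (x : E d) :
    -∑ i, pd i (fun y => ρ t y * v t y i) x = ρ t x * (-(∑ i, v t x i *
      pd i (fun y => Real.log (ρ t y)) x) - ∑ i, pd i (fun y => v t y i) x) := by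
  simp only [pd_mul (h.sρ t ht).differentiable (h.sv t ht _).differentiable,
    Finset.sum_add_distrib, h.pd_eq ht]
  rw [mul_sub, mul_neg, Finset.mul_sum, Finset.mul_sum, neg_add]
  congr 2
  refine Finset.sum_congr rfl fun i _ => by ring

lemma hasDerivAt_log (h : TPData l T C v ρ) {t : ℝ} (ht : t ∈ Icc 0 T) (x : E d) :
    HasDerivAt (fun τ => Real.log (ρ τ x)) (-(∑ i, v t x i *
      pd i (fun y => Real.log (ρ t y)) x) - ∑ i, pd i (fun y => v t y i) x) t := by
  refine ((h.der t ht x).log (h.pos t ht x).ne').congr_deriv ?_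
  rw [h.der_eq ht x, mul_div_cancel_left₀ _ (h.pos t ht x).ne']

lemma abs_der_log_le (h : TPData l T C v ρ) {t : ℝ} (ht : t ∈ Icc 0 T) (x : E d) :
    |-(∑ i, v t x i * pd i (fun y => Real.log (ρ t y)) x) - ∑ i, pd i (fun y => v t y i) x|
      ≤ d * (C * C) + C := by
  refine (_root_.abs_sub _ _).trans (add_le_add ?_ (h.bv1 t ht x))
  rw [abs_neg]
  refine (Finset.abs_sum_le_sum_abs _ _).trans ((Finset.sum_le_card_nsmul _ _ (C * C)
    fun i _ => ?_).trans (by simp))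
  rw [abs_mul]
  exact mul_le_mul (h.bv t ht x i) (h.blog t ht x i) (abs_nonneg _) h.hC

lemma abs_log_sub_le (h : TPData l T C v ρ) {s t : ℝ} (hs : s ∈ Icc 0 T) (ht : t ∈ Icc 0 T)
    (x : E d) : |Real.log (ρ t x) - Real.log (ρ s x)| ≤ (d * (C * C) + C) * |t - s| :=
  (convex_Icc 0 T).norm_image_sub_le_of_norm_hasDerivWithin_le
    (fun _ hr => (h.hasDerivAt_log hr x).hasDerivWithinAt) (fun _ hr => h.abs_der_log_le hr x) hs ht

lemma exists_bounds (h : TPData l T C v ρ) : ∃ M L, 0 ≤ M ∧ 0 ≤ L ∧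
    (∀ t ∈ Icc 0 T, ∀ x, |ρ t x| ≤ M ∧ |Real.log (ρ t x)| ≤ M) ∧
    ∀ s ∈ Icc 0 T, ∀ t ∈ Icc 0 T, ∀ x, |ρ t x - ρ s x| ≤ L * |t - s| ∧
      |Real.log (ρ t x) - Real.log (ρ s x)| ≤ L * |t - s| := by
  have h0 : (0 : ℝ) ∈ Icc 0 T := ⟨le_rfl, h.hT.le⟩
  have hC := h.hC
  have hT := h.hT
  set D : ℝ := d * (C * C) + C
  have hD : 0 ≤ D := by positivity
  obtain ⟨A, hA0, hA⟩ := (h.slog h0).exists_bound h.hl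
  have hlog : ∀ t ∈ Icc 0 T, ∀ x, |Real.log (ρ t x)| ≤ A + D * T := fun t ht x => by
    have h1 := h.abs_log_sub_le h0 ht x
    rw [sub_zero, abs_of_nonneg ht.1] at h1
    have h2 := mul_le_mul_of_nonneg_left ht.2 hD
    have h3 := abs_sub_abs_le_abs_sub (Real.log (ρ t x)) (Real.log (ρ 0 x))
    linarith [hA x]
  have hρ : ∀ t ∈ Icc 0 T, ∀ x, |ρ t x| ≤ Real.exp (A + D * T) := fun t ht x => by
    rw [abs_of_pos (h.pos t ht x), ← Real.exp_log (h.pos t ht x)]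
    exact Real.exp_le_exp.2 ((le_abs_self _).trans (hlog t ht x))
  have h1 : A + D * T ≤ Real.exp (A + D * T) := by linarith [Real.add_one_le_exp (A + D * T)]
  refine ⟨Real.exp (A + D * T), Real.exp (A + D * T) * D + D, by positivity, by positivity,
    fun t ht x => ⟨hρ t ht x, (hlog t ht x).trans h1⟩, fun s hs t ht x => ⟨?_, ?_⟩⟩
  · have := (convex_Icc 0 T).norm_image_sub_le_of_norm_hasDerivWithin_le
      (C := Real.exp (A + D * T) * D)
      (fun r hr => (h.der r hr x).hasDerivWithinAt) (fun r hr => by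
        rw [h.der_eq hr, norm_mul]
        exact mul_le_mul (hρ r hr x) (h.abs_der_log_le hr x) (norm_nonneg _) (by positivity)) hs ht
    exact this.trans (mul_le_mul_of_nonneg_right (by linarith) (abs_nonneg _))
  · exact (h.abs_log_sub_le hs ht x).trans
      (mul_le_mul_of_nonneg_right (by linarith [mul_nonneg (Real.exp_pos (A + D * T)).le hD])
        (abs_nonneg _))

end TPData

namespace FPData

lemma exists_bounds (h : FPData l T B V α) (hd : 0 < d) (hT : 0 < T) : ∃ M, 0 ≤ M ∧
    (∀ t ∈ Icc 0 T, ∀ x, |α t x| ≤ M ∧ |(α t x)⁻¹| ≤ M ∧ |Real.log (α t x)| ≤ M) ∧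
    ∀ s ∈ Ico 0 T, ∃ L, 0 ≤ L ∧ ∀ t ∈ Icc s T, ∀ x, |α t x - α s x| ≤ L * (t - s) ∧
      |Real.log (α t x) - Real.log (α s x)| ≤ L * (t - s) := by
  have hruc : ∀ t ∈ Ico 0 T, RUC T α t := fun t ht => h.ruc hd ht
  have h0 : (0 : ℝ) ∈ Icc 0 T := ⟨le_rfl, hT.le⟩
  obtain ⟨m, hm, hlow⟩ := h.exists_lower_bound hruc
  obtain ⟨L, hL, hlip⟩ := h.exists_lip le_rfl hT.le le_rfl hruc
  obtain ⟨A, hA0, hA⟩ := (h.sα 0 h0).exists_bound h.hl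
  have hup : ∀ t ∈ Icc 0 T, ∀ x, |α t x| ≤ A + L * T := fun t ht x => by
    have h1 := hlip t ht x
    have h2 := mul_le_mul_of_nonneg_left ht.2 hL
    have h3 := abs_sub_abs_le_abs_sub (α t x) (α 0 x)
    rw [sub_zero] at h1
    linarith [hA x]
  have hinv : ∀ t ∈ Icc 0 T, ∀ x, |(α t x)⁻¹| ≤ m⁻¹ := fun t ht x => by
    rw [abs_of_pos (inv_pos.2 (h.pos t ht x))]
    exact inv_anti₀ hm (hlow t ht x)
  have hloglip : ∀ a b : ℝ, m ≤ a → m ≤ b → |Real.log a - Real.log b| ≤ m⁻¹ * |a - b| := by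
    have key : ∀ a b : ℝ, m ≤ a → m ≤ b → Real.log a - Real.log b ≤ m⁻¹ * |a - b| := by
      intro a b ha hb
      have hb0 := hm.trans_le hb
      rw [← Real.log_div (hm.trans_le ha).ne' hb0.ne']
      refine (Real.log_le_sub_one_of_pos (div_pos (hm.trans_le ha) hb0)).trans ?_
      have : a / b - 1 = b⁻¹ * (a - b) := by field_simp
      rw [this]
      rcases le_or_gt 0 (a - b) with h0 | h0
      · exact mul_le_mul (inv_anti₀ hm hb) (le_abs_self _) h0 (by positivity)
      · exact (mul_nonpos_of_nonneg_of_nonpos (by positivity) h0.le).trans (by positivity)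
    intro a b ha hb
    rw [abs_le]
    have h1 := key a b ha hb
    have h2 := key b a hb ha
    rw [abs_sub_comm] at h2
    constructor <;> linarith
  refine ⟨A + L * T + m⁻¹ + max |Real.log m| (A + L * T), by positivity,
    fun t ht x => ⟨?_, ?_, ?_⟩, fun s hs => ?_⟩
  · refine (hup t ht x).trans ?_
    have : 0 ≤ m⁻¹ := by positivity
    have : 0 ≤ max |Real.log m| (A + L * T) := (abs_nonneg _).trans (le_max_left _ _)
    linarith
  · refine (hinv t ht x).trans ?_
    have : 0 ≤ A + L * T := by positivity
    have : 0 ≤ max |Real.log m| (A + L * T) := (abs_nonneg _).trans (le_max_left _ _)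
    linarith
  · have h1 : 0 ≤ A + L * T := by positivity
    have h2 : 0 ≤ m⁻¹ := by positivity
    have h3 : |Real.log (α t x)| ≤ max |Real.log m| (A + L * T) := by
      rw [abs_le]
      constructor
      · have := Real.log_le_log hm (hlow t ht x)
        linarith [neg_abs_le (Real.log m), le_max_left |Real.log m| (A + L * T)]
      · have := Real.log_le_sub_one_of_pos (h.pos t ht x)
        linarith [le_abs_self (α t x), hup t ht x, le_max_right |Real.log m| (A + L * T)]
    linarith
  · obtain ⟨L', hL', hlip'⟩ := h.exists_lip hs.1 hs.2.le le_rfl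
      (fun r hr => hruc r ⟨hs.1.trans hr.1, hr.2⟩)
    have hmi : 0 ≤ m⁻¹ := by positivity
    refine ⟨L' + m⁻¹ * L', by positivity, fun t ht x => ?_⟩
    have hts : 0 ≤ t - s := sub_nonneg.2 ht.1
    have h1 := hlip' t ht x
    refine ⟨h1.trans (mul_le_mul_of_nonneg_right (by nlinarith) hts), ?_⟩
    refine (hloglip _ _ (hlow t ⟨hs.1.trans ht.1, ht.2⟩ x) (hlow s ⟨hs.1, hs.2.le⟩ x)).trans ?_
    refine (mul_le_mul_of_nonneg_left h1 hmi).trans ?_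
    rw [← mul_assoc]
    exact mul_le_mul_of_nonneg_right (by linarith) hts

end FPData
end

section
variable {d : ℕ} {l T B C : ℝ} {v : ℝ → E d → E d} {V α ρ : ℝ → E d → ℝ}

lemma SP.exp {g : E d → ℝ} (hg : SP l g) : SP l (fun x => Real.exp (g x)) :=
  ⟨hg.smooth.exp, hg.periodic.comp_left _⟩

lemma pd_exp {g : E d → ℝ} (hg : Differentiable ℝ g) (i : Fin d) (x : E d) :
    pd i (fun y => Real.exp (g y)) x = Real.exp (g x) * pd i g x := by
  rw [pd, (hg x).hasFDerivAt.exp.fderiv]; simp [pd]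

lemma integral_sum_pd_mul (hl : 0 < l) {G : Fin d → E d → ℝ} {r : E d → ℝ} (hG : ∀ i, SP l (G i))
    (hr : SP l r) :
    ∫ x in box d l, (∑ i, pd i (G i) x) * r x = -∫ x in box d l, ∑ i, G i x * pd i r x := by
  simp only [Finset.sum_mul]
  rw [integral_finsetSum _ fun i _ => integrableOn_box (((hG i).pd i).mul hr).continuous,
    integral_finsetSum _ fun i _ => integrableOn_box ((hG i).mul (hr.pd i)).continuous,
    ← Finset.sum_neg_distrib]
  exact Finset.sum_congr rfl fun i _ => integral_pd_mul hl (hG i) hr i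

lemma fpOp_eq_sum {W g : E d → ℝ} (hW : SP l W) (hg : SP l g) (x : E d) :
    fpOp W g x = ∑ i, pd i (fun y => pd i g y + g y * pd i W y) x := by
  simp only [pd_add (hg.pd _).differentiable (hg.mul (hW.pd _)).differentiable,
    pd_mul hg.differentiable (hW.pd _).differentiable, fpOp, Finset.sum_add_distrib, Finset.sum_mul]
  have : ∀ i, pd i W x * pd i g x = pd i g x * pd i W x := fun i => mul_comm _ _
  have h2 : ∀ i, pd i (pd i W) x * g x = g x * pd i (pd i W) x := fun i => mul_comm _ _
  simp only [this, h2]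
  ring

/-- The components of the self-consistency residual. -/
def resid (v : ℝ → E d → E d) (V ρ : ℝ → E d → ℝ) (i : Fin d) (t : ℝ) (x : E d) : ℝ :=
  v t x i + pd i (V t) x + pd i (fun y => Real.log (ρ t y)) x

/-- The derivative of the relative entropy is controlled by the residual. -/
lemma integral_entropy_deriv_le (hρ : TPData l T C v ρ) (hα : FPData l T B V α) {t : ℝ}
    (ht : t ∈ Icc 0 T) :
    ∫ x in box d l, ((-∑ i, pd i (fun y => ρ t y * v t y i) x)
        * (Real.log (ρ t x) - Real.log (α t x))
      + ρ t x * ((-∑ i, pd i (fun y => ρ t y * v t y i) x) / ρ t x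
        - fpOp (V t) (α t) x / α t x))
      ≤ ∫ x in box d l, 1 / 4 * ((∑ i, resid v V ρ i t x ^ 2) * ρ t x) := by
  have hl := hρ.hl
  have sρ := hρ.sρ t ht
  have sα := hα.sα t ht
  have sV := hα.sV t ht
  have pρ := hρ.pos t ht
  have pα := hα.pos t ht
  have su := hρ.slog ht
  have sw := sα.log pα
  have sz := su.sub sw
  have sv := hρ.sv t ht
  have sr := sz.exp
  have sG : ∀ i, SP l (fun y => pd i (α t) y + α t y * pd i (V t) y) := fun i =>
    (sα.pd i).add (sα.mul (sV.pd i))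
  have srv : ∀ i, SP l (fun y => ρ t y * v t y i) := fun i => sρ.mul (sv i)
  have I1 := integral_sum_pd_mul hl srv sz
  have I2 := integral_sum_pd_mul hl srv (SP.const (l := l) (d := d) 1)
  have I3 := integral_sum_pd_mul hl sG sr
  simp only [pd_const, mul_zero, Finset.sum_const_zero, integral_zero, neg_zero, mul_one] at I2
  have c1 : SP l fun x => (∑ i, pd i (fun y => ρ t y * v t y i) x)
      * (Real.log (ρ t x) - Real.log (α t x)) := (SP.sum fun i _ => (srv i).pd i).mul sz
  have c2 : SP l fun x => ∑ i, pd i (fun y => ρ t y * v t y i) x := SP.sum fun i _ => (srv i).pd i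
  have c3 : SP l fun x => (∑ i, pd i (fun y => pd i (α t) y + α t y * pd i (V t) y) x)
      * Real.exp (Real.log (ρ t x) - Real.log (α t x)) := (SP.sum fun i _ => (sG i).pd i).mul sr
  have d1 : SP l fun x => ∑ i, ρ t x * v t x i
      * pd i (fun y => Real.log (ρ t y) - Real.log (α t y)) x :=
    SP.sum fun i _ => (srv i).mul (sz.pd i)
  have d3 : SP l fun x => ∑ i, (pd i (α t) x + α t x * pd i (V t) x)
      * pd i (fun y => Real.exp (Real.log (ρ t y) - Real.log (α t y))) x :=
    SP.sum fun i _ => (sG i).mul (sr.pd i)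
  have hrr : ∀ x, Real.exp (Real.log (ρ t x) - Real.log (α t x)) = ρ t x / α t x := fun x => by
    rw [Real.exp_sub, Real.exp_log (pρ x), Real.exp_log (pα x)]
  have e1 : ∀ x, ((-∑ i, pd i (fun y => ρ t y * v t y i) x)
        * (Real.log (ρ t x) - Real.log (α t x))
      + ρ t x * ((-∑ i, pd i (fun y => ρ t y * v t y i) x) / ρ t x
        - fpOp (V t) (α t) x / α t x))
      = -((∑ i, pd i (fun y => ρ t y * v t y i) x) * (Real.log (ρ t x) - Real.log (α t x)))
        - (∑ i, pd i (fun y => ρ t y * v t y i) x)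
        - (∑ i, pd i (fun y => pd i (α t) y + α t y * pd i (V t) y) x)
          * Real.exp (Real.log (ρ t x) - Real.log (α t x)) := fun x => by
    rw [hrr, ← fpOp_eq_sum sV sα]
    have := (pρ x).ne'
    have := (pα x).ne'
    field_simp
    ring
  simp only [e1]
  rw [integral_sub (f := fun x => -((∑ i, pd i (fun y => ρ t y * v t y i) x)
      * (Real.log (ρ t x) - Real.log (α t x))) - (∑ i, pd i (fun y => ρ t y * v t y i) x))
      (integrableOn_box (c1.neg.sub c2).continuous) (integrableOn_box c3.continuous),
    integral_sub (f := fun x => -((∑ i, pd i (fun y => ρ t y * v t y i) x)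
      * (Real.log (ρ t x) - Real.log (α t x))))
      (integrableOn_box c1.neg.continuous) (integrableOn_box c2.continuous),
    integral_neg, I1, I2, I3, neg_neg, sub_zero, sub_neg_eq_add,
    ← integral_add (integrableOn_box d1.continuous) (integrableOn_box d3.continuous)]
  have sδ : ∀ i, SP l (resid v V ρ i t) := fun i => ((sv i).add (sV.pd i)).add (su.pd i)
  have s2 : SP l fun x => 1 / 4 * ((∑ i, resid v V ρ i t x ^ 2) * ρ t x) := by
    simp only [pow_two]
    exact (SP.const _).mul ((SP.sum fun i _ => (sδ i).mul (sδ i)).mul sρ)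
  refine setIntegral_mono (integrableOn_box (d1.add d3).continuous) (integrableOn_box s2.continuous)
    fun x => ?_
  simp only [pd_exp sz.differentiable, pd_sub su.differentiable sw.differentiable]
  rw [hrr]
  rw [← Finset.sum_add_distrib, Finset.sum_mul, Finset.mul_sum]
  refine Finset.sum_le_sum fun i _ => ?_
  have ew : pd i (α t) x = α t x * pd i (fun y => Real.log (α t y)) x := by
    rw [pd_log sα.differentiable pα]
    have := (pα x).ne'
    field_simp
  rw [ew, resid]
  have hα0 := (pα x).ne'
  have : (α t x * pd i (fun y => Real.log (α t y)) x + α t x * pd i (V t) x) * (ρ t x / α t x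
      * (pd i (fun y => Real.log (ρ t y)) x - pd i (fun y => Real.log (α t y)) x))
      = ρ t x * ((pd i (fun y => Real.log (α t y)) x + pd i (V t) x)
      * (pd i (fun y => Real.log (ρ t y)) x - pd i (fun y => Real.log (α t y)) x)) := by
    field_simp
  rw [this]
  nlinarith [mul_nonneg (pρ x).le (sq_nonneg (v t x i + pd i (V t) x
    + pd i (fun y => Real.log (ρ t y)) x - 2 * (pd i (fun y => Real.log (ρ t y)) x
    - pd i (fun y => Real.log (α t y)) x)))]

lemma abs_mul_sub_mul_le {a b a' b' M L r : ℝ} (ha : |a| ≤ M) (hb' : |b'| ≤ M)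
    (h1 : |a - a'| ≤ L * r) (h2 : |b - b'| ≤ L * r) : |a * b - a' * b'| ≤ 2 * M * L * r := by
  have e : a * b - a' * b' = a * (b - b') + (a - a') * b' := by ring
  rw [e]
  refine (abs_add_le _ _).trans ?_
  rw [abs_mul, abs_mul]
  have hM : 0 ≤ M := (abs_nonneg _).trans ha
  have k1 := mul_le_mul ha h2 (abs_nonneg _) hM
  have k2 := mul_le_mul h1 hb' (abs_nonneg _) ((abs_nonneg _).trans h1)
  linarith

/-- Entropy estimate: the relative entropy is controlled by the time-integrated residual. -/
lemma entropy_le (hd : 0 < d) (hρ : TPData l T C v ρ) (hα : FPData l T B V α)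
    (h0 : ∀ x, ρ 0 x = α 0 x) {φ : ℝ → ℝ} (hφ : IntegrableOn φ (Icc 0 T))
    (hle : ∀ t ∈ Icc 0 T, ∫ x in box d l, (∑ i, resid v V ρ i t x ^ 2) * ρ t x ≤ φ t)
    {t : ℝ} (ht : t ∈ Icc 0 T) :
    ∫ x in box d l, ρ t x * (Real.log (ρ t x) - Real.log (α t x))
      ≤ 1 / 4 * ∫ s in (0 : ℝ)..t, φ s := by
  obtain ⟨M, L, hM, hL, hbd, hlip⟩ := hρ.exists_bounds
  obtain ⟨N, hN, hbdα, hlipα⟩ := hα.exists_bounds hd hρ.hT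
  set F : ℝ → E d → ℝ := fun t x => ρ t x * (Real.log (ρ t x) - Real.log (α t x)) with hF
  have hFc : ∀ t ∈ Icc 0 T, Continuous (F t) := fun t ht =>
    ((hρ.sρ t ht).mul ((hρ.slog ht).sub ((hα.sα t ht).log (hα.pos t ht)))).continuous
  have hder : ∀ t ∈ Icc 0 T, ∀ x, HasDerivAt (fun r => F r x)
      ((-∑ i, pd i (fun y => ρ t y * v t y i) x)
        * (Real.log (ρ t x) - Real.log (α t x))
      + ρ t x * ((-∑ i, pd i (fun y => ρ t y * v t y i) x) / ρ t x
        - fpOp (V t) (α t) x / α t x)) t := fun t ht x =>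
    (hρ.der t ht x).mul (((hρ.der t ht x).log (hρ.pos t ht x).ne').sub
      ((hα.der t ht x).log (hα.pos t ht x).ne'))
  have hzb : ∀ t ∈ Icc 0 T, ∀ x, |Real.log (ρ t x) - Real.log (α t x)| ≤ M + N := fun t ht x =>
    (_root_.abs_sub _ _).trans (add_le_add (hbd t ht x).2 (hbdα t ht x).2.2)
  have hcont : ContinuousOn (fun t => ∫ x in box d l, F t x) (Icc 0 T) :=
    continuousOn_integral_box (M := M * (M + N)) hFc (fun t ht x => by
      rw [hF, abs_mul]
      exact mul_le_mul (hbd t ht x).1 (hzb t ht x) (abs_nonneg _) hM)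
      fun x t ht => (hder t ht x).continuousAt.continuousWithinAt
  have hrd : ∀ s ∈ Ico 0 T, HasDerivWithinAt (fun t => ∫ x in box d l, F t x)
      (∫ x in box d l, ((-∑ i, pd i (fun y => ρ s y * v s y i) x)
        * (Real.log (ρ s x) - Real.log (α s x))
      + ρ s x * ((-∑ i, pd i (fun y => ρ s y * v s y i) x) / ρ s x
        - fpOp (V s) (α s) x / α s x))) (Ioi s) s := fun s hs => by
    obtain ⟨L', hL', hlip'⟩ := hlipα s hs
    have hs' : s ∈ Icc 0 T := ⟨hs.1, hs.2.le⟩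
    refine hasDerivWithinAt_integral_box (L := 2 * (M + N) * (L + L')) hs hFc (fun r hr x => ?_)
      fun x => hder s hs' x
    have hr' : r ∈ Icc 0 T := ⟨hs.1.trans hr.1, hr.2⟩
    have hrs : 0 ≤ r - s := sub_nonneg.2 hr.1
    have h1 := hlip s hs' r hr' x
    rw [abs_of_nonneg hrs] at h1
    have h2 := (hlip' r hr x).2
    refine abs_mul_sub_mul_le ((hbd r hr' x).1.trans (by linarith)) (hzb s hs' x)
      (h1.1.trans (mul_le_mul_of_nonneg_right (by linarith) hrs)) ?_
    have e : Real.log (ρ r x) - Real.log (α r x) - (Real.log (ρ s x) - Real.log (α s x))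
      = (Real.log (ρ r x) - Real.log (ρ s x)) - (Real.log (α r x) - Real.log (α s x)) := by ring
    rw [e, add_mul]
    exact (_root_.abs_sub _ _).trans (add_le_add h1.2 h2)
  have hsub : Icc 0 t ⊆ Icc 0 T := Icc_subset_Icc_right ht.2
  have := intervalIntegral.sub_le_integral_of_hasDeriv_right_of_le_Ico (φ := fun s => 1 / 4 * φ s)
    ht.1 (hcont.mono hsub) (fun s hs => hrd s ⟨hs.1, hs.2.trans_le ht.2⟩)
    ((hφ.mono_set hsub).const_mul _) (fun s hs => by
      have hs' : s ∈ Icc 0 T := ⟨hs.1, hs.2.le.trans ht.2⟩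
      refine (integral_entropy_deriv_le hρ hα hs').trans ?_
      rw [integral_const_mul]
      exact mul_le_mul_of_nonneg_left (hle s hs') (by norm_num))
  have e0 : ∫ x in box d l, F 0 x = 0 := by simp [hF, h0]
  rw [e0, sub_zero, intervalIntegral.integral_const_mul] at this
  exact this

end

section
variable {d : ℕ} {l T B C : ℝ} {v : ℝ → E d → E d} {V α ρ : ℝ → E d → ℝ}

lemma integral_box_eq_of_deriv {F F' : ℝ → E d → ℝ} {M : ℝ}
    (hc : ∀ t ∈ Icc 0 T, Continuous (F t)) (hM : ∀ t ∈ Icc 0 T, ∀ x, |F t x| ≤ M)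
    (hL : ∀ s ∈ Ico 0 T, ∃ L, ∀ r ∈ Icc s T, ∀ x, |F r x - F s x| ≤ L * (r - s))
    (hder : ∀ t ∈ Icc 0 T, ∀ x, HasDerivAt (fun r => F r x) (F' t x) t)
    (h0 : ∀ t ∈ Icc 0 T, ∫ x in box d l, F' t x = 0) {t : ℝ} (ht : t ∈ Icc 0 T) :
    ∫ x in box d l, F t x = ∫ x in box d l, F 0 x := by
  refine constant_of_has_deriv_right_zero (f := fun t => ∫ x in box d l, F t x)
    (continuousOn_integral_box hc hM fun x t ht => (hder t ht x).continuousAt.continuousWithinAt)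
    (fun s hs => ?_) t ht
  have hs' : s ∈ Icc 0 T := ⟨hs.1, hs.2.le⟩
  obtain ⟨L, hL⟩ := hL s hs
  rw [← hasDerivWithinAt_Ioi_iff_Ici, ← h0 s hs']
  exact hasDerivWithinAt_integral_box hs hc hL (hder s hs')

lemma TPData.integral_eq (h : TPData l T C v ρ) {t : ℝ} (ht : t ∈ Icc 0 T) :
    ∫ x in box d l, ρ t x = ∫ x in box d l, ρ 0 x := by
  obtain ⟨M, L, hM, hL, hbd, hlip⟩ := h.exists_bounds
  refine integral_box_eq_of_deriv (fun t ht => (h.sρ t ht).continuous)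
    (fun t ht x => (hbd t ht x).1) (fun s hs => ⟨L, fun r hr x => ?_⟩) h.der (fun t ht => ?_) ht
  · have := (hlip s ⟨hs.1, hs.2.le⟩ r ⟨hs.1.trans hr.1, hr.2⟩ x).1
    rwa [abs_of_nonneg (sub_nonneg.2 hr.1)] at this
  · have s := fun i => (h.sρ t ht).mul (h.sv t ht i)
    rw [integral_neg, integral_finsetSum _ fun i _ => integrableOn_box ((s i).pd i).continuous]
    simp only [integral_pd_eq_zero h.hl (s _), Finset.sum_const_zero, neg_zero]

lemma FPData.integral_eq (h : FPData l T B V α) (hd : 0 < d) (hT : 0 < T) {t : ℝ}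
    (ht : t ∈ Icc 0 T) : ∫ x in box d l, α t x = ∫ x in box d l, α 0 x := by
  obtain ⟨N, hN, hbd, hlip⟩ := h.exists_bounds hd hT
  refine integral_box_eq_of_deriv (fun t ht => (h.sα t ht).continuous)
    (fun t ht x => (hbd t ht x).1) (fun s hs => ?_) h.der (fun t ht => ?_) ht
  · obtain ⟨L, -, hL⟩ := hlip s hs
    exact ⟨L, fun r hr x => (hL r hr x).1⟩
  · have s := fun i => ((h.sα t ht).pd i).add ((h.sα t ht).mul ((h.sV t ht).pd i))
    simp only [fpOp_eq_sum (h.sV t ht) (h.sα t ht)]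
    rw [integral_finsetSum _ fun i _ => integrableOn_box ((s i).pd i).continuous]
    simp only [integral_pd_eq_zero h.hl (s _), Finset.sum_const_zero]

lemma abs_sub_le_entropy {a b ε : ℝ} (ha : 0 < a) (hb : 0 < b) (hε : 0 < ε) :
    |a - b| ≤ 1 / ε * (a * (Real.log a - Real.log b) - a + b) + ε / 2 * (a + b) := by
  obtain ⟨p, hp, rfl⟩ : ∃ p, 0 < p ∧ a = p ^ 2 := ⟨√a, Real.sqrt_pos.2 ha, (Real.sq_sqrt ha.le).symm⟩
  obtain ⟨q, hq, rfl⟩ : ∃ q, 0 < q ∧ b = q ^ 2 := ⟨√b, Real.sqrt_pos.2 hb, (Real.sq_sqrt hb.le).symm⟩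
  have h1 : (p - q) ^ 2 ≤ p ^ 2 * (Real.log (p ^ 2) - Real.log (q ^ 2)) - p ^ 2 + q ^ 2 := by
    have h := Real.log_le_sub_one_of_pos (div_pos hq hp)
    rw [Real.log_div hq.ne' hp.ne'] at h
    rw [Real.log_pow, Real.log_pow]
    have h2 := mul_le_mul_of_nonneg_left h (by positivity : 0 ≤ 2 * p ^ 2)
    have h3 : 2 * p ^ 2 * (q / p - 1) = 2 * p * q - 2 * p ^ 2 := by field_simp
    push_cast
    nlinarith
  have h2 : |p ^ 2 - q ^ 2| = |p - q| * (p + q) := by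
    rw [sq_sub_sq, abs_mul, abs_of_pos (by positivity : 0 < p + q)]; ring
  have h3 : |p - q| * (p + q) ≤ 1 / ε * (p - q) ^ 2 + ε / 2 * (p ^ 2 + q ^ 2) := by
    have e : 1 / ε * (p - q) ^ 2 + ε / 2 * (p ^ 2 + q ^ 2) - |p - q| * (p + q)
        = 1 / ε * ((|p - q| - ε / 2 * (p + q)) ^ 2 + ε ^ 2 / 4 * (p - q) ^ 2) := by
      rw [← sq_abs (p - q)]
      have : |p - q| ^ 2 = (p - q) ^ 2 := sq_abs _
      field_simp
      linear_combination (-4 * ε ^ 2) * this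
    have : 0 ≤ 1 / ε * ((|p - q| - ε / 2 * (p + q)) ^ 2 + ε ^ 2 / 4 * (p - q) ^ 2) := by positivity
    linarith
  rw [h2]
  refine h3.trans ?_
  have := mul_le_mul_of_nonneg_left h1 (by positivity : 0 ≤ 1 / ε)
  linarith

/-- Quantitative `L¹` estimate between the transported and the Fokker–Planck densities. -/
lemma integral_abs_sub_le (hd : 0 < d) (hρ : TPData l T C v ρ) (hα : FPData l T B V α)
    (h0 : ∀ x, ρ 0 x = α 0 x) (h1 : ∫ x in box d l, α 0 x = 1) {φ : ℝ → ℝ}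
    (hφ : IntegrableOn φ (Icc 0 T))
    (hle : ∀ t ∈ Icc 0 T, ∫ x in box d l, (∑ i, resid v V ρ i t x ^ 2) * ρ t x ≤ φ t)
    {t ε : ℝ} (ht : t ∈ Icc 0 T) (hε : 0 < ε) :
    ∫ x in box d l, |ρ t x - α t x| ≤ 1 / ε * (1 / 4 * ∫ s in (0 : ℝ)..t, φ s) + ε := by
  have m1 : ∫ x in box d l, ρ t x = 1 := by
    rw [hρ.integral_eq ht, ← h1]; simp only [h0]
  have m2 : ∫ x in box d l, α t x = 1 := by rw [hα.integral_eq hd hρ.hT ht, h1]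
  have sρ := hρ.sρ t ht
  have sα := hα.sα t ht
  have sF := sρ.mul ((hρ.slog ht).sub (sα.log (hα.pos t ht)))
  have key : ∫ x in box d l, |ρ t x - α t x| ≤ ∫ x in box d l,
      (1 / ε * (ρ t x * (Real.log (ρ t x) - Real.log (α t x)) - ρ t x + α t x)
        + ε / 2 * (ρ t x + α t x)) :=
    setIntegral_mono (integrableOn_box (sρ.sub sα).continuous.abs)
      (integrableOn_box (((SP.const _).mul ((sF.sub sρ).add sα)).add
        ((SP.const _).mul (sρ.add sα))).continuous)
      fun x => abs_sub_le_entropy (hρ.pos t ht x) (hα.pos t ht x) hε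
  refine key.trans ?_
  rw [integral_add (f := fun x => 1 / ε * (ρ t x * (Real.log (ρ t x) - Real.log (α t x))
      - ρ t x + α t x)) (integrableOn_box ((SP.const _).mul ((sF.sub sρ).add sα)).continuous)
      (integrableOn_box ((SP.const _).mul (sρ.add sα)).continuous),
    integral_const_mul, integral_const_mul,
    integral_add (f := fun x => ρ t x * (Real.log (ρ t x) - Real.log (α t x)) - ρ t x)
      (integrableOn_box (sF.sub sρ).continuous) (integrableOn_box sα.continuous),
    integral_sub (f := fun x => ρ t x * (Real.log (ρ t x) - Real.log (α t x)))
      (integrableOn_box sF.continuous) (integrableOn_box sρ.continuous),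
    integral_add (integrableOn_box sρ.continuous) (integrableOn_box sα.continuous), m1, m2]
  have := mul_le_mul_of_nonneg_left (entropy_le hd hρ hα h0 hφ hle ht)
    (by positivity : 0 ≤ 1 / ε)
  linarith

end

section
variable {d : ℕ} {l : ℝ}

lemma W2sq_add_le {ν₀ ν₁ ν₂ : Measure (E d)} [IsFiniteMeasure ν₀] [IsFiniteMeasure ν₁]
    [IsFiniteMeasure ν₂] (hm : ν₁ univ = ν₂ univ) {D : ℝ≥0∞} {s : Set (E d)}
    (h₁ : ∀ᵐ x ∂ν₁, x ∈ s) (h₂ : ∀ᵐ x ∂ν₂, x ∈ s)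
    (hD : ∀ x ∈ s, ∀ y ∈ s, ENNReal.ofReal (‖x - y‖ ^ 2) ≤ D) :
    W2sq (ν₀ + ν₁) (ν₀ + ν₂) ≤ D * ν₁ univ := by
  set M : ℝ≥0∞ := ν₁ univ with hM
  have hMt : M ≠ ⊤ := measure_ne_top _ _
  have hc : ∀ ν : Measure (E d), ν univ = M → (M⁻¹ * M) • ν = ν := fun ν hν => by
    rcases eq_or_ne M 0 with h0 | h0
    · rw [h0, Measure.measure_univ_eq_zero] at hν
      rw [hν, smul_zero]
    · rw [ENNReal.inv_mul_cancel h0 hMt, one_smul]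
  have hdiag : Measurable fun x : E d => (x, x) := measurable_id.prodMk measurable_id
  set π : Measure (E d × E d) := ν₀.map (fun x => (x, x)) + M⁻¹ • ν₁.prod ν₂ with hπ
  have hf : π.map Prod.fst = ν₀ + ν₁ := by
    rw [hπ, Measure.map_add _ _ measurable_fst, Measure.map_map measurable_fst hdiag,
      Measure.map_smul, Measure.map_fst_prod, ← hm, smul_smul, hc ν₁ rfl]
    congr 1
    exact Measure.map_id
  have hs : π.map Prod.snd = ν₀ + ν₂ := by
    rw [hπ, Measure.map_add _ _ measurable_snd, Measure.map_map measurable_snd hdiag,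
      Measure.map_smul, Measure.map_snd_prod, smul_smul, hc ν₂ hm.symm]
    congr 1
    exact Measure.map_id
  have hcost : Measurable fun q : E d × E d => ENNReal.ofReal (‖q.1 - q.2‖ ^ 2) := by fun_prop
  refine (iInf₂_le π ⟨hf, hs⟩).trans ?_
  rw [hπ, lintegral_add_measure, lintegral_map hcost hdiag, lintegral_smul_measure,
    lintegral_prod _ hcost.aemeasurable]
  simp only [sub_self, norm_zero, ne_eq, OfNat.ofNat_ne_zero, not_false_eq_true, zero_pow,
    ENNReal.ofReal_zero, lintegral_const, zero_mul, zero_add, smul_eq_mul]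
  have : ∫⁻ x, ∫⁻ y, ENNReal.ofReal (‖x - y‖ ^ 2) ∂ν₂ ∂ν₁ ≤ D * M * M := by
    calc _ ≤ ∫⁻ _, D * M ∂ν₁ := by
          refine lintegral_mono_ae ?_
          filter_upwards [h₁] with x hx
          calc _ ≤ ∫⁻ _, D ∂ν₂ := by
                refine lintegral_mono_ae ?_
                filter_upwards [h₂] with y hy using hD x hx y hy
            _ = D * M := by rw [lintegral_const, ← hm]
      _ = D * M * M := by rw [lintegral_const]
  refine (mul_le_mul_right this _).trans ?_
  rcases eq_or_ne M 0 with h0 | h0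
  · simp [h0]
  · rw [mul_comm, mul_assoc, ENNReal.mul_inv_cancel h0 hMt, mul_one]

lemma W2sq_densM_le {g₁ g₂ : E d → ℝ} (hc₁ : Continuous g₁) (hc₂ : Continuous g₂)
    (h₁ : ∀ x, 0 ≤ g₁ x) (h₂ : ∀ x, 0 ≤ g₂ x)
    (hm : ∫ x in box d l, g₁ x = ∫ x in box d l, g₂ x) {D : ℝ≥0∞}
    (hD : ∀ x ∈ box d l, ∀ y ∈ box d l, ENNReal.ofReal (‖x - y‖ ^ 2) ≤ D) :
    W2sq (densM l g₁) (densM l g₂) ≤ D * ENNReal.ofReal (∫ x in box d l, |g₁ x - g₂ x|) := by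
  set μ : Measure (E d) := volume.restrict (box d l) with hμ
  have hfin : ∀ {h : E d → ℝ}, Continuous h →
      IsFiniteMeasure (μ.withDensity fun x => ENNReal.ofReal (h x)) := fun hh =>
    isFiniteMeasure_withDensity_ofReal (integrableOn_box hh).2
  have hms : ∀ {h : E d → ℝ}, Continuous h → Measurable fun x => ENNReal.ofReal (h x) :=
    fun hh => hh.measurable.ennreal_ofReal
  set m : E d → ℝ := fun x => min (g₁ x) (g₂ x) with hmdef
  have cm : Continuous m := hc₁.min hc₂
  have hm0 : ∀ x, 0 ≤ m x := fun x => le_min (h₁ x) (h₂ x)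
  have hdec : ∀ {g : E d → ℝ}, Continuous g → (∀ x, m x ≤ g x) →
      densM l g = μ.withDensity (fun x => ENNReal.ofReal (m x))
        + μ.withDensity (fun x => ENNReal.ofReal (g x - m x)) := fun {g} hg hle => by
    rw [← withDensity_add_left (hms cm), densM]
    congr 1
    ext x
    rw [Pi.add_apply, ← ENNReal.ofReal_add (hm0 x) (sub_nonneg.2 (hle x)), add_sub_cancel]
  have e₁ := hdec hc₁ fun x => min_le_left _ _
  have e₂ := hdec hc₂ fun x => min_le_right _ _
  have i0 := hfin cm
  have k₁ : Continuous fun x => g₁ x - m x := hc₁.sub cm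
  have k₂ : Continuous fun x => g₂ x - m x := hc₂.sub cm
  have i1 := hfin k₁
  have i2 := hfin k₂
  have hmass : ∀ {g : E d → ℝ}, Continuous g → (∀ x, 0 ≤ g x) →
      μ.withDensity (fun x => ENNReal.ofReal (g x)) univ
        = ENNReal.ofReal (∫ x in box d l, g x) := fun {g} hg h0 => by
    rw [withDensity_apply _ MeasurableSet.univ, Measure.restrict_univ,
      ofReal_integral_eq_lintegral_ofReal (integrableOn_box hg) (ae_of_all _ h0)]
  have hs : ∀ (g : E d → ℝ≥0∞), ∀ᵐ x ∂(μ.withDensity g), x ∈ box d l := fun g =>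
    (withDensity_absolutelyContinuous μ g).ae_le (ae_restrict_mem (measurableSet_box d l))
  rw [e₁, e₂]
  refine (W2sq_add_le ?_ (hs _) (hs _) hD).trans ?_
  · rw [hmass k₁ fun x => sub_nonneg.2 (min_le_left _ _),
      hmass k₂ fun x => sub_nonneg.2 (min_le_right _ _),
      integral_sub (integrableOn_box hc₁) (integrableOn_box cm),
      integral_sub (integrableOn_box hc₂) (integrableOn_box cm), hm]
  · refine mul_le_mul_right ?_ _
    rw [hmass k₁ fun x => sub_nonneg.2 (min_le_left _ _)]
    refine ENNReal.ofReal_le_ofReal (setIntegral_mono (integrableOn_box k₁)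
      (integrableOn_box (hc₁.sub hc₂).abs) fun x => ?_)
    simp only [hmdef]
    rcases min_cases (g₁ x) (g₂ x) with h | h
    · rw [h.1, sub_self]; exact abs_nonneg _
    · rw [h.1]; exact le_abs_self _

end

section
variable {d : ℕ} {l T : ℝ}

lemma norm_iteratedFDeriv_pd_le {g : E d → ℝ} (hg : ContDiff ℝ (⊤ : ℕ∞) g) (k : ℕ) (i : Fin d)
    (x : E d) : ‖iteratedFDeriv ℝ k (pd i g) x‖ ≤ ‖iteratedFDeriv ℝ (k + 1) g x‖ := by
  have hs : ContDiff ℝ (⊤ : ℕ∞) (fderiv ℝ g) := hg.fderiv_right (by simp)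
  have := norm_iteratedFDeriv_clm_apply_const (𝕜 := ℝ) (f := fderiv ℝ g) (c := uvec d i) (x := x)
    (n := k) hs.contDiffAt (by exact_mod_cast le_top)
  rwa [norm_uvec, one_mul, norm_iteratedFDeriv_fderiv] at this

lemma abs_pd_le_norm_iteratedFDeriv {g : E d → ℝ} (hg : ContDiff ℝ (⊤ : ℕ∞) g) (i : Fin d)
    (x : E d) : |pd i g x| ≤ ‖iteratedFDeriv ℝ 1 g x‖ := by
  simpa using norm_iteratedFDeriv_pd_le hg 0 i x

lemma abs_pd_pd_le_norm_iteratedFDeriv {g : E d → ℝ} (hg : ContDiff ℝ (⊤ : ℕ∞) g) (i j : Fin d)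
    (x : E d) : |pd j (pd i g) x| ≤ ‖iteratedFDeriv ℝ 2 g x‖ :=
  (abs_pd_le_norm_iteratedFDeriv (contDiff_pd hg i) j x).trans (norm_iteratedFDeriv_pd_le hg 1 i x)

lemma abs_pd_pd_pd_le_norm_iteratedFDeriv {g : E d → ℝ} (hg : ContDiff ℝ (⊤ : ℕ∞) g)
    (i j k : Fin d) (x : E d) : |pd k (pd j (pd i g)) x| ≤ ‖iteratedFDeriv ℝ 3 g x‖ :=
  (abs_pd_pd_le_norm_iteratedFDeriv (contDiff_pd hg i) j k x).trans
    (norm_iteratedFDeriv_pd_le hg 2 i x)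

/-- The gradient of a periodic function is controlled by its second derivatives. -/
lemma SP.abs_pd_le_of_pd_pd {g : E d → ℝ} (hg : SP l g) (hl : 0 < l) {B : ℝ} (i : Fin d)
    (hB : ∀ x, |_root_.pd i (_root_.pd i g) x| ≤ B) (x : E d) : |_root_.pd i g x| ≤ B * l := by
  obtain ⟨s, hs, h0⟩ := exists_hasDerivAt_eq_zero (f := fun s : ℝ => g (x + s • uvec d i)) hl
    (Continuous.continuousOn (continuous_iff_continuousAt.2 fun s =>
      (hasDerivAt_line hg.differentiable x i s).continuousAt))
    (by simp [hg.periodic x i]) fun s _ => hasDerivAt_line hg.differentiable x i s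
  have := Convex.norm_image_sub_le_of_norm_hasDerivWithin_le (C := B) (s := univ)
    (f := fun s : ℝ => _root_.pd i g (x + s • uvec d i))
    (fun s _ => (hasDerivAt_line (hg.pd i).differentiable x i s).hasDerivWithinAt)
    (fun s _ => hB _) convex_univ (mem_univ s) (mem_univ 0)
  rw [h0, zero_smul, add_zero, sub_zero, zero_sub, norm_neg, Real.norm_eq_abs,
    Real.norm_eq_abs, abs_of_pos hs.1] at this
  exact this.trans (mul_le_mul_of_nonneg_left hs.2.le ((abs_nonneg _).trans (hB x)))

lemma RegPot.exists_pd_bound {Lv : ℝ} {V : ℝ → E d → ℝ} (hl : 0 < l)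
    (hV : ∀ t, ContDiff ℝ (⊤ : ℕ∞) (V t)) (h : RegPot d l T Lv V) :
    ∃ B, 0 ≤ B ∧ ∀ t ∈ Icc 0 T, ∀ x, ∀ i j k, |pd i (V t) x| ≤ B ∧ |pd j (pd i (V t)) x| ≤ B
      ∧ |pd k (pd j (pd i (V t))) x| ≤ B := by
  refine ⟨max 0 (max Lv (Lv * l)), le_max_left _ _, fun t ht x i j k => ?_⟩
  have h2 : ∀ x, ∀ i j, |pd j (pd i (V t)) x| ≤ Lv := fun x i j =>
    (abs_pd_pd_le_norm_iteratedFDeriv (hV t) i j x).trans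
      (((h t ht).1.iteratedFDeriv 2).forall_of_box hl (p := fun y => ‖y‖ ≤ Lv)
        (fun x hx => ((h t ht).2 x hx).1) x)
  have h3 : ∀ x, ∀ i j k, |pd k (pd j (pd i (V t))) x| ≤ Lv := fun x i j k =>
    (abs_pd_pd_pd_le_norm_iteratedFDeriv (hV t) i j k x).trans
      (((h t ht).1.iteratedFDeriv 3).forall_of_box hl (p := fun y => ‖y‖ ≤ Lv)
        (fun x hx => ((h t ht).2 x hx).2.1) x)
  have h1 := SP.abs_pd_le_of_pd_pd ⟨hV t, (h t ht).1⟩ hl i (fun x => h2 x i i) x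
  exact ⟨h1.trans ((le_max_right _ _).trans (le_max_right _ _)),
    (h2 x i j).trans ((le_max_left _ _).trans (le_max_right _ _)),
    (h3 x i j k).trans ((le_max_left _ _).trans (le_max_right _ _))⟩

lemma SolvesFPE.hasDerivAt_fpOp {V : ℝ → E d → ℝ} {α₀ : E d → ℝ} {α : ℝ → E d → ℝ}
    (hV : ∀ t, ContDiff ℝ (⊤ : ℕ∞) (V t)) (h : SolvesFPE d l V α₀ α) (t : ℝ) (x : E d) :
    HasDerivAt (fun τ => α τ x) (fpOp (V t) (α t) x) t := by
  obtain ⟨hs, h0, hp, hi, hd⟩ := h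
  refine (hd t x).congr_deriv ?_
  have d1 : Differentiable ℝ (α t) := (hs t).differentiable (by simp)
  have d2 : DifferentiableAt ℝ (fun y => gradient (V t) y) x :=
    (contDiff_gradient (hV t)).differentiable (by simp) x
  have e2 : diverg (fun y => α t y • gradient (V t) y) x =
    fderiv ℝ (α t) x (gradient (V t) x) + α t x * diverg (fun y => gradient (V t) y) x :=
    diverg_smul (F := fun y => gradient (V t) y) (d1 x) d2
  have e3 : fderiv ℝ (α t) x (gradient (V t) x) = ∑ i, pd i (V t) x * pd i (α t) x := by
    have : gradient (V t) x = ∑ i, pd i (V t) x • uvec d i := by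
      ext j
      rw [gradient_apply]
      simp [uvec, Pi.single_apply]
    rw [this, map_sum]
    simp only [map_smul, smul_eq_mul, pd]
  rw [e2, e3, lap_eq (hs t), ← lap, lap_eq (hV t), fpOp]
  ring

lemma SolvesFPE.fpData {B : ℝ} {V : ℝ → E d → ℝ} {α₀ : E d → ℝ} {α : ℝ → E d → ℝ} (hl : 0 < l)
    (hB : 0 ≤ B) (hV : ∀ t ∈ Icc 0 T, SP l (V t)) (hV' : ∀ t, ContDiff ℝ (⊤ : ℕ∞) (V t))
    (hb : ∀ t ∈ Icc 0 T, ∀ x, ∀ i j, |pd i (V t) x| ≤ B ∧ |pd j (pd i (V t)) x| ≤ B)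
    (h : SolvesFPE d l V α₀ α) : FPData l T (max B (d * B)) V α := by
  refine ⟨hl, hB.trans (le_max_left _ _), hV, fun t _ => ⟨h.1 t, h.2.2.1 t⟩, fun t _ => h.2.1 t,
    fun t ht x i => (hb t ht x i i).1.trans (le_max_left _ _), fun t ht x => ?_,
    fun t _ x => h.hasDerivAt_fpOp hV' t x⟩
  refine (Finset.abs_sum_le_sum_abs _ _).trans (le_trans ?_ (le_max_right _ _))
  simpa using Finset.sum_le_card_nsmul Finset.univ _ B fun i _ => (hb t ht x i i).2

lemma TransportedBy.tpData {L₀ Lf : ℝ} {f : ℝ → E d → E d}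
    {α₀ : E d → ℝ} {ρ : ℝ → E d → ℝ} (hl : 0 < l) (hT : 0 < T)
    (hfs : ∀ t, ContDiff ℝ (⊤ : ℕ∞) (f t)) (hfc : Continuous (Function.uncurry f))
    (hA1 : RegInit d l L₀ α₀) (hA2 : RegVel d l T Lf f)
    (hρ : TransportedBy d l f α₀ ρ) :
    ∃ C, TPData l T C f ρ := by
  obtain ⟨C, hC, hlog⟩ := hρ.exists_pd_log_bound hl hT hfs hfc hA1 hA2
  obtain ⟨B, hB⟩ := ((isCompact_Icc (a := (0 : ℝ)) (b := T)).prod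
    (isCompact_box d l)).exists_bound_of_continuousOn hfc.continuousOn
  have hsv : ∀ t ∈ Icc 0 T, ∀ i, SP l (fun x => f t x i) := fun t ht i =>
    ⟨contDiff_coord_iff.1 (hfs t) i, (hA2 t ht).1.comp_left fun y => y i⟩
  obtain ⟨hρs, hρ0, hρp, hρi, hρd⟩ := hρ
  have hdv : ∀ t x, DifferentiableAt ℝ (f t) x := fun t x => (hfs t).differentiable (by simp) x
  have hdρ : ∀ t x, DifferentiableAt ℝ (ρ t) x := fun t x => (hρs t).differentiable (by simp) x
  refine ⟨max C (max B (d * Lf)), hl, hT, hC.trans (le_max_left _ _), hsv,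
    fun t _ => ⟨hρs t, hρp t⟩, fun t _ => hρ0 t, fun t _ x => ?_, fun t ht x i => ?_,
    fun t ht x => ?_, fun t ht x i => (hlog t ht x i i i).1.trans (le_max_left _ _)⟩
  · refine (hρd t x).congr_deriv ?_
    rw [diverg_eq (F := fun y => ρ t y • f t y) ((hdρ t x).smul (hdv t x))]
    simp
  · have : ‖f t x‖ ≤ B := (hA2 t ht).1.forall_of_box hl (p := fun y => ‖y‖ ≤ B)
      (fun x hx => hB (t, x) ⟨ht, hx⟩) x
    exact (PiLp.norm_apply_le (f t x) i).trans
      (this.trans ((le_max_left _ _).trans (le_max_right _ _)))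
  · refine (Finset.abs_sum_le_sum_abs _ _).trans
      (le_trans ?_ ((le_max_right _ _).trans (le_max_right _ _)))
    have hb : ‖fderiv ℝ (f t) x‖ ≤ Lf := (hA2 t ht).1.fderiv.forall_of_box hl
      (p := fun y => ‖y‖ ≤ Lf) (fun x hx => by
        simpa using ((hA2 t ht).2 x hx 1 (by simp)).1) x
    have := Finset.sum_le_card_nsmul Finset.univ (fun i => |pd i (fun y => f t y i) x|) Lf
      fun i _ => by
        rw [pd, fderiv_coord (hdv t x)]
        refine (PiLp.norm_apply_le (fderiv ℝ (f t) x (uvec d i)) i).trans ?_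
        refine ((fderiv ℝ (f t) x).le_opNorm _).trans ?_
        rwa [norm_uvec, mul_one]
    simpa using this

end

/-- A family of smooth periodic functions depending measurably on a parameter. -/
structure MeasField {d : ℕ} {Ω : Type*} [MeasurableSpace Ω] (l : ℝ) (F : Ω → E d → ℝ) : Prop where
  sp : ∀ ω, SP l (F ω)
  meas : ∀ x, Measurable fun ω => F ω x

section
variable {d : ℕ} {l : ℝ} {Ω : Type*} [MeasurableSpace Ω]

lemma measurable_integral_box {F : Ω → E d → ℝ} (hc : ∀ ω, Continuous (F ω))
    (hm : ∀ x, Measurable fun ω => F ω x) : Measurable fun ω => ∫ x in box d l, F ω x := by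
  have := stronglyMeasurable_uncurry_of_continuous_of_stronglyMeasurable (u := fun x ω => F ω x)
    hc fun x => (hm x).stronglyMeasurable
  exact (this.integral_prod_left (μ := volume.restrict (box d l))).measurable

namespace MeasField
variable {F G : Ω → E d → ℝ}

lemma measurable_integral (h : MeasField l F) : Measurable fun ω => ∫ x in box d l, F ω x :=
  measurable_integral_box (fun ω => (h.sp ω).continuous) h.meas

lemma add (hF : MeasField l F) (hG : MeasField l G) : MeasField l fun ω x => F ω x + G ω x :=
  ⟨fun ω => (hF.sp ω).add (hG.sp ω), fun x => (hF.meas x).add (hG.meas x)⟩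

lemma mul (hF : MeasField l F) (hG : MeasField l G) : MeasField l fun ω x => F ω x * G ω x :=
  ⟨fun ω => (hF.sp ω).mul (hG.sp ω), fun x => (hF.meas x).mul (hG.meas x)⟩

lemma sum {ι : Type*} {s : Finset ι} {H : ι → Ω → E d → ℝ} (h : ∀ i ∈ s, MeasField l (H i)) :
    MeasField l fun ω x => ∑ i ∈ s, H i ω x :=
  ⟨fun ω => SP.sum fun i hi => (h i hi).sp ω, fun x => Finset.measurable_fun_sum _ fun i hi =>
    (h i hi).meas x⟩

lemma const {g : E d → ℝ} (hg : SP l g) : MeasField l fun (_ : Ω) x => g x :=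
  ⟨fun _ => hg, fun _ => measurable_const⟩

lemma log (hF : MeasField l F) (h0 : ∀ ω x, 0 < F ω x) :
    MeasField l fun ω x => Real.log (F ω x) :=
  ⟨fun ω => (hF.sp ω).log (h0 ω), fun x => Real.measurable_log.comp (hF.meas x)⟩

lemma pd (hF : MeasField l F) (i : Fin d) : MeasField l fun ω => pd i (F ω) := by
  refine ⟨fun ω => (hF.sp ω).pd i, fun x => ?_⟩
  refine measurable_of_tendsto_metrizable (f := fun (n : ℕ) ω =>
    ((1 : ℝ) / (n + 1))⁻¹ * (F ω (x + ((1 : ℝ) / (n + 1)) • uvec d i) - F ω x))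
    (fun n => ((hF.meas _).sub (hF.meas _)).const_mul _) (tendsto_pi_nhds.2 fun ω => ?_)
  have h := (hasDerivAt_line (hF.sp ω).differentiable x i 0).tendsto_slope_zero
  have ht : Filter.Tendsto (fun n : ℕ => (1 : ℝ) / (n + 1)) Filter.atTop (nhdsWithin 0 {0}ᶜ) :=
    tendsto_nhdsWithin_iff.2 ⟨tendsto_one_div_add_atTop_nhds_zero_nat,
      Filter.Eventually.of_forall fun n => by
        simp only [mem_compl_iff, mem_singleton_iff]; positivity⟩
  simpa [Function.comp_def] using h.comp ht

end MeasField

end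

section
variable {d : ℕ} {l : ℝ} {Ω : Type*}

lemma eq_sum_uvec (v : E d) : v = ∑ i, v i • uvec d i := by
  ext j
  simp [uvec, Pi.single_apply]

lemma abs_sub_le_of_pd_le {g : E d → ℝ} (hg : Differentiable ℝ g) {B : ℝ} (hB0 : 0 ≤ B)
    (hB : ∀ x i, |pd i g x| ≤ B) (x y : E d) : |g x - g y| ≤ d * B * ‖x - y‖ := by
  refine convex_univ.norm_image_sub_le_of_norm_fderiv_le (fun z _ => hg z) (fun z _ => ?_)
    (mem_univ y) (mem_univ x)
  refine ContinuousLinearMap.opNorm_le_bound _ (by positivity) fun v => ?_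
  conv_lhs => rw [eq_sum_uvec v, map_sum]
  refine (norm_sum_le _ _).trans ?_
  have := Finset.sum_le_card_nsmul Finset.univ (fun i => ‖fderiv ℝ g z (v i • uvec d i)‖) (B * ‖v‖)
    fun i _ => by
      rw [map_smul, norm_smul, mul_comm]
      exact mul_le_mul (hB z i) (PiLp.norm_apply_le v i) (norm_nonneg _) hB0
  simpa [mul_assoc] using this

/-- For equi-Lipschitz periodic functions, smallness in a weighted `L²` norm implies smallness. -/
lemma exists_forall_abs_lt_of_integral_lt (hl : 0 < l) {α : E d → ℝ} (hα : SP l α)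
    (h0 : ∀ x, 0 < α x) {K ε : ℝ} (hK : 0 ≤ K) (hε : 0 < ε) :
    ∃ δ > 0, ∀ w : E d → ℝ, SP l w → (∀ x y, |w x - w y| ≤ K * ‖x - y‖) →
      ∫ x in box d l, α x * w x ^ 2 < δ → ∀ x, |w x| < ε := by
  obtain ⟨x₀, -, hx₀⟩ := hα.periodic.exists_min hl hα.continuous
  set r : ℝ := min (l / 2) (ε / (2 * (K + 1))) with hr
  have hr0 : 0 < r := lt_min (by positivity) (by positivity)
  have hball : Metric.ball (0 : E d) r ⊆ box d l := fun y hy i => by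
    have h1 : ‖y‖ < r := by simpa using hy
    have h2 := abs_le.1 ((PiLp.norm_apply_le y i).trans (h1.le.trans (min_le_left _ _)))
    exact ⟨h2.1, h2.2⟩
  have hv : 0 < volume.real (Metric.ball (0 : E d) r) := by
    rw [Measure.real, ENNReal.toReal_pos_iff]
    exact ⟨Metric.measure_ball_pos _ _ hr0, measure_ball_lt_top⟩
  refine ⟨α x₀ * (ε / 2) ^ 2 * volume.real (Metric.ball (0 : E d) r),
    mul_pos (mul_pos (h0 _) (by positivity)) hv, fun w hw hlip hintg x => ?_⟩
  by_contra! hx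
  refine hintg.not_ge ?_
  have hF : SP l fun x => α x * w x ^ 2 := by simpa only [sq] using hα.mul (hw.mul hw)
  have hc : Continuous fun y => α (y + x) * w (y + x) ^ 2 :=
    hF.continuous.comp (continuous_id.add continuous_const)
  have e := integral_box_add hl hF.periodic x
  rw [← e]
  calc α x₀ * (ε / 2) ^ 2 * volume.real (Metric.ball (0 : E d) r)
      = ∫ _ in Metric.ball (0 : E d) r, α x₀ * (ε / 2) ^ 2 := by
        rw [setIntegral_const, smul_eq_mul, mul_comm]
    _ ≤ ∫ y in Metric.ball (0 : E d) r, α (y + x) * w (y + x) ^ 2 := by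
        refine setIntegral_mono_on (integrableOn_const measure_ball_lt_top.ne)
          ((integrableOn_box hc).mono_set hball) measurableSet_ball fun y hy => ?_
        have h1 : ‖y‖ < r := by simpa using hy
        have h2 := hlip x (y + x)
        have h3 : K * ‖x - (y + x)‖ ≤ ε / 2 := by
          have e1 : x - (y + x) = -y := by abel
          have h4 : ‖y‖ ≤ ε / (2 * (K + 1)) := h1.le.trans (min_le_right _ _)
          rw [le_div_iff₀ (by positivity)] at h4
          rw [e1, norm_neg]
          nlinarith [norm_nonneg y]
        have h5 : ε / 2 ≤ |w (y + x)| := by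
          have := abs_sub_abs_le_abs_sub (w x) (w (y + x))
          linarith
        refine mul_le_mul (hx₀ _) ?_ (by positivity) (h0 _).le
        rw [← sq_abs (w (y + x))]
        exact pow_le_pow_left₀ (by positivity) h5 2
    _ ≤ ∫ y in box d l, α (y + x) * w (y + x) ^ 2 :=
        setIntegral_mono_set (integrableOn_box hc)
          (ae_of_all _ fun y => mul_nonneg (h0 _).le (sq_nonneg _)) hball.eventuallyLE

lemma exists_seq_gradient_dense (hl : 0 < l) [Nonempty Ω] {W : Ω → E d → ℝ}
    (hW : ∀ ω, SP l (W ω)) :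
    ∃ a : ℕ → Ω, ∀ ω, ∀ ε > 0, ∃ j, ∀ x i, |pd i (W (a j)) x - pd i (W ω) x| < ε := by
  have := isCompact_iff_compactSpace.1 (isCompact_box d l)
  let G : Ω → C(box d l, Fin d → ℝ) := fun ω =>
    ⟨fun x i => pd i (W ω) x, continuous_pi fun i =>
      ((hW ω).pd i).continuous.comp continuous_subtype_val⟩
  obtain ⟨u, hu⟩ := TopologicalSpace.exists_dense_seq (range G)
  choose a ha using fun j => (u j).2
  refine ⟨a, fun ω ε hε => ?_⟩
  obtain ⟨j, hj⟩ := hu.exists_dist_lt ⟨G ω, mem_range_self ω⟩ hε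
  refine ⟨j, fun x i => ?_⟩
  refine (((hW (a j)).pd i).sub ((hW ω).pd i)).periodic.forall_of_box hl
    (p := fun y => |y| < ε) (fun x hx => ?_) x
  have h1 : dist (G ω) (G (a j)) < ε := by rw [ha]; exact hj
  have h2 := (ContinuousMap.dist_lt_iff hε).1 h1 ⟨x, hx⟩
  have h3 := (dist_pi_lt_iff hε).1 h2 i
  rw [dist_comm, Real.dist_eq] at h3
  exact h3

end

section
variable {d : ℕ} {l : ℝ} {Ω : Type*} [MeasurableSpace Ω]

/-- The gradient of the solution of `div(α ∇W) = g` depends measurably on the data. -/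
lemma measField_pd_of_measField_div (hl : 0 < l) {W α : Ω → E d → ℝ} (hW : ∀ ω, SP l (W ω))
    (hα : MeasField l α) (h0 : ∀ ω x, 0 < α ω x)
    (hg : MeasField l fun ω x => ∑ i, pd i (fun y => α ω y * pd i (W ω) y) x)
    {B : ℝ} (hB0 : 0 ≤ B) (hB : ∀ ω x i j, |pd j (pd i (W ω)) x| ≤ B) (i : Fin d) :
    MeasField l fun ω => pd i (W ω) := by
  refine ⟨fun ω => (hW ω).pd i, fun x => ?_⟩
  rcases isEmpty_or_nonempty Ω with hΩ | hΩ
  · exact measurable_of_empty _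
  obtain ⟨a, ha⟩ := exists_seq_gradient_dense hl hW
  set D : ℕ → Ω → E d → ℝ := fun j ω x => ∑ i, (pd i (W (a j)) x - pd i (W ω) x) ^ 2 with hD
  set A : ℕ → Ω → ℝ := fun j ω => ∫ x in box d l, α ω x * ∑ i, pd i (W (a j)) x ^ 2 with hA
  set b : ℕ → Ω → ℝ := fun j ω => -∫ x in box d l,
    (∑ i, pd i (fun y => α ω y * pd i (W ω) y) x) * W (a j) x with hb
  set C : Ω → ℝ := fun ω => ∫ x in box d l, α ω x * ∑ i, pd i (W ω) x ^ 2 with hC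
  set e : ℕ → Ω → ℝ := fun j ω => ∫ x in box d l, α ω x * D j ω x with he
  have sα := hα.sp
  have sq' : ∀ {g : E d → ℝ}, SP l g → SP l fun x => g x ^ 2 := fun {g} hg => by
    simpa only [sq] using hg.mul hg
  have sD : ∀ j ω, SP l (D j ω) := fun j ω =>
    SP.sum fun i _ => sq' (((hW (a j)).pd i).sub ((hW ω).pd i))
  have ebC : ∀ j ω, e j ω = A j ω - 2 * b j ω + C ω := fun j ω => by
    have hb' : b j ω = ∫ x in box d l, ∑ i, α ω x * pd i (W ω) x * pd i (W (a j)) x := by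
      simp only [hb]
      rw [integral_sum_pd_mul hl (fun i => (sα ω).mul ((hW ω).pd i)) (hW (a j)), neg_neg]
    have s1 : SP l fun x => α ω x * ∑ i, pd i (W (a j)) x ^ 2 :=
      (sα ω).mul (SP.sum fun i _ => sq' ((hW (a j)).pd i))
    have s2 : SP l fun x => ∑ i, α ω x * pd i (W ω) x * pd i (W (a j)) x :=
      SP.sum fun i _ => ((sα ω).mul ((hW ω).pd i)).mul ((hW (a j)).pd i)
    have s3 : SP l fun x => α ω x * ∑ i, pd i (W ω) x ^ 2 :=
      (sα ω).mul (SP.sum fun i _ => sq' ((hW ω).pd i))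
    simp only [he, hA, hC, hb']
    rw [← integral_const_mul, ← integral_sub (integrableOn_box s1.continuous)
      ((integrableOn_box s2.continuous).const_mul 2), ← integral_add
      (f := fun x => (α ω x * ∑ i, pd i (W (a j)) x ^ 2)
        - 2 * ∑ i, α ω x * pd i (W ω) x * pd i (W (a j)) x)
      ((integrableOn_box s1.continuous).sub ((integrableOn_box s2.continuous).const_mul 2))
      (integrableOn_box s3.continuous)]
    congr 1
    ext x
    simp only [hD, Finset.mul_sum, ← Finset.sum_sub_distrib, ← Finset.sum_add_distrib]
    exact Finset.sum_congr rfl fun i _ => by ring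
  have mA : ∀ j, Measurable (A j) := fun j =>
    (hα.mul (MeasField.const (SP.sum fun i _ => sq' ((hW (a j)).pd i)))).measurable_integral
  have mb : ∀ j, Measurable (b j) := fun j =>
    (hg.mul (MeasField.const (hW (a j)))).measurable_integral.neg
  have e0 : ∀ j ω, 0 ≤ e j ω := fun j ω => integral_nonneg fun x =>
    mul_nonneg (h0 ω x).le (Finset.sum_nonneg fun i _ => sq_nonneg _)
  have esmall : ∀ ω, ∀ ε > 0, ∃ j, e j ω < ε := fun ω ε hε => by
    set m : ℝ := ∫ x in box d l, α ω x with hm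
    have hm0 : 0 ≤ m := integral_nonneg fun x => (h0 ω x).le
    set η : ℝ := ε / ((m + 1) * (d + 1)) with hη
    have hη0 : 0 < η := by positivity
    obtain ⟨j, hj⟩ := ha ω (min 1 η) (lt_min one_pos hη0)
    refine ⟨j, ?_⟩
    have hDle : ∀ x, D j ω x ≤ d * η := fun x => by
      have := Finset.sum_le_card_nsmul Finset.univ
        (fun i => (pd i (W (a j)) x - pd i (W ω) x) ^ 2) η fun i _ => by
          rw [← sq_abs]
          have h1 := (hj x i).le.trans (min_le_left _ _)
          have h2 := (hj x i).le.trans (min_le_right _ _)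
          nlinarith [abs_nonneg (pd i (W (a j)) x - pd i (W ω) x)]
      simpa using this
    calc e j ω ≤ ∫ x in box d l, α ω x * (d * η) :=
          setIntegral_mono (integrableOn_box ((sα ω).mul (sD j ω)).continuous)
            ((integrableOn_box (sα ω).continuous).mul_const _) fun x =>
            mul_le_mul_of_nonneg_left (hDle x) (h0 ω x).le
      _ = m * d * η := by rw [integral_mul_const]; ring
      _ < (m + 1) * (d + 1) * η := by
          refine mul_lt_mul_of_pos_right ?_ hη0
          have : (0 : ℝ) ≤ d := Nat.cast_nonneg d
          nlinarith
      _ = ε := by rw [hη]; field_simp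
  have mC : Measurable C := by
    refine Measurable.isLUB (f := fun j ω => 2 * b j ω - A j ω)
      (fun j => ((mb j).const_mul 2).sub (mA j)) fun ω => ⟨?_, fun c hc => ?_⟩
    · rintro _ ⟨j, rfl⟩
      linarith [ebC j ω, e0 j ω]
    · refine le_of_forall_pos_lt_add fun ε hε => ?_
      obtain ⟨j, hj⟩ := esmall ω ε hε
      have := hc ⟨j, rfl⟩
      linarith [ebC j ω]
  have me : ∀ j, Measurable (e j) := fun j => by
    have : e j = fun ω => A j ω - 2 * b j ω + C ω := funext (ebC j)
    rw [this]
    exact ((mA j).sub ((mb j).const_mul 2)).add mC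
  classical
  have hex : ∀ k : ℕ, ∀ ω, ∃ j, e j ω < 1 / ((k : ℝ) + 1) := fun k ω =>
    esmall ω _ Nat.one_div_pos_of_nat
  refine measurable_of_tendsto_metrizable
    (f := fun (k : ℕ) ω => pd i (W (a (Nat.find (hex k ω)))) x)
    (fun k => Measurable.find (f := fun j _ => pd i (W (a j)) x) (fun j => measurable_const)
      (fun j => measurableSet_lt (me j) measurable_const) (hex k)) (tendsto_pi_nhds.2 fun ω => ?_)
  rw [Metric.tendsto_atTop]
  intro ε hε
  obtain ⟨δ, hδ, h⟩ := exists_forall_abs_lt_of_integral_lt hl (sα ω) (h0 ω)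
    (K := d * (2 * B)) (by positivity) hε
  obtain ⟨N, hN⟩ := exists_nat_one_div_lt hδ
  refine ⟨N, fun k hk => ?_⟩
  set j := Nat.find (hex k ω) with hj
  have hjk : e j ω < δ := (Nat.find_spec (hex k ω)).trans_le
    ((one_div_le_one_div_of_le (by positivity) (by exact_mod_cast Nat.succ_le_succ hk)).trans hN.le)
  have sw := ((hW (a j)).pd i).sub ((hW ω).pd i)
  refine h _ sw (abs_sub_le_of_pd_le sw.differentiable (by positivity) fun y k => ?_) ?_ x
  · rw [pd_sub ((hW (a j)).pd i).differentiable ((hW ω).pd i).differentiable]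
    have h1 := hB (a j) y i k
    have h2 := hB ω y i k
    rw [abs_le] at h1 h2 ⊢
    constructor <;> linarith
  · refine lt_of_le_of_lt (setIntegral_mono (integrableOn_box ((sα ω).mul (sq' sw)).continuous)
      (integrableOn_box ((sα ω).mul (sD j ω)).continuous) fun y => ?_) hjk
    refine mul_le_mul_of_nonneg_left ?_ (h0 ω y).le
    exact Finset.single_le_sum (f := fun i => (pd i (W (a j)) y - pd i (W ω) y) ^ 2)
      (fun i _ => sq_nonneg _) (Finset.mem_univ i)

end

section
variable {d : ℕ} {l : ℝ}

lemma clm_eq_sum_smulRight {G : Type*} [NormedAddCommGroup G] [NormedSpace ℝ G] (L : E d →L[ℝ] G) :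
    L = ∑ i, (EuclideanSpace.proj i : E d →L[ℝ] ℝ).smulRight (L (uvec d i)) := by
  ext v
  conv_lhs => rw [eq_sum_uvec v, map_sum]
  simp

lemma fderiv_uvec_eq_sum {F : E d → E d} (hF : ContDiff ℝ (⊤ : ℕ∞) F) (x : E d) (i : Fin d) :
    fderiv ℝ F x (uvec d i) = ∑ k, pd i (fun y => F y k) x • uvec d k := by
  refine (eq_sum_uvec _).trans (Finset.sum_congr rfl fun k _ => ?_)
  rw [pd, fderiv_coord (hF.differentiable (by simp) x)]

lemma fderiv_fderiv_uvec_eq_sum {F : E d → E d} (hF : ContDiff ℝ (⊤ : ℕ∞) F) (x : E d)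
    (i j : Fin d) : fderiv ℝ (fun y => fderiv ℝ F y) x (uvec d i) (uvec d j)
      = ∑ k, pd i (pd j (fun y => F y k)) x • uvec d k := by
  have hs : ContDiff ℝ (⊤ : ℕ∞) (fderiv ℝ F) := hF.fderiv_right (by simp)
  rw [← fderiv_fderiv_apply (hs.differentiable (by simp) x)]
  have hc : ContDiff ℝ (⊤ : ℕ∞) (fun y => fderiv ℝ F y (uvec d j)) :=
    hs.clm_apply contDiff_const
  rw [fderiv_uvec_eq_sum hc]
  refine Finset.sum_congr rfl fun k _ => ?_
  congr 2
  ext y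
  rw [pd, fderiv_coord (hF.differentiable (by simp) y)]

lemma exists_norm_fderiv_eq (d : ℕ) : ∃ N : (Fin d → Fin d → ℝ) → ℝ, Continuous N ∧
    ∀ F : E d → E d, ContDiff ℝ (⊤ : ℕ∞) F → ∀ x,
      ‖fderiv ℝ F x‖ = N fun i k => pd i (fun y => F y k) x := by
  refine ⟨fun a => ‖∑ i, (EuclideanSpace.proj i : E d →L[ℝ] ℝ).smulRight
    (∑ k, a i k • uvec d k)‖, ?_, fun F hF x => ?_⟩
  · refine (continuous_finsetSum (Finset.univ : Finset (Fin d)) fun i _ => ?_).norm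
    exact (ContinuousLinearMap.smulRightL ℝ (E d) (E d) (EuclideanSpace.proj i)).continuous.comp
      (by fun_prop)
  · conv_lhs => rw [clm_eq_sum_smulRight (fderiv ℝ F x)]
    simp only [fderiv_uvec_eq_sum hF]

lemma exists_norm_fderiv_fderiv_eq (d : ℕ) : ∃ N : (Fin d → Fin d → Fin d → ℝ) → ℝ, Continuous N ∧
    ∀ F : E d → E d, ContDiff ℝ (⊤ : ℕ∞) F → ∀ x,
      ‖fderiv ℝ (fun y => fderiv ℝ F y) x‖ = N fun i j k => pd i (pd j (fun y => F y k)) x := by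
  refine ⟨fun a => ‖∑ i, (EuclideanSpace.proj i : E d →L[ℝ] ℝ).smulRight
    (∑ j, (EuclideanSpace.proj j : E d →L[ℝ] ℝ).smulRight (∑ k, a i j k • uvec d k))‖,
    ?_, fun F hF x => ?_⟩
  · have h : ∀ i, Continuous fun a : Fin d → Fin d → Fin d → ℝ =>
        ∑ j, (EuclideanSpace.proj j : E d →L[ℝ] ℝ).smulRight (∑ k, a i j k • uvec d k) := fun i =>
      continuous_finsetSum _ fun j _ => (ContinuousLinearMap.smulRightL ℝ (E d) (E d)
        (EuclideanSpace.proj j)).continuous.comp (by fun_prop)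
    exact (continuous_finsetSum _ fun i _ => (ContinuousLinearMap.smulRightL ℝ (E d)
      (E d →L[ℝ] E d) (EuclideanSpace.proj i)).continuous.comp (h i)).norm
  · conv_lhs => rw [clm_eq_sum_smulRight (fderiv ℝ (fun y => fderiv ℝ F y) x)]
    congr 1
    refine Finset.sum_congr rfl fun i _ => ?_
    congr 1
    conv_lhs => rw [clm_eq_sum_smulRight (fderiv ℝ (fun y => fderiv ℝ F y) x (uvec d i))]
    simp only [fderiv_fderiv_uvec_eq_sum hF]

/-- The pointwise second-order Sobolev integrand is a continuous function of the derivatives. -/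
lemma exists_jet_eq (d : ℕ) :
    ∃ N : (Fin d → ℝ) × (Fin d → Fin d → ℝ) × (Fin d → Fin d → Fin d → ℝ) → ℝ, Continuous N ∧
    ∀ F : E d → E d, ContDiff ℝ (⊤ : ℕ∞) F → ∀ x,
      ‖F x‖ ^ 2 + ‖fderiv ℝ F x‖ ^ 2 + ‖fderiv ℝ (fun y => fderiv ℝ F y) x‖ ^ 2
        = N (fun k => F x k, fun i k => pd i (fun y => F y k) x,
          fun i j k => pd i (pd j (fun y => F y k)) x) := by
  obtain ⟨N₁, c₁, h₁⟩ := exists_norm_fderiv_eq d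
  obtain ⟨N₂, c₂, h₂⟩ := exists_norm_fderiv_fderiv_eq d
  refine ⟨fun a => ‖WithLp.toLp 2 a.1‖ ^ 2 + N₁ a.2.1 ^ 2 + N₂ a.2.2 ^ 2, ?_, fun F hF x => ?_⟩
  · have : Continuous fun a : Fin d → ℝ => (WithLp.toLp 2 a : E d) := PiLp.continuous_toLp 2 _
    fun_prop
  · simp only [← h₁ F hF, ← h₂ F hF]

end

section
variable {d : ℕ} {l T : ℝ}

lemma integrableOn_integral_jet {R : ℝ → E d → E d} {ρ : ℝ → E d → ℝ} {C M : ℝ}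
    (hR : ∀ k, MeasField l fun (t : Icc (0 : ℝ) T) x => R t x k)
    (hρ : MeasField l fun t : Icc (0 : ℝ) T => ρ t)
    (hC : ∀ t ∈ Icc 0 T, ∀ x, ∀ i j k, |R t x k| ≤ C ∧ |pd i (fun y => R t y k) x| ≤ C
      ∧ |pd i (pd j (fun y => R t y k)) x| ≤ C)
    (hM : ∀ t ∈ Icc 0 T, ∀ x, |ρ t x| ≤ M) :
    IntegrableOn (fun t => ∫ x in box d l, (‖R t x‖ ^ 2 + ‖fderiv ℝ (R t) x‖ ^ 2
      + ‖fderiv ℝ (fun y => fderiv ℝ (R t) y) x‖ ^ 2) * ρ t x) (Icc 0 T) := by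
  obtain ⟨N, cN, hN⟩ := exists_jet_eq d
  have hRs : ∀ t ∈ Icc 0 T, ContDiff ℝ (⊤ : ℕ∞) (R t) := fun t ht =>
    contDiff_coord_iff.2 fun k => ((hR k).sp ⟨t, ht⟩).smooth
  set a : ℝ → E d → (Fin d → ℝ) × (Fin d → Fin d → ℝ) × (Fin d → Fin d → Fin d → ℝ) := fun t x =>
    (fun k => R t x k, fun i k => pd i (fun y => R t y k) x,
      fun i j k => pd i (pd j (fun y => R t y k)) x) with ha
  obtain ⟨K, hK⟩ := (isCompact_closedBall (0 : (Fin d → ℝ) × (Fin d → Fin d → ℝ) ×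
    (Fin d → Fin d → Fin d → ℝ)) (max 0 C)).exists_bound_of_continuousOn cN.continuousOn
  have hb : ∀ t ∈ Icc 0 T, ∀ x, |N (a t x)| ≤ K := fun t ht x => by
    refine hK _ ?_
    have h0 : (0 : ℝ) ≤ max 0 C := le_max_left _ _
    have hle : C ≤ max 0 C := le_max_right _ _
    rw [mem_closedBall_zero_iff, Prod.norm_def, Prod.norm_def]
    refine max_le ((pi_norm_le_iff_of_nonneg h0).2 fun k => ?_)
      (max_le ((pi_norm_le_iff_of_nonneg h0).2 fun i => (pi_norm_le_iff_of_nonneg h0).2 fun k => ?_)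
        ((pi_norm_le_iff_of_nonneg h0).2 fun i => (pi_norm_le_iff_of_nonneg h0).2 fun j =>
          (pi_norm_le_iff_of_nonneg h0).2 fun k => ?_))
    · exact (hC t ht x k k k).1.trans hle
    · exact (hC t ht x i i k).2.1.trans hle
    · exact (hC t ht x i j k).2.2.trans hle
  have heq : ∀ t ∈ Icc 0 T, ∫ x in box d l, (‖R t x‖ ^ 2 + ‖fderiv ℝ (R t) x‖ ^ 2
      + ‖fderiv ℝ (fun y => fderiv ℝ (R t) y) x‖ ^ 2) * ρ t x
      = ∫ x in box d l, N (a t x) * ρ t x := fun t ht => by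
    simp only [hN (R t) (hRs t ht), ha]
  refine IntegrableOn.congr_fun (f := fun t => ∫ x in box d l, N (a t x) * ρ t x) ?_
    (fun t ht => (heq t ht).symm) measurableSet_Icc
  have hmeas : Measurable fun t : Icc (0 : ℝ) T => ∫ x in box d l, N (a t x) * ρ t x := by
    refine measurable_integral_box (F := fun (t : Icc (0 : ℝ) T) x => N (a t x) * ρ t x)
      (fun t => (cN.comp ?_).mul (hρ.sp t).continuous)
      fun x => (cN.measurable.comp ?_).mul (hρ.meas x)
    · exact (continuous_pi fun k => ((hR k).sp t).continuous).prodMk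
        ((continuous_pi fun i => continuous_pi fun k => (((hR k).pd i).sp t).continuous).prodMk
        (continuous_pi fun i => continuous_pi fun j => continuous_pi fun k =>
          ((((hR k).pd j).pd i).sp t).continuous))
    · exact (measurable_pi_lambda _ fun k => (hR k).meas x).prodMk
        ((measurable_pi_lambda _ fun i => measurable_pi_lambda _ fun k =>
          ((hR k).pd i).meas x).prodMk
        (measurable_pi_lambda _ fun i => measurable_pi_lambda _ fun j =>
          measurable_pi_lambda _ fun k => (((hR k).pd j).pd i).meas x))
  refine IntegrableOn.of_bound (C := K * M * volume.real (box d l)) measure_Icc_lt_top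
    (aemeasurable_restrict_of_measurable_subtype measurableSet_Icc hmeas).aestronglyMeasurable
    ((ae_restrict_mem measurableSet_Icc).mono fun t ht => ?_)
  refine norm_setIntegral_le_of_norm_le_const (volume_box_lt_top d l) fun x _ => ?_
  rw [norm_mul]
  exact mul_le_mul (hb t ht x) (hM t ht x) (abs_nonneg _) ((abs_nonneg _).trans (hb t ht x))

lemma measField_pd_potential {V α : ℝ → E d → ℝ} {B : ℝ} (h : FPData l T B V α) {B' : ℝ}
    (hB0 : 0 ≤ B') (hB : ∀ t ∈ Icc 0 T, ∀ x i j, |pd j (pd i (V t)) x| ≤ B') (i : Fin d) :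
    MeasField l fun t : Icc (0 : ℝ) T => pd i (V t) := by
  have hα : MeasField l fun t : Icc (0 : ℝ) T => α t := by
    refine ⟨fun t => h.sα t t.2, fun x => Continuous.measurable ?_⟩
    have : ContinuousOn (fun t => α t x) (Icc 0 T) := fun t ht =>
      (h.der t ht x).continuousAt.continuousWithinAt
    exact continuousOn_iff_continuous_domRestrict.1 this
  refine measField_pd_of_measField_div h.hl (W := fun t : Icc (0 : ℝ) T => V t)
    (fun t => h.sV t t.2) hα (fun t => h.pos t t.2) ⟨fun t => ?_, fun x => ?_⟩ hB0
    (fun t x i j => hB t t.2 x i j) i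
  · exact SP.sum fun i _ => ((h.sα t t.2).mul ((h.sV t t.2).pd i)).pd i
  · have e : (fun t : Icc (0 : ℝ) T => ∑ i, pd i (fun y => α t y * pd i (V t) y) x)
        = fun t : Icc (0 : ℝ) T => deriv (fun τ => α τ x) t - ∑ i, pd i (pd i (α t)) x := by
      ext t
      have sα := h.sα t t.2
      have sV := h.sV t t.2
      rw [(h.der t t.2 x).deriv, fpOp_eq_sum sV sα, ← Finset.sum_sub_distrib]
      refine Finset.sum_congr rfl fun i _ => ?_
      rw [pd_add (sα.pd i).differentiable (sα.mul (sV.pd i)).differentiable]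
      ring
    rw [e]
    exact ((measurable_deriv _).comp measurable_subtype_coe).sub
      ((MeasField.sum fun i (_ : i ∈ Finset.univ) => (hα.pd i).pd i).meas x)

end

section
variable {d : ℕ} {l T : ℝ}

lemma deltaF_apply (f : ℝ → E d → E d) (V ρ : ℝ → E d → ℝ) (t : ℝ) (x : E d) (k : Fin d) :
    deltaF f V ρ t x k = resid f V ρ k t x := by
  simp only [deltaF, Avf, score, resid, PiLp.sub_apply, PiLp.neg_apply, gradient_apply]
  ring

lemma norm_iteratedFDeriv_coord_le {F : E d → E d} (hF : ContDiff ℝ (⊤ : ℕ∞) F) (m : ℕ)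
    (k : Fin d) (x : E d) :
    ‖iteratedFDeriv ℝ m (fun y => F y k) x‖ ≤ ‖iteratedFDeriv ℝ m F x‖ := by
  have h := (EuclideanSpace.proj k : E d →L[ℝ] ℝ).iteratedFDeriv_comp_left (x := x) hF.contDiffAt
    (i := m) (by exact_mod_cast le_top)
  have h1 : ‖(EuclideanSpace.proj k : E d →L[ℝ] ℝ)‖ ≤ 1 :=
    ContinuousLinearMap.opNorm_le_bound _ zero_le_one fun v => by
      simpa using PiLp.norm_apply_le v k
  have h2 := ContinuousLinearMap.norm_compContinuousMultilinearMap_le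
    (EuclideanSpace.proj k : E d →L[ℝ] ℝ) (iteratedFDeriv ℝ m F x)
  rw [← h] at h2
  exact h2.trans (mul_le_of_le_one_left (norm_nonneg _) h1)

lemma RegVel.abs_pd_le {Lf : ℝ} {f : ℝ → E d → E d} (hl : 0 < l)
    (hfs : ∀ t, ContDiff ℝ (⊤ : ℕ∞) (f t)) (hA2 : RegVel d l T Lf f) {t : ℝ} (ht : t ∈ Icc 0 T)
    (x : E d) (i j k : Fin d) :
    |pd i (fun y => f t y k) x| ≤ Lf ∧ |pd i (pd j (fun y => f t y k)) x| ≤ Lf := by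
  have hk := contDiff_coord_iff.1 (hfs t) k
  have hb : ∀ m ∈ Finset.Icc 1 4, ‖iteratedFDeriv ℝ m (f t) x‖ ≤ Lf := fun m hm =>
    ((hA2 t ht).1.iteratedFDeriv m).forall_of_box hl (p := fun y => ‖y‖ ≤ Lf)
      (fun x hx => ((hA2 t ht).2 x hx m hm).1) x
  exact ⟨(abs_pd_le_norm_iteratedFDeriv hk i x).trans
      ((norm_iteratedFDeriv_coord_le (hfs t) 1 k x).trans (hb 1 (by simp))),
    (abs_pd_pd_le_norm_iteratedFDeriv hk j i x).trans
      ((norm_iteratedFDeriv_coord_le (hfs t) 2 k x).trans (hb 2 (by simp)))⟩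

lemma pd_add_add {f g h : E d → ℝ} (hf : Differentiable ℝ f) (hg : Differentiable ℝ g)
    (hh : Differentiable ℝ h) (i : Fin d) :
    pd i (fun x => f x + g x + h x) = fun x => pd i f x + pd i g x + pd i h x := by
  ext x
  have h1 := pd_add (f := fun x => f x + g x) (hf.add hg) hh i x
  rw [h1, pd_add hf hg]

lemma abs_add_add_le {a b c A B C : ℝ} (ha : |a| ≤ A) (hb : |b| ≤ B) (hc : |c| ≤ C) :
    |a + b + c| ≤ A + B + C :=
  (abs_add_three _ _ _).trans (add_le_add (add_le_add ha hb) hc)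

set_option maxSynthPendingDepth 4 in
/-- The `L¹` distance to the Fokker–Planck solution is controlled by the self-consistency
potential. -/
lemma integral_abs_sub_le_Rloss (hd : 0 < d) (hl : 0 < l) (hT : 0 < T) {L₀ Lf Lv : ℝ}
    {f : ℝ → E d → E d} {V : ℝ → E d → ℝ} {α₀ : E d → ℝ} {ρ α : ℝ → E d → ℝ}
    (hfs : ∀ t, ContDiff ℝ (⊤ : ℕ∞) (f t)) (hfc : Continuous (Function.uncurry f))
    (hVs : ∀ t, ContDiff ℝ (⊤ : ℕ∞) (V t)) (hα₀ : InitDensity d l α₀) (hA1 : RegInit d l L₀ α₀)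
    (hA2 : RegVel d l T Lf f) (hA3 : RegPot d l T Lv V) (hρ : TransportedBy d l f α₀ ρ)
    (hα : SolvesFPE d l V α₀ α) {t ε : ℝ} (ht : t ∈ Icc 0 T) (hε : 0 < ε) :
    (∫ x in box d l, ρ t x = ∫ x in box d l, α t x) ∧
    ∫ x in box d l, |ρ t x - α t x| ≤ 1 / ε * (1 / 4 * Rloss d l T f V ρ) + ε := by
  obtain ⟨B, hB0, hB⟩ := hA3.exists_pd_bound hl hVs
  obtain ⟨C, hC⟩ := hρ.tpData hl hT hfs hfc hA1 hA2
  obtain ⟨D, hD0, hD⟩ := hρ.exists_pd_log_bound hl hT hfs hfc hA1 hA2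
  have hF := hα.fpData hl hB0 (fun t ht => ⟨hVs t, (hA3 t ht).1⟩) hVs
    fun t ht x i j => ⟨(hB t ht x i j j).1, (hB t ht x i j j).2.1⟩
  obtain ⟨M, -, -, -, hM, -⟩ := hC.exists_bounds
  have h0 : ∀ x, ρ 0 x = α 0 x := fun x => by rw [hρ.2.2.2.1, hα.2.2.2.1]
  have h1 : ∫ x in box d l, α 0 x = 1 := by rw [hα.2.2.2.1]; exact hα₀.2.2.2
  have h0T : (0 : ℝ) ∈ Icc 0 T := ⟨le_rfl, hT.le⟩
  have sf : ∀ t ∈ Icc 0 T, ∀ k, SP l fun x => f t x k := hC.sv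
  have sV : ∀ t ∈ Icc 0 T, ∀ k, SP l (pd k (V t)) := fun t ht k => (hF.sV t ht).pd k
  have sρ : ∀ t ∈ Icc 0 T, ∀ k, SP l (pd k fun y => Real.log (ρ t y)) :=
    fun t ht k => (hC.slog ht).pd k
  have hcoord : ∀ t k, (fun y => deltaF f V ρ t y k) =
      fun y => f t y k + pd k (V t) y + pd k (fun z => Real.log (ρ t z)) y := fun t k =>
    funext fun y => deltaF_apply f V ρ t y k
  have mρ : MeasField l fun t : Icc (0 : ℝ) T => ρ t := by
    refine ⟨fun t => hC.sρ t t.2, fun x => Continuous.measurable ?_⟩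
    have : ContinuousOn (fun t => ρ t x) (Icc 0 T) := fun t ht =>
      (hC.der t ht x).continuousAt.continuousWithinAt
    exact continuousOn_iff_continuous_domRestrict.1 this
  have mf : ∀ k, MeasField l fun (t : Icc (0 : ℝ) T) x => f t x k := fun k => by
    refine ⟨fun t => sf t t.2 k, fun x => Continuous.measurable ?_⟩
    have h2 : Continuous fun t : Icc (0 : ℝ) T => f t x :=
      hfc.comp (f := fun t : Icc (0 : ℝ) T => ((t : ℝ), x)) (by fun_prop)
    exact (EuclideanSpace.proj (𝕜 := ℝ) k).continuous.comp h2
  have mR : ∀ k, MeasField l fun (t : Icc (0 : ℝ) T) x => deltaF f V ρ t x k := fun k => by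
    have he : (fun (t : Icc (0 : ℝ) T) x => deltaF f V ρ t x k) = fun (t : Icc (0 : ℝ) T) x =>
        f t x k + pd k (V t) x + pd k (fun z => Real.log (ρ t z)) x := funext fun t => hcoord t k
    rw [he]
    exact ((mf k).add (measField_pd_potential hF hB0
      (fun t ht x i j => (hB t ht x i j j).2.1) k)).add ((mρ.log fun t => hC.pos t t.2).pd k)
  have hbd : ∀ t ∈ Icc 0 T, ∀ x, ∀ i j k, |deltaF f V ρ t x k| ≤ max C Lf + B + D ∧
      |pd i (fun y => deltaF f V ρ t y k) x| ≤ max C Lf + B + D ∧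
      |pd i (pd j (fun y => deltaF f V ρ t y k)) x| ≤ max C Lf + B + D := by
    intro t ht x i j k
    rw [deltaF_apply, hcoord, pd_add_add (sf t ht k).differentiable (sV t ht k).differentiable
      (sρ t ht k).differentiable i, pd_add_add (sf t ht k).differentiable
      (sV t ht k).differentiable (sρ t ht k).differentiable j,
      pd_add_add ((sf t ht k).pd j).differentiable ((sV t ht k).pd j).differentiable
      ((sρ t ht k).pd j).differentiable i]
    have hv := hA2.abs_pd_le hl hfs ht x i j k
    have hb := hB t ht x k
    have hd := hD t ht x k
    exact ⟨abs_add_add_le ((hC.bv t ht x k).trans (le_max_left _ _)) (hb i j).1 (hd i j).1,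
      abs_add_add_le (hv.1.trans (le_max_right _ _)) (hb i j).2.1 (hd i j).2.1,
      abs_add_add_le (hv.2.trans (le_max_right _ _)) (hb j i).2.2 (hd j i).2.2⟩
  set Φ : ℝ → ℝ := fun t => ∫ x in box d l, (‖deltaF f V ρ t x‖ ^ 2
    + ‖fderiv ℝ (deltaF f V ρ t) x‖ ^ 2
    + ‖fderiv ℝ (fun y => fderiv ℝ (deltaF f V ρ t) y) x‖ ^ 2) * ρ t x with hΦ
  have hΦi : IntegrableOn Φ (Icc 0 T) :=
    integrableOn_integral_jet mR mρ hbd fun t ht x => (hM t ht x).1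
  have hle : ∀ t ∈ Icc 0 T,
      ∫ x in box d l, (∑ i, resid f V ρ i t x ^ 2) * ρ t x ≤ Φ t := fun t ht => by
    have hs : ContDiff ℝ (⊤ : ℕ∞) (deltaF f V ρ t) :=
      contDiff_coord_iff.2 fun k => ((mR k).sp ⟨t, ht⟩).smooth
    have hs1 : ContDiff ℝ (⊤ : ℕ∞) (fderiv ℝ (deltaF f V ρ t)) := hs.fderiv_right (by simp)
    have hs2 : ContDiff ℝ (⊤ : ℕ∞) (fderiv ℝ (fun y => fderiv ℝ (deltaF f V ρ t) y)) :=
      hs1.fderiv_right (by simp)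
    have hcρ := (hC.sρ t ht).continuous
    have heq : ∀ x, ∑ i, resid f V ρ i t x ^ 2 = ‖deltaF f V ρ t x‖ ^ 2 := fun x => by
      simp only [EuclideanSpace.real_norm_sq_eq, deltaF_apply]
    simp only [heq]
    have c0 := hs.continuous
    have c1 := hs1.continuous
    have c2 := hs2.continuous
    refine setIntegral_mono (integrableOn_box (by fun_prop)) (integrableOn_box (by fun_prop))
      fun x => ?_
    refine mul_le_mul_of_nonneg_right ?_ (hC.pos t ht x).le
    exact (le_add_of_nonneg_right (sq_nonneg _)).trans (le_add_of_nonneg_right (sq_nonneg _))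
  have hmono : ∫ s in (0 : ℝ)..t, Φ s ≤ Rloss d l T f V ρ := by
    refine intervalIntegral.integral_mono_interval le_rfl ht.1 ht.2 ?_
      ((intervalIntegrable_iff_integrableOn_Icc_of_le hT.le).2 hΦi)
    exact Filter.Eventually.of_forall fun s => integral_nonneg fun x =>
      mul_nonneg (by positivity) (hρ.2.1 s x).le
  refine ⟨?_, (integral_abs_sub_le hd hC hF h0 h1 hΦi hle ht hε).trans ?_⟩
  · rw [hC.integral_eq ht, hF.integral_eq hd hT ht]
    simp only [h0]
  · gcongr

lemma tendsto_of_le_div_add {a r : ℕ → ℝ} (h0 : ∀ n, 0 ≤ a n)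
    (hr : Filter.Tendsto r Filter.atTop (nhds 0))
    (h : ∀ ε > 0, ∀ n, a n ≤ 1 / ε * (1 / 4 * r n) + ε) :
    Filter.Tendsto a Filter.atTop (nhds 0) := by
  refine Metric.tendsto_atTop.2 fun ε hε => ?_
  have h2 : Filter.Tendsto (fun n => 1 / (ε / 2) * (1 / 4 * r n)) Filter.atTop (nhds 0) := by
    simpa using (hr.const_mul (1 / 4 : ℝ)).const_mul (1 / (ε / 2))
  obtain ⟨N, hN⟩ := Filter.eventually_atTop.1 (h2.eventually_lt_const (half_pos hε))
  refine ⟨N, fun n hn => ?_⟩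
  rw [Real.dist_eq, sub_zero, abs_of_nonneg (h0 n)]
  have := h (ε / 2) (half_pos hε) n
  have := hN n hn
  linarith

end

/-- corollary of the main theorem: under assumptions (A1)–(A3), if
`{f_n}` is a sequence of hypothesis velocity fields with `R(f_n) → 0`, then for every
`t ∈ [0,T]`, `W₂²(ρ¹(t,·;f_n), α(t,·)) → 0` as `n → ∞`. -/
theorem vanishing_self_consistency_recovers_FPE_solution
    (d : ℕ) (hd : 0 < d) (l T L₀ Lf Lv : ℝ) (hl : 0 < l) (hT : 0 < T)
    (fs : ℕ → ℝ → E d → E d) (Ks : ℕ → NNReal) (V : ℝ → E d → ℝ)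
    (α₀ : E d → ℝ) (ρs : ℕ → ℝ → E d → ℝ) (αs : ℝ → E d → ℝ)
    (hfsmooth : ∀ n t, ContDiff ℝ (⊤ : ℕ∞) (fs n t))
    (hfcont : ∀ n, Continuous (Function.uncurry (fs n)))
    (hfLip : ∀ n t, LipschitzWith (Ks n) (fs n t))
    (hVsmooth : ∀ t, ContDiff ℝ (⊤ : ℕ∞) (V t))
    (hα₀ : InitDensity d l α₀) (hA1 : RegInit d l L₀ α₀)
    (hA2 : ∀ n, RegVel d l T Lf (fs n)) (hA3 : RegPot d l T Lv V)
    (hρ : ∀ n, TransportedBy d l (fs n) α₀ (ρs n))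
    (hFPE : SolvesFPE d l V α₀ αs)
    (hR : Filter.Tendsto (fun n => Rloss d l T (fs n) V (ρs n))
      Filter.atTop (nhds 0)) :
    ∀ t ∈ Icc (0 : ℝ) T,
      Filter.Tendsto (fun n => W2sq (densM l (ρs n t)) (densM l (αs t)))
        Filter.atTop (nhds 0) := by
  intro t ht
  have key := fun n ε (hε : 0 < ε) => integral_abs_sub_le_Rloss hd hl hT (hfsmooth n) (hfcont n)
    hVsmooth hα₀ hA1 (hA2 n) hA3 (hρ n) hFPE ht hε
  have hlim := tendsto_of_le_div_add (fun n => integral_nonneg fun x => abs_nonneg _) hR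
    fun ε hε n => (key n ε hε).2
  obtain ⟨D, hD⟩ := Metric.isBounded_iff.1 (isCompact_box d l).isBounded
  have hW : ∀ n, W2sq (densM l (ρs n t)) (densM l (αs t)) ≤ ENNReal.ofReal (D ^ 2) *
      ENNReal.ofReal (∫ x in box d l, |ρs n t x - αs t x|) := fun n =>
    W2sq_densM_le ((hρ n).1 t).continuous (hFPE.1 t).continuous (fun x => ((hρ n).2.1 t x).le)
      (fun x => (hFPE.2.1 t x).le) (key n 1 one_pos).1 fun x hx y hy =>
      ENNReal.ofReal_le_ofReal (pow_le_pow_left₀ (norm_nonneg _)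
        (by simpa [dist_eq_norm] using hD hx hy) 2)
  have hlim' : Filter.Tendsto (fun n => ENNReal.ofReal (D ^ 2) *
      ENNReal.ofReal (∫ x in box d l, |ρs n t x - αs t x|)) Filter.atTop (nhds 0) := by
    simpa using ENNReal.Tendsto.const_mul (ENNReal.tendsto_ofReal hlim)
      (Or.inr ENNReal.ofReal_ne_top)
  exact tendsto_of_tendsto_of_tendsto_of_le_of_le tendsto_const_nhds hlim' (fun n => bot_le) hW
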